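/- Let (R, 𝔪) be a complete regular local ring of mixed characteristic (0, p) (i.e. R has characteristic 0 and its residue field has characteristic p > 0), whose residue field is algebraically closed, and let (x_1, …, x_n, y_1, …, y_m) be a regular system of parameters of R (a family of n + m = dim R elements generating 𝔪). Set S := R[1/(y_1 ⋯ y_m)]. Let W be a finite étale S-algebra which is an integral domain, equipped with a finite group G of S-algebra automorphisms of W such that the invariant subring W^G equals S, the order |G| equals the rank of W as a projective S-module, and gcd(|G|, p) = 1 (i.e. W is a Galois étale extension of S of degree prime to p). Then there exist a positive integer e coprime to p and an injective S-algebra homomorphism from W into the ring R_e[1/(y_1 ⋯ y_m)], where R_e := R[T_1, …, T_m]/(T_1^e − y_1, …, T_m^e − y_m). (Equivalently: the maximal prime-to-p Galois étale extension of S is generated by the prime-to-p roots of the y_i.) -/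

import Mathlib

open scoped BigOperators

/-- The ring `R_e = R[T_1, …, T_m]/(T_1^e − y_1, …, T_m^e − y_m)` obtained by adjoining
`e`-th roots of the elements `y j` to `R`. -/
noncomputable abbrev KummerRing (R : Type) [CommRing R] (m : ℕ) (y : Fin m → R) (e : ℕ) :
    Type :=
  MvPolynomial (Fin m) R ⧸
    Ideal.span (Set.range fun j : Fin m => MvPolynomial.X j ^ e - MvPolynomial.C (y j))

open IsLocalRing

/-- `Z` is a regular system of parameters of the local ring `A`. -/
structure IsRegularParams (A : Type*) [CommRing A] [IsLocalRing A] (Z : Finset A) : Prop where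
  span_eq : Ideal.span (Z : Set A) = maximalIdeal A
  card_le : (Z.card : WithBot ℕ∞) ≤ ringKrullDim A

lemma nontrivial_quotient_span {A : Type*} [CommRing A] [IsLocalRing A] {f : A}
    (hf : f ∈ maximalIdeal A) : Nontrivial (A ⧸ Ideal.span {f}) :=
  Ideal.Quotient.nontrivial_iff.mpr fun h =>
    (maximalIdeal.isMaximal A).ne_top (top_le_iff.mp
      (h ▸ (Ideal.span_singleton_le_iff_mem _).mpr hf))

lemma isLocalRing_quotient_span {A : Type*} [CommRing A] [IsLocalRing A] {f : A}
    (hf : f ∈ maximalIdeal A) : IsLocalRing (A ⧸ Ideal.span {f}) :=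
  haveI := nontrivial_quotient_span hf
  IsLocalRing.of_surjective' _ Ideal.Quotient.mk_surjective

lemma WithBot.natCast_le_of_succ_le {a b : ℕ} {d : WithBot ℕ∞} (h : a + 1 ≤ b)
    (hb : (b : WithBot ℕ∞) ≤ d + 1) : (a : WithBot ℕ∞) ≤ d := by
  have h1 : ((a + 1 : ℕ) : WithBot ℕ∞) ≤ d + 1 := le_trans (by exact_mod_cast h) hb
  induction d using WithBot.recBotCoe with
  | bot => simp at h1
  | coe d =>
    have h2 : ((a + 1 : ℕ) : ℕ∞) ≤ d + 1 := by exact_mod_cast h1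
    have h3 : (a : ℕ∞) ≤ d := by
      push_cast at h2
      exact (ENat.add_le_add_iff_right (by simp)).mp h2
    exact_mod_cast h3

open Classical in
lemma IsRegularParams.quotient {A : Type*} [CommRing A] [IsLocalRing A] [IsNoetherianRing A]
    {Z : Finset A} (hZ : IsRegularParams A Z) {f z u : A} (hf : f ∈ maximalIdeal A)
    (hz : z ∈ Z) (hu : IsUnit u) (hfz : f - u * z ∈ Ideal.span ((Z.erase z : Finset A) : Set A))
    [IsLocalRing (A ⧸ Ideal.span {f})] :
    IsRegularParams (A ⧸ Ideal.span {f})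
      ((Z.erase z).image (Ideal.Quotient.mk (Ideal.span {f}))) := by
  constructor
  · rw [Finset.coe_image, ← Ideal.map_span]
    have hmap : Ideal.map (Ideal.Quotient.mk (Ideal.span {f})) (maximalIdeal A) =
        maximalIdeal (A ⧸ Ideal.span {f}) :=
      IsLocalRing.map_maximalIdeal_of_surjective _ Ideal.Quotient.mk_surjective
    rw [← hmap]
    apply le_antisymm
    · apply Ideal.map_mono
      rw [← hZ.span_eq]
      exact Ideal.span_mono (by simp)
    · rw [← hZ.span_eq, Ideal.map_span, Ideal.span_le]
      rintro _ ⟨w, hw, rfl⟩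
      by_cases hwz : w = z
      · subst hwz
        obtain ⟨v, hv⟩ := hu.exists_left_inv
        have : Ideal.Quotient.mk (Ideal.span {f}) w =
            Ideal.Quotient.mk (Ideal.span {f}) (- v * (f - u * w)) := by
          rw [Ideal.Quotient.eq, Ideal.mem_span_singleton]
          exact ⟨v, by linear_combination (-w) * hv⟩
        rw [this]
        exact Ideal.mem_map_of_mem _ (Ideal.mul_mem_left _ _ hfz)
      · exact Ideal.mem_map_of_mem _ (Ideal.subset_span (by simp [hwz]; exact hw))
  · have h1 := ringKrullDim_le_ringKrullDim_quotient_add_card (R := A) {f} (by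
      simpa [IsLocalRing.ringJacobson_eq_maximalIdeal] using hf)
    rw [Finset.coe_singleton, Finset.card_singleton, Nat.cast_one] at h1
    refine WithBot.natCast_le_of_succ_le (b := Z.card) ?_ (hZ.card_le.trans h1)
    have h2 := Finset.card_image_le (s := Z.erase z) (f := Ideal.Quotient.mk (Ideal.span {f}))
    have h3 := Finset.card_erase_add_one hz
    omega

lemma exists_mem_not_mem_sq_minimalPrimes {A : Type*} [CommRing A] [IsLocalRing A]
    [IsNoetherianRing A] (h2 : maximalIdeal A ≠ ⊥) (hm : maximalIdeal A ∉ minimalPrimes A) :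
    ∃ f ∈ maximalIdeal A, f ∉ maximalIdeal A ^ 2 ∧ ∀ P ∈ minimalPrimes A, f ∉ P := by
  classical
  have hfin : (minimalPrimes A).Finite := minimalPrimes.finite_of_isNoetherianRing A
  by_contra! hcon
  have hsub : (maximalIdeal A : Set A) ⊆ ⋃ i ∈ ((insert (maximalIdeal A ^ 2) hfin.toFinset : Finset (Ideal A)) : Set (Ideal A)),
      ((id i : Ideal A) : Set A) := by
    intro f hf
    by_cases h : f ∈ maximalIdeal A ^ 2
    · exact Set.mem_biUnion (by simp) h
    · obtain ⟨P, hP, hfP⟩ := hcon f hf h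
      exact Set.mem_biUnion (by simp [hP]) hfP
  rw [Ideal.subset_union_prime (maximalIdeal A ^ 2) (maximalIdeal A ^ 2)] at hsub
  · obtain ⟨P, hP, hle⟩ := hsub
    simp only [Finset.mem_insert, Set.Finite.mem_toFinset] at hP
    rcases hP with rfl | hP
    · have := Submodule.eq_bot_of_le_smul_of_le_jacobson_bot (maximalIdeal A) (maximalIdeal A)
        (IsNoetherian.noetherian _) (by simpa [pow_two] using hle)
        (IsLocalRing.maximalIdeal_le_jacobson _)
      exact h2 this
    · have : P = maximalIdeal A :=
        ((maximalIdeal.isMaximal A).eq_of_le (hP.1.1.ne_top) hle).symm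
      exact hm (this ▸ hP)
  · intro i hi h _
    simp only [Finset.mem_insert, Set.Finite.mem_toFinset] at hi
    exact (hi.resolve_left h).1.1

lemma isDomain_of_isPrime_span_singleton {A : Type*} [CommRing A] [IsLocalRing A]
    [IsNoetherianRing A] {f : A} (hf : f ∈ maximalIdeal A) (hp : (Ideal.span {f}).IsPrime)
    (hmin : ∀ P ∈ minimalPrimes A, f ∉ P) : IsDomain A := by
  obtain ⟨P, hP, hle⟩ := Ideal.exists_minimalPrimes_le (I := ⊥) (J := Ideal.span {f}) bot_le
  have hPp : P.IsPrime := hP.1.1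
  have hbot : P = ⊥ := by
    refine Submodule.eq_bot_of_le_smul_of_le_jacobson_bot (Ideal.span {f}) P
      (IsNoetherian.noetherian _) ?_ ?_
    · intro a ha
      obtain ⟨b, rfl⟩ := Ideal.mem_span_singleton'.mp (hle ha)
      have hb : b ∈ P := (hPp.mem_or_mem ha).resolve_right (hmin P hP)
      rw [mul_comm]
      exact Ideal.mul_mem_mul (Ideal.mem_span_singleton_self f) hb
    · rw [Ideal.span_singleton_le_iff_mem]
      exact IsLocalRing.maximalIdeal_le_jacobson _ hf
  subst hbot
  exact IsDomain.of_bot_isPrime A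

theorem IsRegularParams.isDomain {A : Type*} [CommRing A] [IsLocalRing A] [IsNoetherianRing A]
    {Z : Finset A} (hZ : IsRegularParams A Z) : IsDomain A := by
  classical
  induction hn : Z.card using Nat.strong_induction_on generalizing A with
  | h n ih =>
  rcases Z.eq_empty_or_nonempty with rfl | hne
  · have h := hZ.span_eq
    simp only [Finset.coe_empty, Ideal.span_empty] at h
    have : (⊥ : Ideal A).IsPrime := h ▸ inferInstance
    exact IsDomain.of_bot_isPrime A
  · have hdim : (1 : WithBot ℕ∞) ≤ ringKrullDim A := le_trans (by
      exact_mod_cast hne.card_pos) hZ.card_le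
    have hm : maximalIdeal A ∉ minimalPrimes A := by
      intro h
      have : (maximalIdeal A).height = 0 := by
        rwa [Ideal.height_eq_zero_iff]
      rw [← IsLocalRing.maximalIdeal_height_eq_ringKrullDim, this] at hdim
      exact absurd hdim (by decide)
    obtain ⟨f, hf, hf2, hmin⟩ := exists_mem_not_mem_sq_minimalPrimes (A := A) (by
      intro h
      refine hm ?_
      rw [h]
      refine ⟨⟨h ▸ inferInstance, bot_le⟩, fun _ _ _ => bot_le⟩) hm
    have hloc := isLocalRing_quotient_span hf
    have hf' := hf
    rw [← hZ.span_eq, Submodule.mem_span_finset] at hf'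
    obtain ⟨c, -, hc⟩ := hf'
    have : ∃ z ∈ Z, IsUnit (c z) := by
      by_contra! h
      refine hf2 (hc ▸ Ideal.sum_mem _ fun z hz => ?_)
      rw [pow_two, smul_eq_mul]
      exact Ideal.mul_mem_mul (h z hz) (hZ.span_eq ▸ Ideal.subset_span hz)
    obtain ⟨z, hz, hu⟩ := this
    have hq := hZ.quotient (f := f) hf hz hu (by
      rw [← hc, ← Finset.add_sum_erase _ _ hz, smul_eq_mul, add_sub_cancel_left]
      exact Ideal.sum_mem _ fun w hw => Ideal.mul_mem_left _ _ (Ideal.subset_span hw))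
    have hcard : ((Z.erase z).image (Ideal.Quotient.mk (Ideal.span {f}))).card < n := by
      have h2 := Finset.card_image_le (s := Z.erase z) (f := Ideal.Quotient.mk (Ideal.span {f}))
      have h3 := Finset.card_erase_add_one hz
      omega
    have := ih _ hcard hq rfl
    exact isDomain_of_isPrime_span_singleton hf
      ((Ideal.Quotient.isDomain_iff_prime _).mp this) hmin

lemma IsRegularParams.card_eq {A : Type*} [CommRing A] [IsLocalRing A] [IsNoetherianRing A]
    {Z : Finset A} (hZ : IsRegularParams A Z) {Z' : Finset A}
    (hZ' : Ideal.span (Z' : Set A) = maximalIdeal A) : Z.card ≤ Z'.card := by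
  have h1 := hZ.card_le.trans (ringKrullDim_le_spanFinrank_maximalIdeal A)
  rw [← hZ'] at h1
  have h2 : (Ideal.span (Z' : Set A)).spanFinrank ≤ Z'.card := by
    simpa using Submodule.spanFinrank_span_le_ncard_of_finite (R := A) Z'.finite_toSet
  have h3 : Z.card ≤ (Ideal.span (Z' : Set A)).spanFinrank := by exact_mod_cast h1
  exact h3.trans h2

lemma IsRegularParams.ne_zero {A : Type*} [CommRing A] [IsLocalRing A] [IsNoetherianRing A]
    {Z : Finset A} (hZ : IsRegularParams A Z) {z : A} (hz : z ∈ Z) : z ≠ 0 := by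
  classical
  rintro rfl
  have := hZ.card_eq (Z' := Z.erase 0) (by
    rw [← hZ.span_eq, Finset.coe_erase, Ideal.span, Submodule.span_sdiff_singleton_zero])
  have h3 := Finset.card_erase_add_one hz
  omega

lemma IsRegularParams.mem {A : Type*} [CommRing A] [IsLocalRing A]
    {Z : Finset A} (hZ : IsRegularParams A Z) {z : A} (hz : z ∈ Z) : z ∈ maximalIdeal A :=
  hZ.span_eq ▸ Ideal.subset_span hz

lemma IsRegularParams.prime {A : Type*} [CommRing A] [IsLocalRing A] [IsNoetherianRing A]
    {Z : Finset A} (hZ : IsRegularParams A Z) {z : A} (hz : z ∈ Z) : Prime z := by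
  classical
  have := isLocalRing_quotient_span (hZ.mem hz)
  have h := (hZ.quotient (f := z) (u := 1) (hZ.mem hz) hz isUnit_one (by simp)).isDomain
  rw [← Ideal.span_singleton_prime (hZ.ne_zero hz)]
  exact (Ideal.Quotient.isDomain_iff_prime _).mp h

lemma exists_quotient_isRegularParams {A : Type*} [CommRing A] [IsLocalRing A] [IsNoetherianRing A]
    {Z : Finset A} (hZ : IsRegularParams A Z) {ι : Type*} (y : ι → A) (hy : ∀ j, y j ∈ Z)
    (hne : Z.Nonempty) (hcase : ∀ z, Z = {z} → IsEmpty ι) :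
    ∃ f ∈ maximalIdeal A, Prime f ∧ ∀ [IsLocalRing (A ⧸ Ideal.span {f})],
      ∃ Z' : Finset (A ⧸ Ideal.span {f}), IsRegularParams _ Z' ∧ Z'.card < Z.card ∧
      ∀ j, Ideal.Quotient.mk (Ideal.span {f}) (y j) ∈ Z' := by
  classical
  have hcard : ∀ z ∈ Z, ∀ f : A,
      ((Z.erase z).image (Ideal.Quotient.mk (Ideal.span {f}))).card < Z.card := by
    intro z hz f
    have h2 := Finset.card_image_le (s := Z.erase z) (f := Ideal.Quotient.mk (Ideal.span {f}))
    have h3 := Finset.card_erase_add_one hz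
    omega
  by_cases h : ∃ z ∈ Z, ∀ j, y j ≠ z
  · obtain ⟨z, hz, hyz⟩ := h
    refine ⟨z, hZ.mem hz, hZ.prime hz, fun {_} => ⟨_, hZ.quotient (f := z) (u := 1) (hZ.mem hz) hz
      isUnit_one (by simp), hcard z hz z, fun j => ?_⟩⟩
    exact Finset.mem_image_of_mem _ (Finset.mem_erase.mpr ⟨hyz j, hy j⟩)
  · push Not at h
    obtain ⟨z, hz⟩ := hne
    have : ∃ w ∈ Z, w ≠ z := by
      by_contra! hw
      have hZz : Z = {z} := Finset.eq_singleton_iff_unique_mem.mpr ⟨hz, hw⟩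
      obtain ⟨j, -⟩ := h z hz
      exact (hcase z hZz).false j
    obtain ⟨w, hw, hwz⟩ := this
    have hf : z - w ∈ maximalIdeal A := sub_mem (hZ.mem hz) (hZ.mem hw)
    have hwe : w ∈ Z.erase z := Finset.mem_erase.mpr ⟨hwz, hw⟩
    have key : ∀ [IsLocalRing (A ⧸ Ideal.span {z - w})], IsRegularParams (A ⧸ Ideal.span {z - w})
      ((Z.erase z).image (Ideal.Quotient.mk (Ideal.span {z - w}))) := fun {_} =>
      hZ.quotient (f := z - w) (u := 1) hf hz isUnit_one (by
        rw [one_mul, sub_sub_cancel_left]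
        exact neg_mem (Ideal.subset_span hwe))
    refine ⟨z - w, hf, ?_, fun {_} => ⟨_, key, hcard z hz _, fun j => ?_⟩⟩
    · have := isLocalRing_quotient_span hf
      have := key.isDomain
      rw [← Ideal.span_singleton_prime (sub_ne_zero.mpr hwz.symm)]
      exact (Ideal.Quotient.isDomain_iff_prime _).mp this
    · by_cases hj : y j = z
      · have : Ideal.Quotient.mk (Ideal.span {z - w}) (y j) =
            Ideal.Quotient.mk (Ideal.span {z - w}) w := by
          rw [Ideal.Quotient.eq, hj]
          exact Ideal.mem_span_singleton_self _
        rw [this]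
        exact Finset.mem_image_of_mem _ hwe
      · exact Finset.mem_image_of_mem _ (Finset.mem_erase.mpr ⟨hj, hy j⟩)

section SplitSums

variable {G E : Type} [Group G] [CommRing E]

/-- `φ` is of the form `σ ↦ ∑ k, x k * ρ σ (y k)` with `x k`, `y k` in `C`. -/
def IsSplitSum (ρ : G →* (E →+* E)) (C : Subring E) (φ : G → E) : Prop :=
  ∃ (κ : Type) (_ : Fintype κ) (x y : κ → E), (∀ k, x k ∈ C) ∧ (∀ k, y k ∈ C) ∧
    ∀ σ, φ σ = ∑ k, x k * ρ σ (y k)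

/-- The function equal to `s` at `1` and to `0` elsewhere is a split sum. -/
def IsDelta (ρ : G →* (E →+* E)) (C : Subring E) (s : E) : Prop :=
  ∃ (κ : Type) (_ : Fintype κ) (x y : κ → E), (∀ k, x k ∈ C) ∧ (∀ k, y k ∈ C) ∧
    ∑ k, x k * y k = s ∧ ∀ σ, σ ≠ 1 → ∑ k, x k * ρ σ (y k) = 0

variable {ρ : G →* (E →+* E)} {C : Subring E}

lemma IsSplitSum.isDelta {φ : G → E} (h : IsSplitSum ρ C φ) (h0 : ∀ σ, σ ≠ 1 → φ σ = 0) :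
    IsDelta ρ C (φ 1) := by
  obtain ⟨κ, _, x, y, hx, hy, hφ⟩ := h
  refine ⟨κ, inferInstance, x, y, hx, hy, by simp [hφ], fun σ hσ => ?_⟩
  rw [← hφ, h0 σ hσ]

lemma IsSplitSum.mul {φ ψ : G → E} (h : IsSplitSum ρ C φ) (h' : IsSplitSum ρ C ψ) :
    IsSplitSum ρ C (fun σ => φ σ * ψ σ) := by
  obtain ⟨κ, _, x, y, hx, hy, hφ⟩ := h
  obtain ⟨κ', _, x', y', hx', hy', hψ⟩ := h'
  refine ⟨κ × κ', inferInstance, fun k => x k.1 * x' k.2, fun k => y k.1 * y' k.2,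
    fun k => mul_mem (hx _) (hx' _), fun k => mul_mem (hy _) (hy' _), fun σ => ?_⟩
  simp only [hφ, hψ]
  rw [Finset.sum_mul_sum, Fintype.sum_prod_type]
  exact Finset.sum_congr rfl fun k _ => Finset.sum_congr rfl fun k' _ => by
    rw [map_mul]; ring

lemma isSplitSum_one : IsSplitSum ρ C (fun _ => 1) :=
  ⟨Unit, inferInstance, fun _ => 1, fun _ => 1, fun _ => one_mem _, fun _ => one_mem _, by simp⟩

lemma isSplitSum_prod {α : Type} (s : Finset α) (φ : α → G → E)
    (h : ∀ i ∈ s, IsSplitSum ρ C (φ i)) : IsSplitSum ρ C (fun σ => ∏ i ∈ s, φ i σ) := by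
  classical
  induction s using Finset.induction_on with
  | empty => simpa using isSplitSum_one
  | insert a s ha ih =>
    simp only [Finset.prod_insert ha]
    exact (h a (by simp)).mul (ih fun i hi => h i (by simp [hi]))

lemma IsDelta.mul_left {s c : E} (h : IsDelta ρ C s) (hc : c ∈ C) : IsDelta ρ C (c * s) := by
  obtain ⟨κ, _, x, y, hx, hy, h1, h2⟩ := h
  refine ⟨κ, inferInstance, fun k => c * x k, y, fun k => mul_mem hc (hx k), hy, ?_, fun σ hσ => ?_⟩
  · simp_rw [mul_assoc, ← Finset.mul_sum, h1]
  · simp_rw [mul_assoc, ← Finset.mul_sum, h2 σ hσ, mul_zero]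

lemma IsDelta.add {s t : E} (h : IsDelta ρ C s) (h' : IsDelta ρ C t) : IsDelta ρ C (s + t) := by
  obtain ⟨κ, _, x, y, hx, hy, h1, h2⟩ := h
  obtain ⟨κ', _, x', y', hx', hy', h1', h2'⟩ := h'
  refine ⟨κ ⊕ κ', inferInstance, Sum.elim x x', Sum.elim y y', ?_, ?_, ?_, fun σ hσ => ?_⟩
  · rintro (k | k) <;> simp [hx, hx']
  · rintro (k | k) <;> simp [hy, hy']
  · simp [Fintype.sum_sum_type, h1, h1']
  · simp [Fintype.sum_sum_type, h2 σ hσ, h2' σ hσ]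

lemma isDelta_zero : IsDelta ρ C 0 :=
  ⟨Empty, inferInstance, Empty.elim, Empty.elim, fun k => k.elim, fun k => k.elim, by simp, by simp⟩

lemma IsDelta.map {E' : Type} [CommRing E'] {ρ' : G →* (E' →+* E')} {C' : Subring E'}
    (g : E →+* E') (hg : ∀ σ e, g (ρ σ e) = ρ' σ (g e)) (hC : ∀ c ∈ C, g c ∈ C') {s : E}
    (h : IsDelta ρ C s) : IsDelta ρ' C' (g s) := by
  obtain ⟨κ, _, x, y, hx, hy, h1, h2⟩ := h
  refine ⟨κ, inferInstance, fun k => g (x k), fun k => g (y k), fun k => hC _ (hx k), fun k => hC _ (hy k),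
    by simp [← h1], fun σ hσ => ?_⟩
  simp only [← hg, ← map_mul, ← map_sum, h2 σ hσ, map_zero]

/-- The ideal of all `a` such that `i a` is a delta. -/
def deltaIdeal {A : Type} [CommRing A] (i : A →+* E) (ρ : G →* (E →+* E)) (C : Subring E)
    (hC : ∀ a, i a ∈ C) : Ideal A where
  carrier := {a | IsDelta ρ C (i a)}
  add_mem' h h' := by simpa using h.add h'
  zero_mem' := by simpa using isDelta_zero
  smul_mem' c a h := by simpa using IsDelta.mul_left h (hC c)

variable [Fintype G]

/-- The trace of a group action. -/
def gtr (ρ : G →* (E →+* E)) (e : E) : E := ∑ σ, ρ σ e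

lemma gtr_invariant (g : G) (e : E) : ρ g (gtr ρ e) = gtr ρ e := by
  unfold gtr
  rw [map_sum]
  refine Fintype.sum_equiv (Equiv.mulLeft g) _ _ fun σ => ?_
  simp [map_mul]

lemma gtr_mul_of_invariant {a : E} (ha : ∀ g, ρ g a = a) (e : E) :
    gtr ρ (a * e) = a * gtr ρ e := by
  simp [gtr, Finset.mul_sum, ha]

lemma gtr_of_invariant {a : E} (ha : ∀ g, ρ g a = a) : gtr ρ a = Fintype.card G * a := by
  simp [gtr, ha]

lemma gtr_add (a b : E) : gtr ρ (a + b) = gtr ρ a + gtr ρ b := by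
  simp [gtr, Finset.sum_add_distrib]

lemma gtr_sub (a b : E) : gtr ρ (a - b) = gtr ρ a - gtr ρ b := by
  simp [gtr]

lemma sum_mul_gtr {κ : Type} [Fintype κ] {x y : κ → E} {s : E} (h1 : ∑ k, x k * y k = s)
    (h2 : ∀ σ, σ ≠ 1 → ∑ k, x k * ρ σ (y k) = 0) (b : E) :
    ∑ k, x k * gtr ρ (y k * b) = s * b := by
  classical
  unfold gtr
  simp_rw [Finset.mul_sum]
  rw [Finset.sum_comm, Fintype.sum_eq_single 1]
  · simp [← h1, Finset.sum_mul, mul_assoc]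
  · intro σ hσ
    simp_rw [map_mul, ← mul_assoc, ← Finset.sum_mul, h2 σ hσ, zero_mul]

end SplitSums

/-- The subring of elements integral over `A`. -/
def intSub {A E : Type} [CommRing A] [CommRing E] (i : A →+* E) : Subring E where
  carrier := {e | i.IsIntegralElem e}
  mul_mem' h h' := h.mul i h'
  one_mem' := i.isIntegralElem_one
  add_mem' h h' := h.add i h'
  zero_mem' := i.isIntegralElem_zero
  neg_mem' h := h.neg i

lemma apply_mem_intSub {A E : Type} [CommRing A] [CommRing E] (i : A →+* E) (a : A) :
    i a ∈ intSub i := i.isIntegralElem_map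

lemma isIntegralElem_map_of_comp {A E A' E' : Type} [CommRing A] [CommRing E] [CommRing A']
    [CommRing E'] {i : A →+* E} {i' : A' →+* E'} (f : A →+* A') (g : E →+* E')
    (h : ∀ a, g (i a) = i' (f a)) {e : E} (he : i.IsIntegralElem e) :
    i'.IsIntegralElem (g e) := by
  obtain ⟨P, hP, hP0⟩ := he
  refine ⟨P.map f, hP.map f, ?_⟩
  rw [Polynomial.eval₂_map, ← RingHom.map_zero g, ← hP0, Polynomial.hom_eval₂]
  congr 1
  ext a
  exact (h a).symm

/-- A `G`-cover of `A` which is Galois away from the prime elements `y j` and tame along them. -/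
structure IsCover {ι G A E : Type} [Fintype ι] [Group G] [CommRing A] [CommRing E]
    (i : A →+* E) (ρ : G →* (E →+* E)) (y : ι → A) : Prop where
  inj : Function.Injective i
  unit : ∀ j, IsUnit (i (y j))
  fix : ∀ g a, ρ g (i a) = i a
  inv : ∀ e, (∀ g, ρ g e = e) → ∃ N a, i (∏ j, y j) ^ N * e = i a
  gal : ∃ N, IsDelta ρ (intSub i) (i (∏ j, y j) ^ N)
  tame : ∀ j, ∃ t, IsDelta ρ (intSub i) (i t) ∧ ¬ y j ∣ t

/-- A finite model of a `G`-cover of `A`, saturated along the prime elements `y j`. -/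
structure IsSatCover {ι G A B : Type} [Fintype ι] [Group G] [CommRing A] [CommRing B] [Algebra A B]
    (ρ : G →* (B →+* B)) (y : ι → A) : Prop where
  inj : Function.Injective (algebraMap A B)
  torsionFree : ∀ (a : A) (b : B), a ≠ 0 → algebraMap A B a * b = 0 → b = 0
  fix : ∀ g a, ρ g (algebraMap A B a) = algebraMap A B a
  inv : ∀ e, (∀ g, ρ g e = e) → ∃ a, algebraMap A B a = e
  sat : ∀ j a b, ¬ y j ∣ a → algebraMap A B (y j) ∣ algebraMap A B a * b →
    algebraMap A B (y j) ∣ b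
  gal : ∃ N, IsDelta ρ ⊤ (algebraMap A B ((∏ j, y j) ^ N))
  tame : ∀ j, ∃ t, IsDelta ρ ⊤ (algebraMap A B t) ∧ ¬ y j ∣ t

section Saturation

variable {ι G A E : Type} [Group G] [CommRing A] [CommRing E]
    {i : A →+* E} {ρ : G →* (E →+* E)} {y : ι → A}

/-- The elements of `E` that become integral after multiplication by a scalar prime to `y j`. -/
def satSub (i : A →+* E) (y : ι → A) (hy : ∀ j, Prime (y j)) : Subring E where
  carrier := {e | ∀ j, ∃ t, ¬ y j ∣ t ∧ i.IsIntegralElem (i t * e)}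
  mul_mem' {a b} h h' j := by
    obtain ⟨t, ht, hta⟩ := h j
    obtain ⟨t', ht', htb⟩ := h' j
    refine ⟨t * t', (hy j).not_dvd_mul ht ht', ?_⟩
    rw [map_mul, mul_mul_mul_comm]
    exact hta.mul i htb
  one_mem' j := ⟨1, (hy j).not_dvd_one, by simpa using i.isIntegralElem_one⟩
  add_mem' {a b} h h' j := by
    obtain ⟨t, ht, hta⟩ := h j
    obtain ⟨t', ht', htb⟩ := h' j
    refine ⟨t * t', (hy j).not_dvd_mul ht ht', ?_⟩
    have : i (t * t') * (a + b) = i t' * (i t * a) + i t * (i t' * b) := by rw [map_mul]; ring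
    rw [this]
    exact (i.isIntegralElem_map.mul i hta).add i (i.isIntegralElem_map.mul i htb)
  zero_mem' j := ⟨1, (hy j).not_dvd_one, by simpa using i.isIntegralElem_zero⟩
  neg_mem' {a} h j := by
    obtain ⟨t, ht, hta⟩ := h j
    exact ⟨t, ht, by simpa using hta.neg i⟩

lemma intSub_le_satSub (hy : ∀ j, Prime (y j)) {e : E} (he : i.IsIntegralElem e) :
    e ∈ satSub i y hy := fun j => ⟨1, (hy j).not_dvd_one, by simpa using he⟩

lemma exists_eq_of_mul_eq_of_mem_satSub (hy : ∀ j, Prime (y j)) (hi : Function.Injective i)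
    (hu : ∀ j, IsUnit (i (y j))) {e : E} (he : e ∈ satSub i y hy) {j : ι} {a : A}
    (h : i (y j) * e = i a) : ∃ a', e = i a' := by
  obtain ⟨t, ht, P, hP, hP0⟩ := he j
  have h1 := Polynomial.dvd_pow_natDegree_of_eval₂_eq_zero hi hP (y j) (t * a) (i t * e) hP0
    (by rw [map_mul, ← h]; ring)
  obtain ⟨a', rfl⟩ := ((hy j).dvd_or_dvd ((hy j).dvd_of_dvd_pow h1)).resolve_left ht
  exact ⟨a', (hu j).mul_left_cancel (by rw [h, map_mul])⟩

lemma exists_eq_of_prod_mul_eq (hy : ∀ j, Prime (y j)) (hi : Function.Injective i)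
    (hu : ∀ j, IsUnit (i (y j))) (s : Finset ι) {e : E} (he : e ∈ satSub i y hy) {a : A}
    (h : i (∏ j ∈ s, y j) * e = i a) : ∃ a', e = i a' := by
  classical
  induction s using Finset.induction_on generalizing a with
  | empty => exact ⟨a, by simpa using h⟩
  | insert j s hj ih =>
    rw [Finset.prod_insert hj, map_mul, mul_assoc] at h
    obtain ⟨a', ha'⟩ := exists_eq_of_mul_eq_of_mem_satSub hy hi hu
      (mul_mem (intSub_le_satSub hy (i.isIntegralElem_map (x := ∏ j ∈ s, y j))) he) h
    exact ih ha'

variable [Fintype ι]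

lemma exists_eq_of_prod_pow_mul_eq (hy : ∀ j, Prime (y j)) (hi : Function.Injective i)
    (hu : ∀ j, IsUnit (i (y j))) {N : ℕ} {e : E} (he : e ∈ satSub i y hy) {a : A}
    (h : i (∏ j, y j) ^ N * e = i a) : ∃ a', e = i a' := by
  induction N generalizing a with
  | zero => exact ⟨a, by simpa using h⟩
  | succ N ih =>
    rw [pow_succ', mul_assoc, ← map_pow] at h
    obtain ⟨a', ha'⟩ := exists_eq_of_prod_mul_eq hy hi hu Finset.univ
      (mul_mem (intSub_le_satSub hy (i.isIntegralElem_map (x := (∏ j, y j) ^ N))) he) h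
    exact ih (by rwa [map_pow] at ha')

lemma IsCover.isUnit_prod (h : IsCover i ρ y) : IsUnit (i (∏ j, y j)) := by
  rw [map_prod]
  exact Finset.prod_induction _ IsUnit (fun _ _ => IsUnit.mul) isUnit_one fun j _ => h.unit j

lemma IsCover.exists_eq (h : IsCover i ρ y) (hy : ∀ j, Prime (y j)) {e : E}
    (he : e ∈ satSub i y hy) (hinv : ∀ g, ρ g e = e) : ∃ a, e = i a := by
  obtain ⟨N, a, ha⟩ := h.inv e hinv
  exact exists_eq_of_prod_pow_mul_eq hy h.inj h.unit he ha

lemma IsCover.map_mem_intSub (h : IsCover i ρ y) (g : G) {e : E} (he : i.IsIntegralElem e) :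
    i.IsIntegralElem (ρ g e) :=
  isIntegralElem_map_of_comp (RingHom.id A) (ρ g) (by simpa using h.fix g) he

lemma IsCover.map_mem_satSub (h : IsCover i ρ y) (hy : ∀ j, Prime (y j)) (g : G) {e : E}
    (he : e ∈ satSub i y hy) : ρ g e ∈ satSub i y hy := by
  intro j
  obtain ⟨t, ht, hte⟩ := he j
  refine ⟨t, ht, ?_⟩
  have := h.map_mem_intSub g hte
  rwa [map_mul, h.fix] at this

lemma IsCover.torsionFree [IsDomain A] [Fintype G] (h : IsCover i ρ y)
    {a : A} {b : E} (ha : a ≠ 0) (hab : i a * b = 0) : b = 0 := by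
  obtain ⟨N, κ, _, x, z, hx, hz, h1, h2⟩ := h.gal
  have key := sum_mul_gtr h1 h2 b
  have h3 : ∀ k, gtr ρ (z k * b) = 0 := by
    intro k
    obtain ⟨M, c, hc⟩ := h.inv _ (fun g => gtr_invariant (ρ := ρ) g (z k * b))
    have h4 : i (a * c) = 0 := by
      rw [map_mul, ← hc, mul_left_comm, ← gtr_mul_of_invariant (fun g => h.fix g a),
        mul_left_comm, hab]
      simp [gtr]
    have h5 : c = 0 := by
      have := (map_eq_zero_iff i h.inj).mp h4
      exact (mul_eq_zero.mp this).resolve_left ha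
    rw [h5, map_zero] at hc
    exact (h.isUnit_prod.pow M).mul_right_eq_zero.mp hc
  simp only [h3, mul_zero, Finset.sum_const_zero] at key
  exact (h.isUnit_prod.pow N).mul_right_eq_zero.mp key.symm

/-- The action of `G` on the saturation. -/
def IsCover.satAction (h : IsCover i ρ y) (hy : ∀ j, Prime (y j)) :
    G →* (satSub i y hy →+* satSub i y hy) where
  toFun g := (ρ g).restrict _ _ fun _ he => h.map_mem_satSub hy g he
  map_one' := by ext; simp
  map_mul' g g' := by ext; simp

/-- The algebra structure on the saturation. -/
@[reducible] def satAlgebra (i : A →+* E) (y : ι → A) (hy : ∀ j, Prime (y j)) :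
    Algebra A (satSub i y hy) :=
  (i.codRestrict (satSub i y hy) fun _ =>
    intSub_le_satSub hy i.isIntegralElem_map).toAlgebra

end Saturation

section Saturation

variable {ι G A E : Type} [Fintype ι] [Group G] [CommRing A] [CommRing E]
    {i : A →+* E} {ρ : G →* (E →+* E)} {y : ι → A}

lemma IsDelta.restrict_satSub (h : IsCover i ρ y) (hy : ∀ j, Prime (y j)) {s : E}
    (hs : s ∈ satSub i y hy) (hd : IsDelta ρ (intSub i) s) :
    IsDelta (h.satAction hy) ⊤ (⟨s, hs⟩ : satSub i y hy) := by
  obtain ⟨κ, _, x, z, hx, hz, h1, h2⟩ := hd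
  refine ⟨κ, inferInstance, fun k => ⟨x k, intSub_le_satSub hy (hx k)⟩,
    fun k => ⟨z k, intSub_le_satSub hy (hz k)⟩, fun _ => trivial, fun _ => trivial, ?_,
    fun σ hσ => ?_⟩
  · ext; simpa using h1
  · ext; simpa [IsCover.satAction] using h2 σ hσ

lemma IsCover.dvd_of_dvd_mul [IsDomain A] (h : IsCover i ρ y) (hy : ∀ j, Prime (y j)) {j : ι}
    {a : A} (ha : ¬ y j ∣ a) {b c : E} (hb : b ∈ satSub i y hy) (hc : c ∈ satSub i y hy)
    (habc : i a * b = i (y j) * c) : ∃ e ∈ satSub i y hy, b = i (y j) * e := by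
  obtain ⟨v, hv⟩ := (h.unit j).exists_right_inv
  refine ⟨v * b, fun l => ?_, by rw [← mul_assoc, hv, one_mul]⟩
  by_cases hl : y l ∣ y j
  · have hass : Associated (y l) (y j) := ((hy l).dvd_prime_iff_associated (hy j)).mp hl
    obtain ⟨t, ht, htc⟩ := hc l
    refine ⟨t * a, (hy l).not_dvd_mul ht (fun h' => ha (hass.symm.dvd.trans h')), ?_⟩
    have : i (t * a) * (v * b) = i t * c := by
      rw [map_mul]
      linear_combination (i t * v) * habc + (i t * c) * hv
    rwa [this]
  · obtain ⟨t, ht, htb⟩ := hb l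
    refine ⟨t * y j, (hy l).not_dvd_mul ht hl, ?_⟩
    have : i (t * y j) * (v * b) = i t * b := by
      rw [map_mul]
      linear_combination (i t * b) * hv
    rwa [this]

theorem IsCover.isSatCover [IsDomain A] [Fintype G] (h : IsCover i ρ y)
    (hy : ∀ j, Prime (y j)) :
    let := satAlgebra i y hy
    IsSatCover (A := A) (h.satAction hy) y := by
  let := satAlgebra i y hy
  refine ⟨fun a b hab => h.inj (congrArg Subtype.val hab), fun a b ha hab => ?_, fun g a => Subtype.ext (h.fix g a), fun e he => ?_,
    fun j a b ha hab => ?_, ?_, fun j => ?_⟩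
  · ext
    exact h.torsionFree ha (congrArg Subtype.val hab)
  · obtain ⟨a, ha⟩ := h.exists_eq hy e.2 fun g => congrArg Subtype.val (he g)
    exact ⟨a, Subtype.ext ha.symm⟩
  · obtain ⟨c, hc⟩ := hab
    obtain ⟨e, he, hbe⟩ := h.dvd_of_dvd_mul hy ha b.2 c.2 (congrArg Subtype.val hc)
    exact ⟨⟨e, he⟩, Subtype.ext hbe⟩
  · obtain ⟨N, hN⟩ := h.gal
    rw [← map_pow] at hN
    exact ⟨N, IsDelta.restrict_satSub h hy _ hN⟩
  · obtain ⟨t, ht, htj⟩ := h.tame j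
    exact ⟨t, IsDelta.restrict_satSub h hy _ ht, htj⟩

end Saturation

section SatCover

variable {ι G A B : Type} [Fintype ι] [Group G] [CommRing A] [CommRing B] [Algebra A B]
  [Fintype G] {ρ : G →* (B →+* B)} {y : ι → A}

lemma IsSatCover.exists_gtr (h : IsSatCover ρ y) (b : B) : ∃ a, algebraMap A B a = gtr ρ b :=
  h.inv _ fun g => gtr_invariant g b

theorem IsSatCover.finite [IsNoetherianRing A] [IsDomain A] (hy : ∀ j, y j ≠ 0)
    (h : IsSatCover ρ y) : Module.Finite A B := by
  obtain ⟨N, κ, _, x, z, -, -, h1, h2⟩ := h.gal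
  have hs : (∏ j, y j) ^ N ≠ 0 := pow_ne_zero _ (Finset.prod_ne_zero_iff.mpr fun j _ => hy j)
  let P : Submodule A B := Submodule.span A (Set.range x)
  have : Module.Finite A P := Module.Finite.span_of_finite A (Set.finite_range x)
  let m : B →ₗ[A] P := (LinearMap.mulLeft A (algebraMap A B ((∏ j, y j) ^ N))).codRestrict P (by
    intro b
    rw [LinearMap.mulLeft_apply, ← sum_mul_gtr h1 h2]
    refine Submodule.sum_mem _ fun k _ => ?_
    obtain ⟨a, ha⟩ := h.exists_gtr (z k * b)
    rw [← ha, mul_comm, ← Algebra.smul_def]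
    exact Submodule.smul_mem _ _ (Submodule.subset_span ⟨k, rfl⟩))
  refine Module.Finite.of_injective m ((injective_iff_map_eq_zero m).mpr fun b hb => ?_)
  exact h.torsionFree _ _ hs (congrArg Subtype.val hb)

end SatCover

theorem IsCover.exists_section_of_maximalIdeal_eq_bot {ι G A E : Type} [Fintype ι] [Group G]
    [Fintype G] [CommRing A] [IsLocalRing A] [CommRing E] {i : A →+* E} {ρ : G →* (E →+* E)}
    {y : ι → A} [IsAlgClosed (ResidueField A)] (hA : maximalIdeal A = ⊥) [IsEmpty ι]
    (h : IsCover i ρ y) : ∃ ε : E, (∀ σ, σ ≠ 1 → ε * ρ σ ε = 0) ∧ gtr ρ ε = 1 := by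
  obtain ⟨N, κ, _, x, z, hx, hz, h1, h2⟩ := h.gal
  have hinv : ∀ b, ∃ a, gtr ρ b = i a := by
    intro b
    obtain ⟨M, a, ha⟩ := h.inv _ fun g => gtr_invariant (ρ := ρ) g b
    exact ⟨a, by simpa using ha⟩
  have hb : ∀ b, ∑ k, x k * gtr ρ (z k * b) = b := by
    intro b
    simpa using sum_mul_gtr h1 h2 b
  have hint : i.IsIntegral := by
    intro b
    rw [← hb b]
    refine sum_mem (S := intSub i) fun k _ => mul_mem (hx k) ?_
    obtain ⟨a, ha⟩ := hinv (z k * b)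
    rw [ha]
    exact apply_mem_intSub i a
  have : Nontrivial E := h.inj.nontrivial
  obtain ⟨𝔫, h𝔫⟩ := Ideal.exists_maximal E
  let : Field (E ⧸ 𝔫) := Ideal.Quotient.field 𝔫
  set χ : E →+* E ⧸ 𝔫 := Ideal.Quotient.mk 𝔫 with hχ
  let j : ResidueField A →+* E ⧸ 𝔫 := Ideal.Quotient.lift _ (χ.comp i) (by
    intro a ha
    rw [hA] at ha
    rw [Ideal.mem_bot.mp ha, map_zero])
  have hj : ∀ a, j (residue A a) = χ (i a) := fun a => rfl
  let : Algebra (ResidueField A) (E ⧸ 𝔫) := j.toAlgebra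
  have : Algebra.IsIntegral (ResidueField A) (E ⧸ 𝔫) := ⟨fun b => by
    obtain ⟨b, rfl⟩ := Ideal.Quotient.mk_surjective b
    exact isIntegralElem_map_of_comp (i := i) (i' := j) (residue A) χ (fun a => (hj a).symm)
      (hint b)⟩
  have hbij := IsAlgClosed.algebraMap_bijective_of_isIntegral (k := ResidueField A) (K := E ⧸ 𝔫)
  have hsurj : ∀ e, ∃ a, χ (i a) = χ e := by
    intro e
    obtain ⟨c, hc⟩ := hbij.2 (χ e)
    obtain ⟨a, rfl⟩ := residue_surjective c
    exact ⟨a, hc⟩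
  have hinj : ∀ a, χ (i a) = 0 → a = 0 := by
    intro a ha
    have : residue A a = 0 := hbij.1 (by rw [map_zero]; exact ha)
    rw [residue_eq_zero_iff, hA] at this
    exact this
  choose a ha using fun k => hsurj (x k)
  have key : ∀ b, (∀ σ, χ (ρ σ b) = 0) → b = 0 := by
    intro b hσ
    rw [← hb b]
    refine Finset.sum_eq_zero fun k _ => ?_
    obtain ⟨c, hc⟩ := hinv (z k * b)
    have : χ (i c) = 0 := by
      rw [← hc, gtr, map_sum]
      exact Finset.sum_eq_zero fun σ _ => by rw [map_mul, map_mul, hσ, mul_zero]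
    rw [hc, hinj c this, map_zero, mul_zero]
  let e : E := ∑ k, i (a k) * z k
  have he : ∀ σ, χ (ρ σ e) = χ (∑ k, x k * ρ σ (z k)) := by
    intro σ
    simp [e, h.fix, ha]
  have he1 : χ (ρ 1 e) = 1 := by
    rw [he]
    have : ∑ k, x k * ρ 1 (z k) = 1 := by simpa using h1
    rw [this, map_one]
  have heσ : ∀ σ, σ ≠ 1 → χ (ρ σ e) = 0 := fun σ hσ => by rw [he, h2 σ hσ, map_zero]
  refine ⟨e, fun σ hσ => key _ fun τ => ?_, ?_⟩
  · rw [map_mul, map_mul]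
    by_cases hτ : τ = 1
    · subst hτ
      have : ρ 1 (ρ σ e) = ρ σ e := by simp
      rw [this, heσ σ hσ, mul_zero]
    · rw [heσ τ hτ, zero_mul]
  · rw [← sub_eq_zero]
    refine key _ fun τ => ?_
    rw [map_sub, gtr_invariant, map_one, map_sub, map_one, gtr, map_sum,
      Fintype.sum_eq_single 1 heσ, he1, sub_self]

lemma prod_dvd_of_dvd_mul {ι C : Type} [CommRing C] (s : Finset ι) (Y : ι → C)
    (hreg : ∀ j ∈ s, ∀ b, Y j * b = 0 → b = 0) {a : C}
    (ha : ∀ j ∈ s, ∀ b, Y j ∣ a * b → Y j ∣ b) {b : C} (hb : ∏ j ∈ s, Y j ∣ a * b) :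
    ∏ j ∈ s, Y j ∣ b := by
  classical
  induction s using Finset.induction_on generalizing b with
  | empty => simp
  | insert j s hj ih =>
    rw [Finset.prod_insert hj] at hb ⊢
    obtain ⟨b, rfl⟩ := ha j (by simp) b (dvd_of_mul_right_dvd hb)
    refine mul_dvd_mul_left _ (ih (fun l hl => hreg l (by simp [hl]))
      (fun l hl => ha l (by simp [hl])) ?_)
    obtain ⟨c, hc⟩ := hb
    refine ⟨c, ?_⟩
    rw [← sub_eq_zero]
    refine hreg j (by simp) _ ?_
    linear_combination hc

lemma prod_pow_dvd_of_dvd_mul {ι C : Type} [CommRing C] (s : Finset ι) (Y : ι → C)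
    (hreg : ∀ j ∈ s, ∀ b, Y j * b = 0 → b = 0) {a : C}
    (ha : ∀ j ∈ s, ∀ b, Y j ∣ a * b → Y j ∣ b) (M : ℕ) {b : C}
    (hb : (∏ j ∈ s, Y j) ^ M ∣ a * b) : (∏ j ∈ s, Y j) ^ M ∣ b := by
  have : (∏ j ∈ s, Y j) ^ M = ∏ p ∈ Finset.range M ×ˢ s, Y p.2 := by
    rw [Finset.prod_product]; simp
  rw [this] at hb ⊢
  exact prod_dvd_of_dvd_mul _ _ (fun p hp => hreg p.2 (Finset.mem_product.mp hp).2)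
    (fun p hp => ha p.2 (Finset.mem_product.mp hp).2) hb

section Regularity

variable {A : Type} [CommRing A] [IsDomain A] {f : A}

lemma pow_dvd_of_pow_dvd_mul (hf : Prime f) {b : A} (hb : ¬ f ∣ b) {k : ℕ} {x : A}
    (h : f ^ k ∣ b * x) : f ^ k ∣ x :=
  hf.pow_dvd_of_dvd_mul_left k hb h

lemma exists_pow_dvd_sub_mul (hf : Prime f) {a b : A} (hb : ¬ f ∣ b)
    (hab : ∀ d, (∃ e, f ∣ a * d - b * e) → ∃ e, f ∣ d - b * e) (k : ℕ) {α β : A}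
    (h : f ^ k ∣ a * α - b * β) : ∃ γ, f ^ k ∣ α - b * γ := by
  induction k with
  | zero => exact ⟨0, by simp⟩
  | succ k ih =>
    obtain ⟨γ, δ, hδ⟩ := ih ((pow_dvd_pow f k.le_succ).trans h)
    obtain ⟨ε, hε⟩ := h
    have h1 : f ^ k ∣ b * (β - a * γ) := ⟨a * δ - f * ε, by
      rw [pow_succ] at hε
      linear_combination (-1) * hε + a * hδ⟩
    obtain ⟨η, hη⟩ := pow_dvd_of_pow_dvd_mul hf hb h1
    have h2 : f ∣ a * δ - b * η := by
      refine ⟨ε, mul_left_cancel₀ (pow_ne_zero k hf.ne_zero) ?_⟩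
      rw [pow_succ] at hε
      linear_combination hε - a * hδ + b * hη
    obtain ⟨θ, θ', hθ⟩ := hab δ ⟨η, h2⟩
    refine ⟨γ + f ^ k * θ, θ', ?_⟩
    rw [pow_succ]
    linear_combination hδ + f ^ k * hθ

end Regularity

section Lifting

variable {ι G A B : Type} [Fintype ι] [Group G] [CommRing A] [CommRing B] [Algebra A B]
  {ρ : G →* (B →+* B)} {y : ι → A}

local notation "𝔞" => algebraMap A B

lemma IsSatCover.dvd_of_dvd_mul_left (h : IsSatCover ρ y) (hy : ∀ j, Prime (y j)) {f : A}
    (hfy : ∀ j, ¬ y j ∣ f) {j : ι} {b : B} (hb : 𝔞 f ∣ 𝔞 (y j) * b) : 𝔞 f ∣ b := by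
  obtain ⟨c, hc⟩ := hb
  obtain ⟨c, rfl⟩ := h.sat j f c (hfy j) (hc ▸ dvd_mul_right _ _)
  refine ⟨c, ?_⟩
  rw [← sub_eq_zero]
  refine h.torsionFree (y j) _ (hy j).ne_zero ?_
  linear_combination hc

lemma IsSatCover.dvd_of_dvd_prod_pow_mul (h : IsSatCover ρ y) (hy : ∀ j, Prime (y j)) {f : A}
    (hfy : ∀ j, ¬ y j ∣ f) {N : ℕ} {b : B} (hb : 𝔞 f ∣ 𝔞 ((∏ j, y j) ^ N) * b) :
    𝔞 f ∣ b := by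
  have key : ∀ (s : Finset ι) (b : B), 𝔞 f ∣ 𝔞 (∏ j ∈ s, y j) * b → 𝔞 f ∣ b := by
    classical
    intro s
    induction s using Finset.induction_on with
    | empty => simp
    | insert j s hj ih =>
      intro b hb
      rw [Finset.prod_insert hj, map_mul, mul_assoc] at hb
      exact ih b (h.dvd_of_dvd_mul_left hy hfy hb)
  induction N generalizing b with
  | zero => simpa using hb
  | succ N ih =>
    rw [pow_succ, map_mul, mul_assoc] at hb
    exact key _ b (ih hb)

lemma IsSatCover.dvd_of_algebraMap_dvd (h : IsSatCover ρ y) {d a : A} (hd : d ≠ 0)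
    (hda : 𝔞 d ∣ 𝔞 a) : d ∣ a := by
  obtain ⟨b, hb⟩ := hda
  obtain ⟨c, hc⟩ := h.inv b fun g => by
    rw [← sub_eq_zero]
    refine h.torsionFree d _ hd ?_
    have := congrArg (ρ g) hb
    rw [h.fix, map_mul, h.fix] at this
    linear_combination hb - this
  exact ⟨c, h.inj (by rw [hb, map_mul, hc])⟩

variable [Fintype G]

lemma IsSatCover.dvd_of_dvd_mul (h : IsSatCover ρ y) (hy : ∀ j, Prime (y j)) {f : A}
    (hf : Prime f) (hfy : ∀ j, ¬ y j ∣ f) {a : A} (ha : ¬ f ∣ a) {b : B}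
    (hb : 𝔞 f ∣ 𝔞 a * b) : 𝔞 f ∣ b := by
  obtain ⟨N, κ, _, x, z, -, -, h1, h2⟩ := h.gal
  refine h.dvd_of_dvd_prod_pow_mul hy hfy (N := N) ?_
  rw [← sum_mul_gtr h1 h2]
  refine Finset.dvd_sum fun k _ => Dvd.dvd.mul_left ?_ _
  obtain ⟨α, hα⟩ := h.exists_gtr (z k * b)
  obtain ⟨c, hc⟩ := hb
  obtain ⟨γ, hγ⟩ := h.exists_gtr (z k * c)
  have : a * α = f * γ := h.inj (by
    rw [map_mul, map_mul, hα, hγ, ← gtr_mul_of_invariant (fun g => h.fix g a),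
      ← gtr_mul_of_invariant (fun g => h.fix g f), mul_left_comm, hc, mul_left_comm])
  rw [← hα]
  exact map_dvd _ ((hf.dvd_or_dvd (Dvd.intro _ this.symm)).resolve_left ha)

lemma IsSatCover.pow_dvd_of_pow_dvd_mul (h : IsSatCover ρ y) (hy : ∀ j, Prime (y j)) {f : A}
    (hf : Prime f) (hfy : ∀ j, ¬ y j ∣ f) {a : A} (ha : ¬ f ∣ a) {k : ℕ} {b : B}
    (hb : 𝔞 f ^ k ∣ 𝔞 a * b) : 𝔞 f ^ k ∣ b := by
  induction k generalizing b with
  | zero => simp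
  | succ k ih =>
    obtain ⟨b, rfl⟩ := h.dvd_of_dvd_mul hy hf hfy ha
      ((dvd_pow_self _ k.succ_ne_zero).trans hb)
    rw [pow_succ']
    refine mul_dvd_mul_left _ (ih ?_)
    obtain ⟨c, hc⟩ := hb
    refine ⟨c, ?_⟩
    rw [← sub_eq_zero]
    refine h.torsionFree f _ hf.ne_zero ?_
    rw [pow_succ'] at hc
    linear_combination hc

/-- One step of the Newton iteration lifting an idempotent with bounded denominators. -/
lemma IsSatCover.newton_step [IsDomain A] (h : IsSatCover ρ y) (hy : ∀ j, Prime (y j)) {f : A}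
    (hf : Prime f) (hfy : ∀ j, ¬ y j ∣ f) {s t : A} (hs : IsDelta ρ ⊤ (𝔞 s))
    (ht : IsDelta ρ ⊤ (𝔞 t)) (hfs : ¬ f ∣ s)
    (hst : ∀ d, (∃ e, f ∣ t ^ 3 * d - s ^ 3 * e) → ∃ e, f ∣ d - s ^ 3 * e)
    {k : ℕ} {w w' : B} (h1 : 𝔞 f ^ k ∣ 𝔞 t * w - 𝔞 s * w')
    (h2 : 𝔞 f ^ k ∣ w ^ 2 - 𝔞 s * w) :
    ∃ v v' : B, 𝔞 f ^ (2 * k) ∣ 𝔞 t * v - 𝔞 s * v' ∧ 𝔞 f ^ (2 * k) ∣ v ^ 2 - 𝔞 s * v ∧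
      𝔞 f ^ k ∣ v - w ∧ 𝔞 f ^ k ∣ v' - w' := by
  obtain ⟨κ, _, x, z, -, -, hx1, hx2⟩ := hs
  obtain ⟨κ', _, x', z', -, -, hx1', hx2'⟩ := ht
  have hfs3 : ¬ f ∣ s ^ 3 := fun h' => hfs (hf.dvd_of_dvd_pow h')
  have cancel : ∀ {m n : ℕ} {b : B}, 𝔞 f ^ m ∣ 𝔞 s ^ n * b → 𝔞 f ^ m ∣ b := by
    intro m n b hb
    rw [← map_pow (algebraMap A B) s n] at hb
    exact h.pow_dvd_of_pow_dvd_mul hy hf hfy (fun h' => hfs (hf.dvd_of_dvd_pow h')) hb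
  set S := 𝔞 s with hS
  set T := 𝔞 t with hT
  set F := 𝔞 f with hF
  obtain ⟨p, hp⟩ := h1
  obtain ⟨q, hq⟩ := h2
  set u := 3 * S * w ^ 2 - 2 * w ^ 3 with hu
  set v := 3 * T * w' ^ 2 - 2 * w' ^ 3 with hv
  have huv : F ^ (2 * k) ∣ T ^ 3 * u - S ^ 3 * v := by
    refine ⟨-6 * T ^ 2 * p * q + p * p * (2 * (2 * T * w + S * w') - 3 * S * T), ?_⟩
    have hpk : F ^ (2 * k) = F ^ k * F ^ k := by rw [two_mul, pow_add]
    rw [hpk]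
    have e1 : F ^ k * F ^ k * (-6 * T ^ 2 * p * q + p * p * (2 * (2 * T * w + S * w') - 3 * S * T))
        = -6 * T ^ 2 * (F ^ k * p) * (F ^ k * q) +
          (F ^ k * p) ^ 2 * (2 * (2 * T * w + S * w') - 3 * S * T) := by ring
    rw [e1, ← hp, ← hq, hu, hv]
    ring
  have hus : F ^ (2 * k) ∣ u ^ 2 - S ^ 3 * u := by
    refine ⟨q ^ 2 * (4 * w ^ 2 - 4 * S * w - 3 * S ^ 2), ?_⟩
    have e1 : F ^ (2 * k) * (q ^ 2 * (4 * w ^ 2 - 4 * S * w - 3 * S ^ 2)) =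
      (F ^ k * q) ^ 2 * (4 * w ^ 2 - 4 * S * w - 3 * S ^ 2) := by ring
    rw [e1, ← hq, hu]
    ring
  have descend : ∀ b : B, ∃ γ : A, F ^ (2 * k) ∣ gtr ρ (b * u) - S ^ 3 * 𝔞 γ := by
    intro b
    obtain ⟨α, hα⟩ := h.exists_gtr (b * u)
    obtain ⟨β, hβ⟩ := h.exists_gtr (b * v)
    obtain ⟨c, hc⟩ := huv
    have h3 : f ^ (2 * k) ∣ t ^ 3 * α - s ^ 3 * β := by
      refine h.dvd_of_algebraMap_dvd (pow_ne_zero _ hf.ne_zero) ⟨gtr ρ (b * c), ?_⟩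
      rw [map_sub, map_mul, map_mul, hα, hβ, ← gtr_mul_of_invariant (fun g => h.fix g _),
        ← gtr_mul_of_invariant (fun g => h.fix g _),
        ← gtr_mul_of_invariant (fun g => h.fix g _), ← gtr_sub]
      congr 1
      simp only [map_pow]
      linear_combination b * hc
    obtain ⟨γ, hγ⟩ := exists_pow_dvd_sub_mul hf hfs3 hst _ h3
    refine ⟨γ, ?_⟩
    have := map_dvd (algebraMap A B) hγ
    rwa [map_sub, map_mul, map_pow, map_pow, hα] at this
  choose γ hγ using fun k => descend (z k)
  choose γ' hγ' using fun k => descend (z' k)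
  have hw : F ^ (2 * k) ∣ S ^ 2 * (∑ k, x k * 𝔞 (γ k)) - u := by
    refine cancel (n := 1) ?_
    have : S ^ 1 * (S ^ 2 * (∑ k, x k * 𝔞 (γ k)) - u) =
        ∑ k, -x k * (gtr ρ (z k * u) - S ^ 3 * 𝔞 (γ k)) := by
      simp only [mul_sub, neg_mul, Finset.sum_sub_distrib, Finset.sum_neg_distrib,
        sum_mul_gtr hx1 hx2, Finset.mul_sum]
      rw [sub_neg_eq_add, neg_add_eq_sub, pow_one]
      congr 1
      exact Finset.sum_congr rfl fun k _ => by ring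
    rw [this]
    exact Finset.dvd_sum fun k _ => Dvd.dvd.mul_left (hγ k) _
  have hw' : F ^ (2 * k) ∣ S ^ 3 * (∑ k, x' k * 𝔞 (γ' k)) - T * u := by
    have : S ^ 3 * (∑ k, x' k * 𝔞 (γ' k)) - T * u =
        ∑ k, -x' k * (gtr ρ (z' k * u) - S ^ 3 * 𝔞 (γ' k)) := by
      simp only [mul_sub, neg_mul, Finset.sum_sub_distrib, Finset.sum_neg_distrib,
        sum_mul_gtr hx1' hx2', Finset.mul_sum]
      rw [sub_neg_eq_add, neg_add_eq_sub]
      congr 1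
      exact Finset.sum_congr rfl fun k _ => by ring
    rw [this]
    exact Finset.dvd_sum fun k _ => Dvd.dvd.mul_left (hγ' k) _
  generalize (∑ k, x k * 𝔞 (γ k)) = V at hw
  generalize (∑ k, x' k * 𝔞 (γ' k)) = V' at hw'
  have hTV : F ^ (2 * k) ∣ T * V - S * V' := by
    refine cancel (n := 2) ?_
    have : S ^ 2 * (T * V - S * V') = T * (S ^ 2 * V - u) - (S ^ 3 * V' - T * u) := by ring
    rw [this]
    exact dvd_sub (Dvd.dvd.mul_left hw _) hw'
  have hVw : F ^ k ∣ V - w := by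
    refine cancel (n := 2) ?_
    have : S ^ 2 * (V - w) = (S ^ 2 * V - u) + (w ^ 2 - S * w) * (S - 2 * w) := by
      rw [hu]; ring
    rw [this]
    refine dvd_add ((pow_dvd_pow F (by omega)).trans hw) (Dvd.dvd.mul_right ⟨q, hq⟩ _)
  refine ⟨V, V', hTV, ?_, hVw, ?_⟩
  · refine cancel (n := 4) ?_
    have : S ^ 4 * (V ^ 2 - S * V) =
        (S ^ 2 * V - u) * (S ^ 2 * V + u - S ^ 3) + (u ^ 2 - S ^ 3 * u) := by ring
    rw [this]
    exact dvd_add (Dvd.dvd.mul_right hw _) hus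
  · refine cancel (n := 1) ?_
    have : S ^ 1 * (V' - w') = T * (V - w) - (T * V - S * V') + (T * w - S * w') := by ring
    rw [this]
    exact dvd_add (dvd_sub (Dvd.dvd.mul_left hVw _) ((pow_dvd_pow F (by omega)).trans hTV))
      ⟨p, hp⟩

end Lifting

lemma exists_dvd_sub_of_not_dvd {ι A : Type} [Fintype ι] [CommRing A] {f : A} (hf : Prime f)
    {y : ι → A} (hyf : ∀ j, Prime (Ideal.Quotient.mk (Ideal.span {f}) (y j))) {t : A}
    (ht : ∀ j, ¬ Ideal.Quotient.mk (Ideal.span {f}) (y j) ∣ Ideal.Quotient.mk (Ideal.span {f}) t)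
    (N : ℕ) (d : A) (hd : ∃ e, f ∣ t * d - (∏ j, y j) ^ N * e) :
    ∃ e, f ∣ d - (∏ j, y j) ^ N * e := by
  set q := Ideal.Quotient.mk (Ideal.span {f}) with hq
  have hprime : (Ideal.span {f}).IsPrime := (Ideal.span_singleton_prime hf.ne_zero).mpr hf
  have hdvd : ∀ a b : A, f ∣ a - b ↔ q a = q b := by
    intro a b
    rw [hq, Ideal.Quotient.eq, Ideal.mem_span_singleton]
  obtain ⟨e, he⟩ := hd
  have h1 : (∏ j, q (y j)) ^ N ∣ q t * q d := by
    rw [hdvd] at he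
    exact ⟨q e, by simpa using he⟩
  obtain ⟨c, hc⟩ := prod_pow_dvd_of_dvd_mul Finset.univ (fun j => q (y j))
    (fun j _ b hb => (mul_eq_zero.mp hb).resolve_left (hyf j).ne_zero)
    (fun j _ b hb => ((hyf j).dvd_or_dvd hb).resolve_left (ht j)) N h1
  obtain ⟨c, rfl⟩ := Ideal.Quotient.mk_surjective c
  exact ⟨c, (hdvd _ _).mpr (by simpa using hc)⟩

section Lifting

variable {ι G A B : Type} [Fintype ι] [Group G] [CommRing A] [CommRing B] [Algebra A B]
  {ρ : G →* (B →+* B)} {y : ι → A} [Fintype G] [IsDomain A]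

local notation "𝔞" => algebraMap A B

lemma IsSatCover.exists_idempotent (h : IsSatCover ρ y) (hy : ∀ j, Prime (y j)) {f : A}
    (hf : Prime f) (hfy : ∀ j, ¬ y j ∣ f)
    (hyf : ∀ j, Prime (Ideal.Quotient.mk (Ideal.span {f}) (y j)))
    (haus : ∀ b : B, (∀ n : ℕ, 𝔞 f ^ n ∣ b) → b = 0)
    (prec : ∀ w : ℕ → B, (∀ n, 𝔞 f ^ n ∣ w (n + 1) - w n) → ∃ c, ∀ n, 𝔞 f ^ n ∣ c - w n)
    {N : ℕ} {t : A} (hs : IsDelta ρ ⊤ (𝔞 ((∏ j, y j) ^ N))) (ht : IsDelta ρ ⊤ (𝔞 t))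
    (hyt : ∀ j, ¬ Ideal.Quotient.mk (Ideal.span {f}) (y j) ∣ Ideal.Quotient.mk (Ideal.span {f}) t)
    {w w' : B} (h1 : 𝔞 f ∣ 𝔞 t * w - 𝔞 ((∏ j, y j) ^ N) * w')
    (h2 : 𝔞 f ∣ w ^ 2 - 𝔞 ((∏ j, y j) ^ N) * w) :
    ∃ c : B, c ^ 2 = c ∧ 𝔞 f ∣ 𝔞 ((∏ j, y j) ^ N) * c - w := by
  have hprime : (Ideal.span {f}).IsPrime := (Ideal.span_singleton_prime hf.ne_zero).mpr hf
  have hfyj : ∀ j, ¬ f ∣ y j := fun j hj => (hyf j).ne_zero (by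
    rwa [Ideal.Quotient.eq_zero_iff_mem, Ideal.mem_span_singleton])
  have hfs : ¬ f ∣ (∏ j, y j) ^ N := fun h' => by
    obtain ⟨j, -, hj⟩ := (hf.dvd_finsetProd_iff _).mp (hf.dvd_of_dvd_pow h')
    exact hfyj j hj
  have hst : ∀ d, (∃ e, f ∣ t ^ 3 * d - ((∏ j, y j) ^ N) ^ 3 * e) →
      ∃ e, f ∣ d - ((∏ j, y j) ^ N) ^ 3 * e := by
    intro d hd
    rw [← pow_mul] at hd ⊢
    refine exists_dvd_sub_of_not_dvd hf hyf (fun j hj => ?_) _ d hd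
    rw [map_pow] at hj
    exact hyt j ((hyf j).dvd_of_dvd_pow hj)
  have hyt' : ∀ j, ¬ y j ∣ t := fun j hj => hyt j (map_dvd _ hj)
  set s := (∏ j, y j) ^ N with hsdef
  let P : ℕ → B × B → Prop := fun n p => 𝔞 f ^ (n + 1) ∣ 𝔞 t * p.1 - 𝔞 s * p.2 ∧
    𝔞 f ^ (n + 1) ∣ p.1 ^ 2 - 𝔞 s * p.1
  have step : ∀ n (p : {p // P n p}), ∃ q : {q // P (n + 1) q},
      𝔞 f ^ (n + 1) ∣ q.1.1 - p.1.1 ∧ 𝔞 f ^ (n + 1) ∣ q.1.2 - p.1.2 := by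
    rintro n ⟨p, hp1, hp2⟩
    obtain ⟨v, v', e1, e2, e3, e4⟩ := h.newton_step hy hf hfy hs ht hfs hst hp1 hp2
    have hle : n + 1 + 1 ≤ 2 * (n + 1) := by omega
    exact ⟨⟨(v, v'), (pow_dvd_pow _ hle).trans e1, (pow_dvd_pow _ hle).trans e2⟩, e3, e4⟩
  choose next hnext hnext' using step
  let W : (n : ℕ) → {p // P n p} := fun n => Nat.rec ⟨(w, w'), by simpa using h1, by simpa using h2⟩
    (fun n p => next n p) n
  have hW1 : ∀ n, 𝔞 f ^ n ∣ (W (n + 1)).1.1 - (W n).1.1 := fun n =>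
    (pow_dvd_pow _ n.le_succ).trans (hnext n (W n))
  have hW2 : ∀ n, 𝔞 f ^ n ∣ (W (n + 1)).1.2 - (W n).1.2 := fun n =>
    (pow_dvd_pow _ n.le_succ).trans (hnext' n (W n))
  obtain ⟨c, hc⟩ := prec (fun n => (W n).1.1) hW1
  obtain ⟨c', hc'⟩ := prec (fun n => (W n).1.2) hW2
  have hcc' : 𝔞 t * c = 𝔞 s * c' := by
    rw [← sub_eq_zero]
    refine haus _ fun n => ?_
    have : 𝔞 t * c - 𝔞 s * c' = 𝔞 t * (c - (W n).1.1) - 𝔞 s * (c' - (W n).1.2) +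
      (𝔞 t * (W n).1.1 - 𝔞 s * (W n).1.2) := by ring
    rw [this]
    exact dvd_add (dvd_sub (Dvd.dvd.mul_left (hc n) _) (Dvd.dvd.mul_left (hc' n) _))
      ((pow_dvd_pow _ n.le_succ).trans (W n).2.1)
  have hcs : c ^ 2 = 𝔞 s * c := by
    rw [← sub_eq_zero]
    refine haus _ fun n => ?_
    have : c ^ 2 - 𝔞 s * c = (c - (W n).1.1) * (c + (W n).1.1 - 𝔞 s) +
      ((W n).1.1 ^ 2 - 𝔞 s * (W n).1.1) := by ring
    rw [this]
    exact dvd_add (Dvd.dvd.mul_right (hc n) _) ((pow_dvd_pow _ n.le_succ).trans (W n).2.2)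
  have hsc : 𝔞 s ∣ c := by
    have := prod_pow_dvd_of_dvd_mul Finset.univ (fun j => 𝔞 (y j)) (a := 𝔞 t) (b := c)
      (fun j _ b hb => h.torsionFree _ _ (hy j).ne_zero hb)
      (fun j _ b hb => h.sat j t b (hyt' j) hb) N
      (by rw [← map_prod, ← map_pow, hcc']; exact dvd_mul_right _ _)
    rwa [← map_prod, ← map_pow] at this
  obtain ⟨e, rfl⟩ := hsc
  have hs0 : s ≠ 0 := fun h' => hfs (h' ▸ dvd_zero f)
  refine ⟨e, ?_, ?_⟩
  · rw [← sub_eq_zero]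
    refine h.torsionFree s _ hs0 (h.torsionFree s _ hs0 ?_)
    linear_combination hcs
  · have h3 := hc 1
    have h4 : 𝔞 f ∣ (W 1).1.1 - w := by
      have := hnext 0 (W 0)
      exact (dvd_of_eq (by simp)).trans this
    rw [pow_one] at h3
    have := dvd_add h3 h4
    rwa [sub_add_sub_cancel] at this

theorem IsSatCover.lift_section (h : IsSatCover ρ y) (hy : ∀ j, Prime (y j)) {f : A}
    (hf : Prime f) (hfy : ∀ j, ¬ y j ∣ f)
    (hyf : ∀ j, Prime (Ideal.Quotient.mk (Ideal.span {f}) (y j)))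
    (haus : ∀ b : B, (∀ n : ℕ, 𝔞 f ^ n ∣ b) → b = 0)
    (prec : ∀ w : ℕ → B, (∀ n, 𝔞 f ^ n ∣ w (n + 1) - w n) → ∃ c, ∀ n, 𝔞 f ^ n ∣ c - w n)
    {N : ℕ} {t : A} (hs : IsDelta ρ ⊤ (𝔞 ((∏ j, y j) ^ N))) (ht : IsDelta ρ ⊤ (𝔞 t))
    (hyt : ∀ j, ¬ Ideal.Quotient.mk (Ideal.span {f}) (y j) ∣ Ideal.Quotient.mk (Ideal.span {f}) t)
    {w w' : B} (h1 : 𝔞 f ∣ 𝔞 t * w - 𝔞 ((∏ j, y j) ^ N) * w')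
    (h2 : 𝔞 f ∣ w ^ 2 - 𝔞 ((∏ j, y j) ^ N) * w)
    (h3 : ∀ σ, σ ≠ 1 → 𝔞 f ∣ w * ρ σ w)
    (h4 : 𝔞 f ∣ gtr ρ w - 𝔞 ((∏ j, y j) ^ N)) :
    ∃ c : B, (∀ σ, σ ≠ 1 → c * ρ σ c = 0) ∧ gtr ρ c = 1 := by
  classical
  obtain ⟨c, hc, e, hcw⟩ := h.exists_idempotent hy hf hfy hyf haus prec hs ht hyt h1 h2
  set s := (∏ j, y j) ^ N with hsdef
  have cancel : ∀ {b : B}, 𝔞 f ∣ 𝔞 s * b → 𝔞 f ∣ b := h.dvd_of_dvd_prod_pow_mul hy hfy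
  have idem : ∀ b : B, b ^ 2 = b → 𝔞 f ∣ b → b = 0 := by
    intro b hb hfb
    refine haus b fun n => ?_
    rcases n with _ | n
    · simp
    · have : b ^ (n + 1) = b := by
        have hb' : IsIdempotentElem b := by rw [IsIdempotentElem, ← pow_two, hb]
        exact hb'.pow_succ_eq n
      rw [← this]
      exact pow_dvd_pow_of_dvd hfb _
  have hw : w = 𝔞 s * c - 𝔞 f * e := by linear_combination -hcw
  have horth : ∀ σ, σ ≠ 1 → c * ρ σ c = 0 := by
    intro σ hσ
    refine idem _ ?_ (cancel (cancel ?_))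
    · rw [mul_pow, ← map_pow, hc]
    · obtain ⟨d, hd⟩ := h3 σ hσ
      refine ⟨d + e * ρ σ (𝔞 s * c) + (𝔞 s * c) * ρ σ e - 𝔞 f * e * ρ σ e, ?_⟩
      rw [hw, map_sub, map_mul, map_mul, h.fix, h.fix] at hd
      rw [map_mul, h.fix]
      linear_combination hd
  refine ⟨c, horth, ?_⟩
  have hpair : ∀ σ τ, σ ≠ τ → ρ σ c * ρ τ c = 0 := by
    intro σ τ hστ
    have := congrArg (ρ σ) (horth (σ⁻¹ * τ) (fun h' => hστ (by
      rw [inv_mul_eq_one] at h'; exact h')))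
    rw [map_mul, map_zero, map_mul, RingHom.mul_def, RingHom.comp_apply, ← RingHom.comp_apply,
      ← RingHom.mul_def, ← map_mul, mul_inv_cancel, map_one] at this
    simpa using this
  have htr : gtr ρ c ^ 2 = gtr ρ c := by
    unfold gtr
    rw [pow_two, Finset.sum_mul_sum]
    refine Finset.sum_congr rfl fun σ _ => ?_
    rw [Fintype.sum_eq_single σ fun τ hτ => hpair σ τ hτ.symm, ← pow_two, ← map_pow, hc]
  rw [eq_comm, ← sub_eq_zero]
  refine idem _ (by linear_combination htr) (cancel ?_)
  obtain ⟨d, hd⟩ := h4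
  refine ⟨-d - gtr ρ e, ?_⟩
  rw [hw, gtr_sub, gtr_mul_of_invariant (fun g => h.fix g _),
    gtr_mul_of_invariant (fun g => h.fix g _)] at hd
  linear_combination -hd

end Lifting

lemma free_of_torsionFree_mod {A M : Type} [CommRing A] [IsDomain A] [IsNoetherianRing A]
    [IsLocalRing A] [AddCommGroup M] [Module A M] [Module.Finite A M] {f g : A} (hf : Prime f)
    (hfg : maximalIdeal A = Ideal.span {f, g})
    (hreg : ∀ m : M, f • m = 0 → m = 0)
    (htf : ∀ (a : A) (m m' : M), ¬ f ∣ a → a • m = f • m' → ∃ m'', m = f • m'') :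
    Module.Free A M := by
  have hfm : f ∈ maximalIdeal A := hfg ▸ Ideal.subset_span (by simp)
  have hprime : (Ideal.span {f}).IsPrime := (Ideal.span_singleton_prime hf.ne_zero).mpr hf
  have hloc : IsLocalRing (A ⧸ Ideal.span {f}) := isLocalRing_quotient_span hfm
  have hmax : maximalIdeal (A ⧸ Ideal.span {f}) = Ideal.span {Ideal.Quotient.mk _ g} := by
    have h1 : (maximalIdeal A).map (Ideal.Quotient.mk (Ideal.span {f})) =
        maximalIdeal (A ⧸ Ideal.span {f}) :=
      IsLocalRing.map_maximalIdeal_of_surjective _ Ideal.Quotient.mk_surjective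
    rw [← h1, hfg, Ideal.map_span, Set.image_pair, Ideal.Quotient.eq_zero_iff_mem.mpr
      (Ideal.mem_span_singleton_self f), Ideal.span_insert_zero]
  have hprin : (maximalIdeal (A ⧸ Ideal.span {f})).IsPrincipal := ⟨⟨_, hmax⟩⟩
  have hpid : IsPrincipalIdealRing (A ⧸ Ideal.span {f}) :=
    ((tfae_of_isNoetherianRing_of_isLocalRing_of_isDomain (A ⧸ Ideal.span {f})).out 4 0).mp hprin
  have hsm : IsSMulRegular M f := by
    intro m m' h
    rw [← sub_eq_zero]
    exact hreg _ (by rw [smul_sub]; exact sub_eq_zero.mpr h)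
  have hmem : f ∈ (⊥ : Ideal A).jacobson := by
    rwa [IsLocalRing.jacobson_eq_maximalIdeal _ bot_ne_top]
  have := Module.finitePresentation_of_finite A M
  rw [← Module.free_quotSMulTop_iff_free A M hmem hsm]
  have : Module.Finite (A ⧸ Ideal.span {f}) (QuotSMulTop f M) :=
    Module.Finite.of_restrictScalars_finite A _ _
  have : Module.IsTorsionFree (A ⧸ Ideal.span {f}) (QuotSMulTop f M) := by
    refine ⟨fun r hr => ?_⟩
    obtain ⟨a, rfl⟩ := Ideal.Quotient.mk_surjective r
    have ha : ¬ f ∣ a := fun h => hr.ne_zero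
      (Ideal.Quotient.eq_zero_iff_mem.mpr (Ideal.mem_span_singleton.mpr h))
    refine isSMulRegular_iff_right_eq_zero_of_smul.mpr fun m hm => ?_
    obtain ⟨m, rfl⟩ := Submodule.Quotient.mk_surjective _ m
    have h1 : (Submodule.Quotient.mk (a • m) : QuotSMulTop f M) = 0 := hm
    rw [Submodule.Quotient.mk_eq_zero, Submodule.mem_smul_pointwise_iff_exists] at h1 ⊢
    obtain ⟨m', -, hm'⟩ := h1
    obtain ⟨m'', h⟩ := htf a m m' ha hm'.symm
    exact ⟨m'', trivial, h.symm⟩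
  infer_instance

lemma exists_linearIndependent_of_torsionFree_mod {A M : Type} [CommRing A] [IsDomain A]
    [IsNoetherianRing A] [AddCommGroup M] [Module A M] [Module.Finite A M] {f g : A} (hf : Prime f)
    (hg : Prime (Ideal.Quotient.mk (Ideal.span {f}) g))
    (hreg : ∀ m : M, f • m = 0 → m = 0)
    (htf : ∀ (a : A) (m m' : M), ¬ f ∣ a → a • m = f • m' → ∃ m'', m = f • m'') :
    ∃ (κ : Type) (_ : Fintype κ) (w : κ → M) (q : A), LinearIndependent A w ∧
      ¬ Ideal.Quotient.mk (Ideal.span {f}) g ∣ Ideal.Quotient.mk (Ideal.span {f}) q ∧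
      ∀ m, q • m ∈ Submodule.span A (Set.range w) := by
  classical
  have hprime : (Ideal.span {f}).IsPrime := (Ideal.span_singleton_prime hf.ne_zero).mpr hf
  have : (Ideal.span {Ideal.Quotient.mk (Ideal.span {f}) g}).IsPrime :=
    (Ideal.span_singleton_prime hg.ne_zero).mpr hg
  let P : Ideal A := (Ideal.span {Ideal.Quotient.mk (Ideal.span {f}) g}).comap
    (Ideal.Quotient.mk (Ideal.span {f}))
  have hP : P.IsPrime := Ideal.comap_isPrime _ _
  have memP : ∀ a, a ∈ P ↔ Ideal.Quotient.mk (Ideal.span {f}) g ∣ Ideal.Quotient.mk _ a := by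
    intro a
    rw [Ideal.mem_comap, Ideal.mem_span_singleton]
  have hPspan : P = Ideal.span {f, g} := by
    have : P = (Ideal.span {g} ⊔ Ideal.span {f}) := by
      have := Ideal.comap_map_of_surjective' (Ideal.Quotient.mk (Ideal.span {f}))
        Ideal.Quotient.mk_surjective (Ideal.span {g})
      rwa [Ideal.map_span, Set.image_singleton, Ideal.mk_ker] at this
    rw [this, Ideal.span_insert, sup_comm]
  let S := P.primeCompl
  let AP := Localization.AtPrime P
  let MP := LocalizedModule S M
  let l : M →ₗ[A] MP := LocalizedModule.mkLinearMap S M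
  have hinj : Function.Injective (algebraMap A AP) :=
    IsLocalization.injective AP P.primeCompl_le_nonZeroDivisors
  have hfP : f ∈ P := hPspan ▸ Ideal.subset_span (by simp)
  have hf' : Prime (algebraMap A AP f) := by
    rw [← Ideal.span_singleton_prime (by simpa using hinj.ne hf.ne_zero), ← Set.image_singleton,
      ← Ideal.map_span]
    refine IsLocalization.isPrime_of_isPrime_disjoint S AP _ hprime ?_
    rw [Set.disjoint_left]
    intro a ha ha'
    exact ha ((Ideal.span_singleton_le_iff_mem _).mpr hfP ha')
  have hdvd : ∀ (a : A), f ∣ a → algebraMap A AP f ∣ algebraMap A AP a := fun a => map_dvd _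
  have hfree : Module.Free AP MP := by
    refine free_of_torsionFree_mod (g := algebraMap A AP g) hf' ?_ ?_ ?_
    · have := congrArg (Ideal.map (algebraMap A AP)) hPspan
      rw [Ideal.map_span, Set.image_pair] at this
      rw [← this]
      exact Localization.AtPrime.map_eq_maximalIdeal.symm
    · intro m hm
      obtain ⟨⟨m, s⟩, rfl⟩ := IsLocalizedModule.mk'_surjective S l m
      simp only [Function.uncurry_apply_pair] at hm ⊢
      rw [algebraMap_smul AP f, ← IsLocalizedModule.mk'_smul, IsLocalizedModule.mk'_eq_zero'] at hm
      obtain ⟨s', hs'⟩ := hm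
      rw [IsLocalizedModule.mk'_eq_zero']
      refine ⟨s', hreg _ ?_⟩
      rw [smul_comm]; exact hs'
    · intro a m m' ha hm
      obtain ⟨⟨m, s⟩, rfl⟩ := IsLocalizedModule.mk'_surjective S l m
      obtain ⟨⟨m', s'⟩, rfl⟩ := IsLocalizedModule.mk'_surjective S l m'
      obtain ⟨a, u, rfl⟩ := IsLocalization.exists_mk'_eq S a
      simp only [Function.uncurry_apply_pair] at hm ⊢
      have hfa : ¬ f ∣ a := fun h => ha (by
        rw [IsLocalization.mk'_eq_mul_mk'_one]
        exact Dvd.dvd.mul_right (hdvd _ h) _)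
      rw [algebraMap_smul AP f, ← IsLocalizedModule.mk'_smul l f m' s', IsLocalizedModule.mk'_smul_mk' AP,
        IsLocalizedModule.mk'_eq_mk'_iff] at hm
      obtain ⟨c, hc⟩ := hm
      simp only [Submonoid.smul_def, Submonoid.coe_mul] at hc
      have hfs : ¬ f ∣ (c * s' * a : A) := by
        intro h
        rcases hf.dvd_or_dvd h with h | h
        · rcases hf.dvd_or_dvd h with h | h
          · exact c.2 (P.mem_of_dvd h hfP)
          · exact s'.2 (P.mem_of_dvd h hfP)
        · exact hfa h
      obtain ⟨m'', hm''⟩ := htf (c * s' * a : A) m ((c * (u * s) : A) • m') hfs (by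
        rw [smul_smul, smul_smul] at hc
        rw [smul_smul, mul_comm f, ← smul_smul]
        simpa [mul_smul] using hc.symm)
      refine ⟨IsLocalizedModule.mk' l m'' s, ?_⟩
      rw [algebraMap_smul AP f, ← IsLocalizedModule.mk'_smul, hm'']
  let b := Module.Free.chooseBasis AP MP
  have hb : ∀ k, ∃ (w : M) (u : A), u ∈ S ∧ l w = u • b k := by
    intro k
    obtain ⟨⟨w, u⟩, hw⟩ := IsLocalizedModule.surj S l (b k)
    exact ⟨w, u, u.2, hw.symm⟩
  choose w u hu hw using hb
  have hloc : ∀ m, ∃ q ∈ S, q • m ∈ Submodule.span A (Set.range w) := by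
    intro m
    obtain ⟨d, hd⟩ := IsLocalization.exist_integer_multiples_of_finset S
      (Finset.univ.image fun k => b.repr (l m) k * IsLocalization.mk' AP 1 ⟨u k, hu k⟩)
    have hd' : ∀ k, ∃ c : A, algebraMap A AP c * algebraMap A AP (u k) =
        algebraMap A AP d * b.repr (l m) k := by
      intro k
      obtain ⟨c, hc⟩ := hd _ (Finset.mem_image_of_mem _ (Finset.mem_univ k))
      refine ⟨c, ?_⟩
      have h1 := IsLocalization.mk'_spec AP 1 ⟨u k, hu k⟩
      rw [map_one] at h1
      rw [hc, Algebra.smul_def, mul_assoc, mul_assoc]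
      erw [h1]
      rw [mul_one]
    choose c hc using hd'
    have : l ((d : A) • m) = l (∑ k, c k • w k) := by
      rw [map_smul, map_sum, ← b.sum_repr (l m), Finset.smul_sum]
      refine Finset.sum_congr rfl fun k _ => ?_
      rw [map_smul, hw, ← algebraMap_smul AP (d : A), ← algebraMap_smul AP (c k),
        ← algebraMap_smul AP (u k), smul_smul, smul_smul, hc]
    obtain ⟨e, he⟩ := (IsLocalizedModule.eq_iff_exists S l).mp this
    refine ⟨e * d, mul_mem e.2 d.2, ?_⟩
    rw [mul_smul]
    have he' : (e : A) • ((d : A) • m) = (e : A) • ∑ k, c k • w k := he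
    rw [he']
    exact Submodule.smul_mem _ _ (Submodule.sum_mem _ fun k _ =>
      Submodule.smul_mem _ _ (Submodule.subset_span ⟨k, rfl⟩))
  obtain ⟨T, hT⟩ := (inferInstance : Module.Finite A M).fg_top
  choose q hqS hq using hloc
  refine ⟨_, inferInstance, w, ∏ t ∈ T, q t, ?_, ?_, fun m => ?_⟩
  · rw [Fintype.linearIndependent_iff]
    intro c hc k
    have h1 : ∑ k, (algebraMap A AP (c k * u k)) • b k = 0 := by
      have := congrArg l hc
      rw [map_sum, map_zero] at this
      rw [← this]
      refine Finset.sum_congr rfl fun k _ => ?_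
      rw [map_smul, hw, algebraMap_smul, mul_smul]
    have h2 := Fintype.linearIndependent_iff.mp b.linearIndependent _ h1 k
    rw [map_eq_zero_iff _ hinj] at h2
    exact (mul_eq_zero.mp h2).resolve_right fun h => hu k (h ▸ P.zero_mem)
  · rw [← memP]
    exact Submonoid.prod_mem S fun t _ => hqS t
  · have : m ∈ Submodule.span A (T : Set M) := hT ▸ trivial
    induction this using Submodule.span_induction with
    | mem t ht =>
      rw [← Finset.prod_erase_mul _ _ ht, mul_smul]
      exact Submodule.smul_mem _ _ (hq t)
    | zero => simp
    | add x y _ _ hx hy => rw [smul_add]; exact add_mem hx hy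
    | smul a x _ hx => rw [smul_comm]; exact Submodule.smul_mem _ _ hx

lemma Ideal.exists_mem_forall_notMem {ι A : Type} [Fintype ι] [CommRing A] (I : Ideal A)
    (P : ι → Ideal A) (hP : ∀ j, (P j).IsPrime) (h : ∀ j, ∃ t ∈ I, t ∉ P j) :
    ∃ t ∈ I, ∀ j, t ∉ P j := by
  classical
  by_contra! hcon
  have hsub : (I : Set A) ⊆ ⋃ j ∈ ((Finset.univ : Finset ι) : Set ι), (P j : Set A) := by
    intro t ht
    obtain ⟨j, hj⟩ := hcon t ht
    exact Set.mem_biUnion (Finset.mem_coe.mpr (Finset.mem_univ j)) hj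
  rcases isEmpty_or_nonempty ι with hι | ⟨⟨j₀⟩⟩
  · obtain ⟨j, -⟩ := hcon 0 I.zero_mem
    exact hι.elim j
  obtain ⟨j, -, hj⟩ := (Ideal.subset_union_prime j₀ j₀ fun j _ _ _ => hP j).mp hsub
  obtain ⟨t, ht, ht'⟩ := h j
  exact ht' (hj ht)

section CodimensionTwo

variable {ι G A B : Type} [Fintype ι] [Group G] [CommRing A] [CommRing B] [Algebra A B]
  {ρ : G →* (B →+* B)} {y : ι → A}

local notation "𝔞" => algebraMap A B

lemma IsDelta.exists_of_span {κ : Type} [Fintype κ] {w : κ → B} {q : A} {s : B}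
    (hfix : ∀ g a, ρ g (𝔞 a) = 𝔞 a) (hs : IsDelta ρ ⊤ s)
    (hw : ∀ b : B, q • b ∈ Submodule.span A (Set.range w)) :
    ∃ u : κ → B, ∑ l, u l * w l = 𝔞 q * s ∧ ∀ σ, σ ≠ 1 → ∑ l, u l * ρ σ (w l) = 0 := by
  obtain ⟨κ', _, x, z, -, -, h1, h2⟩ := hs
  have : ∀ k, ∃ d : κ → A, ∑ l, d l • w l = q • z k := fun k =>
    (Submodule.mem_span_range_iff_exists_fun A).mp (hw (z k))
  choose d hd using this
  have key : ∀ σ, ∑ l, (∑ k, x k * 𝔞 (d k l)) * ρ σ (w l) = 𝔞 q * ∑ k, x k * ρ σ (z k) := by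
    intro σ
    simp_rw [Finset.sum_mul]
    rw [Finset.sum_comm, Finset.mul_sum]
    refine Finset.sum_congr rfl fun k _ => ?_
    have := congrArg (ρ σ) (hd k)
    simp only [Algebra.smul_def, map_sum, map_mul, hfix] at this
    simp_rw [mul_assoc]
    rw [← Finset.mul_sum, this]
    ring
  refine ⟨fun l => ∑ k, x k * 𝔞 (d k l), ?_, fun σ hσ => by rw [key, h2 σ hσ, mul_zero]⟩
  have := key 1
  simp only [map_one, RingHom.one_def, RingHom.id_apply] at this
  rw [this, h1]

lemma IsSatCover.exists_isDelta_forall_not_dvd (h : IsSatCover ρ y) (hy : ∀ j, Prime (y j)) :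
    ∃ t, IsDelta ρ ⊤ (𝔞 t) ∧ ∀ j, ¬ y j ∣ t := by
  obtain ⟨t, ht, ht'⟩ := Ideal.exists_mem_forall_notMem
    (deltaIdeal (algebraMap A B) ρ ⊤ fun _ => trivial) (fun j => Ideal.span {y j})
    (fun j => (Ideal.span_singleton_prime (hy j).ne_zero).mpr (hy j)) (fun j => by
      obtain ⟨t, ht, htj⟩ := h.tame j
      exact ⟨t, ht, fun h' => htj (Ideal.mem_span_singleton.mp h')⟩)
  exact ⟨t, ht, fun j hj => ht' j (Ideal.mem_span_singleton.mpr hj)⟩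

variable [Fintype G] [IsDomain A]

lemma IsSatCover.eq_zero_of_forall_sum_eq_zero (h : IsSatCover ρ y) (hy : ∀ j, y j ≠ 0)
    {κ : Type} [Fintype κ] {w : κ → B} {q : A} (hq : q ≠ 0) (hli : LinearIndependent A w)
    (hw : ∀ b : B, q • b ∈ Submodule.span A (Set.range w)) {c : κ → B}
    (hc : ∀ σ, ∑ l, c l * ρ σ (w l) = 0) (i : κ) : c i = 0 := by
  classical
  obtain ⟨N, κ', _, x, z, -, -, h1, h2⟩ := h.gal
  have hs : (∏ j, y j) ^ N ≠ 0 := pow_ne_zero _ (Finset.prod_ne_zero_iff.mpr fun j _ => hy j)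
  set s := (∏ j, y j) ^ N with hsdef
  have : ∀ k, ∃ d : κ → A, ∑ l, d l • w l = q • x k := fun k =>
    (Submodule.mem_span_range_iff_exists_fun A).mp (hw (x k))
  choose d hd using this
  choose tr htr using h.exists_gtr
  have hdual : ∀ i l, ∑ k, d k l * tr (z k * w i) = if l = i then q * s else 0 := by
    intro i
    have hsum : ∑ l, (∑ k, d k l * tr (z k * w i) - if l = i then q * s else 0) • w l = 0 := by
      simp_rw [sub_smul, ite_smul, zero_smul, Finset.sum_sub_distrib, Finset.sum_smul]
      rw [Finset.sum_ite_eq' Finset.univ i, if_pos (Finset.mem_univ i), Finset.sum_comm,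
        sub_eq_zero]
      have h3 := sum_mul_gtr h1 h2 (w i)
      rw [mul_smul, Algebra.smul_def s, ← h3, Finset.smul_sum]
      refine Finset.sum_congr rfl fun k _ => ?_
      rw [← htr, ← smul_mul_assoc, ← hd, Finset.sum_mul]
      refine Finset.sum_congr rfl fun l _ => ?_
      rw [smul_mul_assoc, mul_comm (w l), ← Algebra.smul_def, smul_smul]
    intro l
    exact sub_eq_zero.mp (Fintype.linearIndependent_iff.mp hli _ hsum l)
  have hv : ∀ i l, gtr ρ ((∑ k, 𝔞 (d k l) * z k) * w i) = 𝔞 (if l = i then q * s else 0) := by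
    intro i l
    rw [← hdual i l]
    simp only [map_sum, map_mul, htr, Finset.sum_mul, gtr]
    rw [Finset.sum_comm]
    simp only [h.fix, Finset.mul_sum, mul_assoc]
  refine h.torsionFree (q * s) _ (mul_ne_zero hq hs) ?_
  have h4 : ∑ l, c l * 𝔞 (if i = l then q * s else 0) = 0 := by
    simp_rw [← hv, gtr, Finset.mul_sum]
    rw [Finset.sum_comm]
    refine Finset.sum_eq_zero fun σ _ => ?_
    have : ∀ l, c l * ρ σ ((∑ k, 𝔞 (d k i) * z k) * w l) =
        ρ σ (∑ k, 𝔞 (d k i) * z k) * (c l * ρ σ (w l)) := fun l => by rw [map_mul]; ring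
    simp_rw [this]
    rw [← Finset.mul_sum, hc, mul_zero]
  rw [Fintype.sum_eq_single i (fun l hl => by simp [hl.symm]), if_pos rfl] at h4
  rw [mul_comm, h4]

/-- If the finite model becomes free after inverting `q`, it becomes étale after inverting `q`. -/
lemma IsSatCover.isDelta_of_linearIndependent (h : IsSatCover ρ y) (hy : ∀ j, Prime (y j))
    {κ : Type} [Fintype κ] {w : κ → B} {q : A} (hq : q ≠ 0) (hli : LinearIndependent A w)
    (hw : ∀ b : B, q • b ∈ Submodule.span A (Set.range w)) : IsDelta ρ ⊤ (𝔞 q) := by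
  obtain ⟨N, hN⟩ := h.gal
  obtain ⟨t, ht, hty⟩ := h.exists_isDelta_forall_not_dvd hy
  obtain ⟨u, hu1, hu2⟩ := hN.exists_of_span h.fix hw
  obtain ⟨u', hu1', hu2'⟩ := ht.exists_of_span h.fix hw
  have hs : (∏ j, y j) ^ N ≠ 0 :=
    pow_ne_zero _ (Finset.prod_ne_zero_iff.mpr fun j _ => (hy j).ne_zero)
  have hprop : ∀ l, 𝔞 t * u l = 𝔞 ((∏ j, y j) ^ N) * u' l := by
    intro l
    rw [← sub_eq_zero]
    refine h.eq_zero_of_forall_sum_eq_zero (fun j => (hy j).ne_zero) hq hli hw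
      (c := fun l => 𝔞 t * u l - 𝔞 ((∏ j, y j) ^ N) * u' l) (fun σ => ?_) l
    simp_rw [sub_mul, mul_assoc, Finset.sum_sub_distrib, ← Finset.mul_sum]
    by_cases hσ : σ = 1
    · subst hσ
      simp only [map_one, RingHom.one_def, RingHom.id_apply]
      rw [hu1, hu1']
      ring
    · rw [hu2 σ hσ, hu2' σ hσ]
      ring
  have hdvd : ∀ l, ∃ v, u l = 𝔞 ((∏ j, y j) ^ N) * v := by
    intro l
    have := prod_pow_dvd_of_dvd_mul Finset.univ (fun j => 𝔞 (y j)) (a := 𝔞 t) (b := u l)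
      (fun j _ b hb => h.torsionFree _ _ (hy j).ne_zero hb)
      (fun j _ b hb => h.sat j t b (hty j) hb) N
      (by rw [← map_prod, ← map_pow, hprop]; exact dvd_mul_right _ _)
    rwa [← map_prod, ← map_pow] at this
  choose v hv using hdvd
  refine ⟨κ, inferInstance, v, w, fun _ => trivial, fun _ => trivial, ?_, fun σ hσ => ?_⟩
  · rw [← sub_eq_zero]
    refine h.torsionFree _ _ hs ?_
    rw [mul_sub, mul_comm _ (𝔞 q), ← hu1, Finset.mul_sum, sub_eq_zero]
    exact Finset.sum_congr rfl fun l _ => by rw [hv]; ring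
  · refine h.torsionFree _ _ hs ?_
    rw [← hu2 σ hσ, Finset.mul_sum]
    exact Finset.sum_congr rfl fun l _ => by rw [hv]; ring

/-- Purity in codimension two. -/
theorem IsSatCover.exists_isDelta_not_dvd_mk [IsNoetherianRing A] (h : IsSatCover ρ y)
    (hy : ∀ j, Prime (y j)) {f : A} (hf : Prime f) (hfy : ∀ j, ¬ y j ∣ f) {j : ι}
    (hyf : Prime (Ideal.Quotient.mk (Ideal.span {f}) (y j))) :
    ∃ q, IsDelta ρ ⊤ (𝔞 q) ∧
      ¬ Ideal.Quotient.mk (Ideal.span {f}) (y j) ∣ Ideal.Quotient.mk (Ideal.span {f}) q := by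
  have := h.finite fun j => (hy j).ne_zero
  obtain ⟨κ, _, w, q, hli, hq, hw⟩ := exists_linearIndependent_of_torsionFree_mod (M := B) hf hyf
    (fun b hb => h.torsionFree f b hf.ne_zero (by rwa [← Algebra.smul_def]))
    (fun a b b' ha hab => by
      simp only [Algebra.smul_def] at hab ⊢
      exact h.dvd_of_dvd_mul hy hf hfy ha ⟨b', hab⟩)
  refine ⟨q, h.isDelta_of_linearIndependent hy (fun h0 => hq ?_) hli hw, hq⟩
  rw [h0, map_zero]
  exact dvd_zero _

end CodimensionTwo

section Localize

variable {ι G A C : Type} [Fintype ι] [Group G] [CommRing A] [CommRing C]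

/-- The action of `G` on the localization at an invariant element. -/
noncomputable def localizationAction (ρ : G →* (C →+* C)) (c : C) (hc : ∀ g, ρ g c = c) :
    G →* (Localization.Away c →+* Localization.Away c) where
  toFun g := IsLocalization.map (Localization.Away c) (ρ g) (T := Submonoid.powers c)
    (M := Submonoid.powers c) (by
      rintro _ ⟨n, rfl⟩
      exact ⟨n, by simp [hc]⟩)
  map_one' := by
    refine IsLocalization.ringHom_ext (Submonoid.powers c) ?_
    ext x
    simp
  map_mul' g g' := by
    refine IsLocalization.ringHom_ext (Submonoid.powers c) ?_
    ext x
    simp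

lemma localizationAction_algebraMap (ρ : G →* (C →+* C)) (c : C) (hc : ∀ g, ρ g c = c) (g : G)
    (x : C) : localizationAction ρ c hc g (algebraMap C _ x) = algebraMap C _ (ρ g x) := by
  simp [localizationAction]

theorem isCover_localization {i : A →+* C} {ρ : G →* (C →+* C)} {y : ι → A}
    (hinj : Function.Injective i) (hreg : ∀ j c, i (y j) * c = 0 → c = 0)
    (hfix : ∀ g a, ρ g (i a) = i a) (hinv : ∀ c, (∀ g, ρ g c = c) → ∃ a, i a = c)
    (hint : ∀ c, i.IsIntegralElem c) (hgal : ∃ N, IsDelta ρ ⊤ (i ((∏ j, y j) ^ N)))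
    (htame : ∀ j, ∃ t, IsDelta ρ ⊤ (i t) ∧ ¬ y j ∣ t) :
    Function.Injective (algebraMap C (Localization.Away (i (∏ j, y j)))) ∧
    IsCover ((algebraMap C (Localization.Away (i (∏ j, y j)))).comp i)
      (localizationAction ρ (i (∏ j, y j)) fun g => hfix g _) y := by
  classical
  set Y := i (∏ j, y j) with hY
  have hYreg : Y ∈ nonZeroDivisors C := by
    rw [hY, map_prod]
    refine Submonoid.prod_mem _ fun j _ => ?_
    exact mem_nonZeroDivisors_iff_right.mpr fun c hc => hreg j c (by rwa [mul_comm])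
  have hCinj : Function.Injective (algebraMap C (Localization.Away Y)) :=
    IsLocalization.injective _ (Submonoid.powers_le.mpr hYreg)
  refine ⟨hCinj, ?_⟩
  have hδ : ∀ a, IsDelta ρ ⊤ (i a) → IsDelta (localizationAction ρ Y fun g => hfix g _)
      (intSub ((algebraMap C (Localization.Away Y)).comp i))
      ((algebraMap C (Localization.Away Y)).comp i a) := fun a ha =>
    ha.map (algebraMap C (Localization.Away Y))
      (fun σ e => (localizationAction_algebraMap ρ Y _ σ e).symm)
      (fun c _ => isIntegralElem_map_of_comp (RingHom.id A) _ (by intro a; rfl) (hint c))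
  refine ⟨hCinj.comp hinj, fun j => ?_, fun g a => ?_, fun e he => ?_, ?_, fun j => ?_⟩
  · have h1 : IsUnit (algebraMap C (Localization.Away Y) Y) :=
      IsLocalization.Away.algebraMap_isUnit Y
    refine isUnit_of_dvd_unit ?_ h1
    exact map_dvd ((algebraMap C _).comp i) (Finset.dvd_prod_of_mem y (Finset.mem_univ j))
  · rw [RingHom.comp_apply, localizationAction_algebraMap, hfix]
  · obtain ⟨n, c, hc⟩ := IsLocalization.Away.surj Y e
    obtain ⟨a, ha⟩ := hinv c fun g => hCinj (by
      rw [← localizationAction_algebraMap ρ Y (fun g => hfix g _), ← hc, map_mul, he, map_pow,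
        localizationAction_algebraMap, hfix])
    refine ⟨n, a, ?_⟩
    rw [RingHom.comp_apply, RingHom.comp_apply, ha, ← hc, mul_comm]
  · obtain ⟨N, hN⟩ := hgal
    refine ⟨N, ?_⟩
    rw [← map_pow]
    exact hδ _ hN
  · obtain ⟨t, ht, htj⟩ := htame j
    exact ⟨t, hδ _ ht, htj⟩

end Localize

section Reduction

variable {ι G A B : Type} [Fintype ι] [Group G] [CommRing A] [CommRing B] [Algebra A B]
  {ρ : G →* (B →+* B)} {y : ι → A}

local notation "𝔞" => algebraMap A B

/-- The action of `G` on the quotient by an invariant element. -/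
def quotientAction (ρ : G →* (B →+* B)) (c : B) (hc : ∀ g, ρ g c = c) :
    G →* ((B ⧸ Ideal.span {c}) →+* (B ⧸ Ideal.span {c})) where
  toFun g := Ideal.quotientMap _ (ρ g) (by
    rw [Ideal.span_singleton_le_iff_mem, Ideal.mem_comap, hc]
    exact Ideal.mem_span_singleton_self c)
  map_one' := by
    refine Ideal.Quotient.ringHom_ext ?_
    ext x
    simp
  map_mul' g g' := by
    refine Ideal.Quotient.ringHom_ext ?_
    ext x
    simp

lemma quotientAction_mk (ρ : G →* (B →+* B)) (c : B) (hc : ∀ g, ρ g c = c) (g : G) (x : B) :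
    quotientAction ρ c hc g (Ideal.Quotient.mk _ x) = Ideal.Quotient.mk _ (ρ g x) := by
  simp [quotientAction]

variable (B) in
/-- The map `A / f → B / f`. -/
def quotientSpanMap (f : A) : (A ⧸ Ideal.span {f}) →+* (B ⧸ Ideal.span {𝔞 f}) :=
  Ideal.quotientMap _ (algebraMap A B) (by
    rw [Ideal.span_singleton_le_iff_mem, Ideal.mem_comap]
    exact Ideal.mem_span_singleton_self _)

lemma quotientSpanMap_mk (f a : A) : quotientSpanMap B f (Ideal.Quotient.mk _ a) =
    Ideal.Quotient.mk _ (𝔞 a) := by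
  simp [quotientSpanMap]

variable [Fintype G] [IsDomain A]

theorem IsSatCover.isCover_quotient [IsNoetherianRing A] (h : IsSatCover ρ y)
    (hcard : IsUnit (Fintype.card G : A))
    (hy : ∀ j, Prime (y j)) {f : A} (hf : Prime f) (hfy : ∀ j, ¬ y j ∣ f)
    (hyf : ∀ j, Prime (Ideal.Quotient.mk (Ideal.span {f}) (y j))) :
    Function.Injective (algebraMap (B ⧸ Ideal.span {𝔞 f}) (Localization.Away
      (quotientSpanMap B f (∏ j, Ideal.Quotient.mk (Ideal.span {f}) (y j))))) ∧
    ∃ ρ' : G →* (Localization.Away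
      (quotientSpanMap B f (∏ j, Ideal.Quotient.mk (Ideal.span {f}) (y j))) →+* _),
    (∀ g b, ρ' g (algebraMap (B ⧸ Ideal.span {𝔞 f}) _ (Ideal.Quotient.mk _ b)) =
      algebraMap (B ⧸ Ideal.span {𝔞 f}) _ (Ideal.Quotient.mk _ (ρ g b))) ∧
    IsCover ((algebraMap (B ⧸ Ideal.span {𝔞 f}) (Localization.Away
      (quotientSpanMap B f (∏ j, Ideal.Quotient.mk (Ideal.span {f}) (y j))))).comp
        (quotientSpanMap B f)) ρ'
      (fun j => Ideal.Quotient.mk (Ideal.span {f}) (y j)) := by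
  have hfin := h.finite fun j => (hy j).ne_zero
  have hδ : ∀ a, IsDelta ρ ⊤ (𝔞 a) → IsDelta (quotientAction ρ (𝔞 f) fun g => h.fix g f) ⊤
      (quotientSpanMap B f (Ideal.Quotient.mk _ a)) := by
    intro a ha
    rw [quotientSpanMap_mk]
    exact ha.map (Ideal.Quotient.mk (Ideal.span {𝔞 f}))
      (fun σ e => (quotientAction_mk ρ _ _ σ e).symm) fun _ _ => Subring.mem_top _
  have hz : ∀ b : B, Ideal.Quotient.mk (Ideal.span {𝔞 f}) b = 0 ↔ 𝔞 f ∣ b := fun b => by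
    rw [Ideal.Quotient.eq_zero_iff_mem, Ideal.mem_span_singleton]
  have hfix' : ∀ (g : G) (a : A ⧸ Ideal.span {f}),
      quotientAction ρ (𝔞 f) (fun g => h.fix g f) g (quotientSpanMap B f a) =
        quotientSpanMap B f a := by
    intro g a
    obtain ⟨a, rfl⟩ := Ideal.Quotient.mk_surjective a
    rw [quotientSpanMap_mk, quotientAction_mk, h.fix]
  have key := isCover_localization (i := quotientSpanMap B f)
    (ρ := quotientAction ρ (𝔞 f) fun g => h.fix g f)
    (y := fun j => Ideal.Quotient.mk (Ideal.span {f}) (y j)) ?_ ?_ hfix' ?_ ?_ ?_ ?_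
  · refine ⟨key.1, _, fun g b => ?_, key.2⟩
    rw [localizationAction_algebraMap, quotientAction_mk]
  · refine (injective_iff_map_eq_zero _).mpr fun a ha => ?_
    obtain ⟨a, rfl⟩ := Ideal.Quotient.mk_surjective a
    rw [quotientSpanMap_mk, hz] at ha
    rw [Ideal.Quotient.eq_zero_iff_mem, Ideal.mem_span_singleton]
    exact h.dvd_of_algebraMap_dvd hf.ne_zero ha
  · intro j c hc
    obtain ⟨c, rfl⟩ := Ideal.Quotient.mk_surjective c
    rw [quotientSpanMap_mk, ← map_mul, hz] at hc
    rw [hz]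
    exact h.dvd_of_dvd_mul_left hy hfy hc
  · intro c hc
    obtain ⟨c, rfl⟩ := Ideal.Quotient.mk_surjective c
    obtain ⟨a, ha⟩ := h.exists_gtr c
    obtain ⟨v, hv⟩ := hcard.exists_left_inv
    refine ⟨Ideal.Quotient.mk _ (v * a), ?_⟩
    have h1 : Ideal.Quotient.mk (Ideal.span {𝔞 f}) (gtr ρ c) =
        (Fintype.card G : B ⧸ Ideal.span {𝔞 f}) * Ideal.Quotient.mk _ c := by
      simp only [gtr, map_sum, ← quotientAction_mk ρ (𝔞 f) (fun g => h.fix g f), hc]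
      simp
    rw [quotientSpanMap_mk, map_mul, map_mul, ha, h1, ← mul_assoc]
    have h2 : Ideal.Quotient.mk (Ideal.span {𝔞 f}) (𝔞 v) * (Fintype.card G : B ⧸ Ideal.span {𝔞 f})
        = 1 := by
      rw [← map_natCast (Ideal.Quotient.mk (Ideal.span {𝔞 f})), ← map_natCast (algebraMap A B),
        ← map_mul, ← map_mul, hv, map_one, map_one]
    rw [h2, one_mul]
  · intro c
    obtain ⟨c, rfl⟩ := Ideal.Quotient.mk_surjective c
    exact isIntegralElem_map_of_comp (Ideal.Quotient.mk (Ideal.span {f}))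
      (Ideal.Quotient.mk (Ideal.span {𝔞 f})) (i' := quotientSpanMap B f)
      (fun a => (quotientSpanMap_mk f a).symm) (Algebra.IsIntegral.isIntegral (R := A) c)
  · obtain ⟨N, hN⟩ := h.gal
    exact ⟨N, by simpa using hδ _ hN⟩
  · intro j
    obtain ⟨q, hq, hqj⟩ := h.exists_isDelta_not_dvd_mk hy hf hfy (hyf j)
    exact ⟨_, hδ _ hq, hqj⟩

end Reduction

section Completeness

variable {A : Type} [CommRing A] {I : Ideal A}

lemma IsPrecomplete.exists_limit [IsPrecomplete I A] {M : Type} [AddCommGroup M] [Module A M]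
    [Module.Finite A M] (w : ℕ → M) (hw : ∀ n, w (n + 1) - w n ∈ I ^ n • (⊤ : Submodule A M)) :
    ∃ c, ∀ n, c - w n ∈ I ^ n • (⊤ : Submodule A M) := by
  obtain ⟨k, g, hg⟩ := Module.Finite.exists_fin (R := A) (M := M)
  have h1 : ∀ n, ∃ a : Fin k → A, (∀ l, a l ∈ I ^ n) ∧ ∑ l, a l • g l = w (n + 1) - w n := by
    intro n
    have := hw n
    rw [← hg, Submodule.mem_ideal_smul_span_iff_exists_sum] at this
    obtain ⟨a, ha, h⟩ := this
    exact ⟨a, ha, by rw [← h, Finsupp.sum_fintype _ _ (by simp)]⟩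
  choose a ha haw using h1
  have h2 : ∀ l, ∃ L : A, ∀ n, ∑ i ∈ Finset.range n, a i l - L ∈ I ^ n := by
    intro l
    obtain ⟨L, hL⟩ := IsPrecomplete.prec (I := I) (M := A) inferInstance
      (f := fun n => ∑ i ∈ Finset.range n, a i l) (fun {m n} hmn => by
        rw [SModEq.sub_mem, ← neg_mem_iff, neg_sub, Finset.sum_range_sub_sum_range hmn]
        refine Submodule.sum_mem _ fun i hi => ?_
        simp only [Finset.mem_filter, Finset.mem_range] at hi
        simpa using Ideal.pow_le_pow_right hi.2 (ha i l))
    refine ⟨L, fun n => ?_⟩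
    have := hL n
    rw [SModEq.sub_mem] at this
    simpa using this
  choose L hL using h2
  have h3 : ∀ n, w n = w 0 + ∑ l, (∑ i ∈ Finset.range n, a i l) • g l := by
    intro n
    induction n with
    | zero => simp
    | succ n ih =>
      simp only [Finset.sum_range_succ, add_smul, Finset.sum_add_distrib]
      rw [haw, ← add_assoc, ← ih]
      abel
  refine ⟨w 0 + ∑ l, L l • g l, fun n => ?_⟩
  have h4 : w 0 + ∑ l, L l • g l - w n = ∑ l, (L l - ∑ i ∈ Finset.range n, a i l) • g l := by
    rw [h3 n]
    simp only [sub_smul, Finset.sum_sub_distrib]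
    abel
  rw [h4]
  refine Submodule.sum_mem _ fun l _ => Submodule.smul_mem_smul ?_ trivial
  rw [← neg_mem_iff, neg_sub]
  exact hL l n

/-- Completeness passes to finite extensions. -/
lemma IsPrecomplete.of_finite [IsPrecomplete I A] {A' : Type} [CommRing A'] [Algebra A A']
    [Module.Finite A A'] {J : Ideal A'} (hIJ : I.map (algebraMap A A') ≤ J) {c : ℕ} (hc : 0 < c)
    (hJI : J ^ c ≤ I.map (algebraMap A A')) : IsPrecomplete J A' := by
  have hmem : ∀ n (z : A'), z ∈ I ^ n • (⊤ : Submodule A A') ↔ z ∈ (I.map (algebraMap A A')) ^ n := by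
    intro n z
    rw [← Ideal.map_pow, Ideal.smul_top_eq_map]
    rfl
  refine isPrecomplete_iff.mpr fun w hw => ?_
  have hw' : ∀ {m n}, m ≤ n → w m - w n ∈ J ^ m := by
    intro m n hmn
    have := hw hmn
    rw [SModEq.sub_mem] at this
    simpa using this
  obtain ⟨L, hL⟩ := IsPrecomplete.exists_limit (I := I) (fun n => w (c * n)) (fun n => by
    rw [hmem]
    refine Ideal.pow_right_mono hJI n ?_
    rw [← pow_mul, ← neg_mem_iff, neg_sub]
    exact hw' (by nlinarith))
  refine ⟨L, fun n => ?_⟩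
  have h1 := hL n
  rw [hmem] at h1
  have h2 := add_mem (Ideal.pow_right_mono hIJ n h1) (neg_mem (hw' (m := n) (n := c * n) (by nlinarith)))
  rw [SModEq.sub_mem, ← neg_mem_iff]
  simp only [smul_eq_mul, Ideal.mul_top]
  convert h2 using 1
  ring

variable [IsLocalRing A] [IsNoetherianRing A] {B : Type} [CommRing B] [Algebra A B]
  [Module.Finite A B] {f : A}

lemma eq_zero_of_forall_pow_dvd (hf : f ∈ maximalIdeal A) (b : B)
    (hb : ∀ n : ℕ, algebraMap A B f ^ n ∣ b) : b = 0 := by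
  refine IsHausdorff.haus (I := maximalIdeal A) (M := B) inferInstance b fun n => ?_
  rw [SModEq.zero]
  obtain ⟨c, rfl⟩ := hb n
  rw [← map_pow, ← Algebra.smul_def]
  exact Submodule.smul_mem_smul (Ideal.pow_mem_pow hf n) trivial

lemma exists_limit_of_forall_pow_dvd [IsPrecomplete (maximalIdeal A) A]
    (hf : f ∈ maximalIdeal A) (w : ℕ → B)
    (hw : ∀ n, algebraMap A B f ^ n ∣ w (n + 1) - w n) :
    ∃ c, ∀ n, algebraMap A B f ^ n ∣ c - w n := by
  have hdvd : ∀ n (b : B), algebraMap A B f ^ n ∣ b → b ∈ maximalIdeal A ^ n • (⊤ : Submodule A B) := by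
    rintro n _ ⟨c, rfl⟩
    rw [← map_pow, ← Algebra.smul_def]
    exact Submodule.smul_mem_smul (Ideal.pow_mem_pow hf n) trivial
  obtain ⟨c, hc⟩ := IsPrecomplete.exists_limit (I := maximalIdeal A) w fun n => hdvd n _ (hw n)
  refine ⟨c, fun n => ?_⟩
  let Q := B ⧸ Ideal.span {algebraMap A B f ^ n}
  have hmono : ∀ m, n ≤ m → algebraMap A B f ^ n ∣ w m - w n := by
    intro m hm
    induction m, hm using Nat.le_induction with
    | base => simp
    | succ m hm ih =>
      have := dvd_add ((pow_dvd_pow _ hm).trans (hw m)) ih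
      rwa [sub_add_sub_cancel] at this
  have hz : Ideal.Quotient.mk (Ideal.span {algebraMap A B f ^ n}) (c - w n) = 0 := by
    have : Module.Finite A Q := Module.Finite.of_surjective
      ((Ideal.Quotient.mkₐ A (Ideal.span {algebraMap A B f ^ n})).toLinearMap)
      Ideal.Quotient.mk_surjective
    refine IsHausdorff.haus (I := maximalIdeal A) (M := Q) inferInstance _ fun m => ?_
    rw [SModEq.zero]
    have h1 : Ideal.Quotient.mk (Ideal.span {algebraMap A B f ^ n}) (c - w n) =
        Ideal.Quotient.mk _ (c - w (max m n)) := by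
      rw [Ideal.Quotient.eq, Ideal.mem_span_singleton]
      have := hmono (max m n) (le_max_right _ _)
      convert this using 1
      ring
    rw [h1]
    have h2 := Submodule.smul_mono_left (N := (⊤ : Submodule A B))
      (Ideal.pow_le_pow_right (I := maximalIdeal A) (le_max_left m n)) (hc (max m n))
    have h3 := Submodule.mem_map_of_mem (f := (Ideal.Quotient.mkₐ A
      (Ideal.span {algebraMap A B f ^ n})).toLinearMap) h2
    rw [Submodule.map_smul''] at h3
    exact Submodule.smul_mono le_rfl le_top h3
  rwa [Ideal.Quotient.eq_zero_iff_mem, Ideal.mem_span_singleton] at hz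

end Completeness

section Core

variable {ι G A B : Type} [Fintype ι] [Group G] [CommRing A] [CommRing B] [Algebra A B]
  {ρ : G →* (B →+* B)} {y : ι → A} [Fintype G] [IsDomain A]

local notation "𝔞" => algebraMap A B

lemma isIdempotentElem_of_section {E : Type} [CommRing E] {ρ : G →* (E →+* E)} {ε : E}
    (h1 : ∀ σ, σ ≠ 1 → ε * ρ σ ε = 0) (h2 : gtr ρ ε = 1) : ε * ε = ε := by
  have : ε * gtr ρ ε = ε * ε := by
    rw [gtr, Finset.mul_sum, Fintype.sum_eq_single 1 h1, map_one, RingHom.one_def, RingHom.id_apply]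
  rw [← this, h2, mul_one]

theorem IsSatCover.exists_section_of_quotient [IsNoetherianRing A] [IsLocalRing A]
    [IsPrecomplete (maximalIdeal A) A] (h : IsSatCover ρ y)
    (hcard : IsUnit (Fintype.card G : A))
    (hy : ∀ j, Prime (y j)) {f : A} (hf : Prime f) (hfm : f ∈ maximalIdeal A)
    (hfy : ∀ j, ¬ y j ∣ f)
    (hyf : ∀ j, Prime (Ideal.Quotient.mk (Ideal.span {f}) (y j)))
    (hquot : ∀ {E : Type} [CommRing E] (i : A ⧸ Ideal.span {f} →+* E) (ρ' : G →* (E →+* E)),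
      IsCover i ρ' (fun j => Ideal.Quotient.mk (Ideal.span {f}) (y j)) →
      ∃ ε : E, (∀ σ, σ ≠ 1 → ε * ρ' σ ε = 0) ∧ gtr ρ' ε = 1) :
    ∃ c : B, (∀ σ, σ ≠ 1 → c * ρ σ c = 0) ∧ gtr ρ c = 1 := by
  have hfin := h.finite fun j => (hy j).ne_zero
  obtain ⟨hinj, ρ', hρ', hc⟩ := h.isCover_quotient hcard hy hf hfy hyf
  obtain ⟨ε, hε1, hε2⟩ := hquot _ ρ' hc
  let E := Localization.Away
      (quotientSpanMap B f (∏ j, Ideal.Quotient.mk (Ideal.span {f}) (y j)))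
  let q : B →+* E := (algebraMap (B ⧸ Ideal.span {𝔞 f}) E).comp (Ideal.Quotient.mk _)
  set i : A ⧸ Ideal.span {f} →+* E := (algebraMap _ E).comp (quotientSpanMap B f) with hi
  have hq : ∀ a, i (Ideal.Quotient.mk _ a) = q (𝔞 a) := fun a => by
    simp only [hi, q, RingHom.comp_apply, quotientSpanMap_mk]
  have hqρ : ∀ σ b, q (ρ σ b) = ρ' σ (q b) := fun σ b => (hρ' σ b).symm
  have hq0 : ∀ b, q b = 0 → 𝔞 f ∣ b := by
    intro b hb
    have : Ideal.Quotient.mk (Ideal.span {𝔞 f}) b = 0 := hinj (hb.trans (map_zero _).symm)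
    rwa [Ideal.Quotient.eq_zero_iff_mem, Ideal.mem_span_singleton] at this
  have hεε : ε * ε = ε := isIdempotentElem_of_section hε1 hε2
  have hεint : i.IsIntegralElem ε :=
    ⟨Polynomial.X ^ 2 - Polynomial.X, Polynomial.monic_X_pow_sub (Polynomial.degree_X_le.trans_lt (by norm_num)), by
      simp [pow_two, hεε]⟩
  have hBint : ∀ b, i.IsIntegralElem (q b) := fun b =>
    isIntegralElem_map_of_comp (i := algebraMap A B) (Ideal.Quotient.mk _) q
      (fun a => (hq a).symm) (Algebra.IsIntegral.isIntegral (R := A) b)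
  have hlift : ∀ u, IsDelta ρ ⊤ (𝔞 u) → ∃ w, q w = q (𝔞 u) * ε := by
    rintro u ⟨κ, _, x, z, -, -, h1, h2⟩
    have h3 := sum_mul_gtr (ρ := ρ') (x := fun k => q (x k)) (y := fun k => q (z k))
      (s := q (𝔞 u)) (by simp [← h1]) (fun σ hσ => by
        simp only [← hqρ, ← map_mul, ← map_sum, h2 σ hσ, map_zero]) ε
    have h4 : ∀ k, ∃ a, q (𝔞 a) = gtr ρ' (q (z k) * ε) := by
      intro k
      obtain ⟨a, ha⟩ := hc.exists_eq hyf (e := gtr ρ' (q (z k) * ε))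
        (intSub_le_satSub hyf (sum_mem (S := intSub i) fun σ _ =>
          hc.map_mem_intSub σ ((hBint (z k)).mul i hεint)))
        (fun g => gtr_invariant g _)
      obtain ⟨a, rfl⟩ := Ideal.Quotient.mk_surjective a
      exact ⟨a, by rw [ha, hq]⟩
    choose a ha using h4
    exact ⟨∑ k, x k * 𝔞 (a k), by rw [← h3]; simp [ha]⟩
  obtain ⟨N, hN⟩ := h.gal
  obtain ⟨t, ht, hyt⟩ := Ideal.exists_mem_forall_notMem
    (deltaIdeal (algebraMap A B) ρ ⊤ fun _ => trivial)
    (fun j => (Ideal.span {Ideal.Quotient.mk (Ideal.span {f}) (y j)}).comap (Ideal.Quotient.mk _))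
    (fun j => by
      have := (Ideal.span_singleton_prime (hyf j).ne_zero).mpr (hyf j)
      exact Ideal.comap_isPrime _ _) (fun j => by
      obtain ⟨t, ht, htj⟩ := h.exists_isDelta_not_dvd_mk hy hf hfy (hyf j)
      exact ⟨t, ht, fun h' => htj (Ideal.mem_span_singleton.mp h')⟩)
  obtain ⟨w, hw⟩ := hlift _ hN
  obtain ⟨w', hw'⟩ := hlift _ ht
  refine h.lift_section hy hf hfy hyf (eq_zero_of_forall_pow_dvd hfm)
    (exists_limit_of_forall_pow_dvd hfm) hN ht
    (fun j hj => hyt j (Ideal.mem_span_singleton.mpr hj)) (w := w) (w' := w')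
    (hq0 _ ?_) (hq0 _ ?_) (fun σ hσ => hq0 _ ?_) (hq0 _ ?_)
  · rw [map_sub, map_mul, map_mul, hw, hw']
    ring
  · rw [map_sub, map_pow, map_mul, hw, mul_pow, pow_two ε, hεε]
    ring
  · rw [map_mul, hqρ, hw, map_mul, ← hqρ, h.fix, mul_mul_mul_comm, hε1 σ hσ, mul_zero]
  · have : q (gtr ρ w) = gtr ρ' (q w) := by simp [gtr, hqρ]
    rw [map_sub, this, hw, gtr_mul_of_invariant (fun g => by rw [← hqρ, h.fix]), hε2, mul_one,
      sub_self]

end Core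

section Main

variable {ι G A E : Type} [Fintype ι] [Group G] [Fintype G] [CommRing A] [CommRing E]
  {i : A →+* E} {ρ : G →* (E →+* E)} {y : ι → A}

lemma IsCover.isCover_satSub_of_isDelta_one [IsDomain A] [IsNoetherianRing A] (h : IsCover i ρ y)
    (hy : ∀ j, Prime (y j)) (h1 : IsDelta ρ (intSub i) 1) :
    let := satAlgebra i y hy
    IsCover (algebraMap A (satSub i y hy)) (h.satAction hy) (fun j : Empty => (j.elim : A)) := by
  let := satAlgebra i y hy
  have hs : IsSatCover (A := A) (h.satAction hy) y := h.isSatCover hy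
  have hfin := hs.finite fun j => (hy j).ne_zero
  refine ⟨hs.inj, fun j => j.elim, hs.fix, fun e he => ?_, ⟨0, ?_⟩, fun j => j.elim⟩
  · obtain ⟨a, ha⟩ := hs.inv e he
    exact ⟨0, a, by simp [ha]⟩
  · obtain ⟨κ, _, x, z, hx, hz, h2, h3⟩ := h1
    refine ⟨κ, inferInstance, fun k => ⟨x k, intSub_le_satSub hy (hx k)⟩,
      fun k => ⟨z k, intSub_le_satSub hy (hz k)⟩,
      fun k => Algebra.IsIntegral.isIntegral (R := A) _,
      fun k => Algebra.IsIntegral.isIntegral (R := A) _, Subtype.ext ?_, fun σ hσ => Subtype.ext ?_⟩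
    · simpa using h2
    · have := h3 σ hσ
      push_cast
      exact this

/-- Residue fields of quotients of a local ring. -/
lemma isAlgClosed_residueField_of_surjective {A A' : Type} [CommRing A] [IsLocalRing A]
    [CommRing A'] [IsLocalRing A'] [IsAlgClosed (ResidueField A)] (φ : A →+* A')
    (hφ : Function.Surjective ((residue A').comp φ)) (hm : ∀ a ∈ maximalIdeal A, φ a ∈ maximalIdeal A') :
    IsAlgClosed (ResidueField A') := by
  let θ : ResidueField A →+* ResidueField A' := Ideal.Quotient.lift _ ((residue A').comp φ)
    fun a ha => (residue_eq_zero_iff _).mpr (hm a ha)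
  have hθ : Function.Surjective θ := by
    intro b
    obtain ⟨a, ha⟩ := hφ b
    exact ⟨residue A a, ha⟩
  exact IsAlgClosed.of_ringEquiv _ _ (RingEquiv.ofBijective θ ⟨θ.injective, hθ⟩)

theorem IsCover.exists_section [IsLocalRing A] [IsNoetherianRing A]
    [IsPrecomplete (maximalIdeal A) A] [IsAlgClosed (ResidueField A)] {Z : Finset A}
    (hZ : IsRegularParams A Z) (hyZ : ∀ j, y j ∈ Z) (hcard : IsUnit (Fintype.card G : A))
    (h : IsCover i ρ y) : ∃ ε : E, (∀ σ, σ ≠ 1 → ε * ρ σ ε = 0) ∧ gtr ρ ε = 1 := by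
  classical
  induction hn : Z.card using Nat.strong_induction_on generalizing A E ι with
  | h n ih =>
  have hdom := hZ.isDomain
  rcases Z.eq_empty_or_nonempty with rfl | hne
  · have : IsEmpty ι := ⟨fun j => by simpa using hyZ j⟩
    exact h.exists_section_of_maximalIdeal_eq_bot (by rw [← hZ.span_eq]; simp)
  have key : ∀ {ι E : Type} [Fintype ι] [CommRing E] {i : A →+* E} {ρ : G →* (E →+* E)}
      {y : ι → A}, (∀ j, y j ∈ Z) → IsCover i ρ y → (∀ z, Z = {z} → IsEmpty ι) →
      ∃ ε : E, (∀ σ, σ ≠ 1 → ε * ρ σ ε = 0) ∧ gtr ρ ε = 1 := by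
    intro ι E _ _ i ρ y hyZ h hcase
    obtain ⟨f, hfm, hf, hquot⟩ := exists_quotient_isRegularParams hZ y hyZ hne hcase
    have hloc : IsLocalRing (A ⧸ Ideal.span {f}) := isLocalRing_quotient_span hfm
    obtain ⟨Z', hZ', hZ'card, hyZ'⟩ := hquot
    have hy : ∀ j, Prime (y j) := fun j => hZ.prime (hyZ j)
    have hyf : ∀ j, Prime (Ideal.Quotient.mk (Ideal.span {f}) (y j)) := fun j => hZ'.prime (hyZ' j)
    have hfy : ∀ j, ¬ y j ∣ f := by
      intro j hj
      have := ((hy j).irreducible.associated_of_dvd hf.irreducible hj).symm.dvd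
      exact (hyf j).ne_zero (by rwa [Ideal.Quotient.eq_zero_iff_mem, Ideal.mem_span_singleton])
    have hmax : (maximalIdeal A).map (algebraMap A (A ⧸ Ideal.span {f})) =
        maximalIdeal (A ⧸ Ideal.span {f}) :=
      map_maximalIdeal_of_surjective _ Ideal.Quotient.mk_surjective
    have : IsPrecomplete (maximalIdeal (A ⧸ Ideal.span {f})) (A ⧸ Ideal.span {f}) :=
      IsPrecomplete.of_finite (I := maximalIdeal A) (c := 1) hmax.le one_pos
        (by rw [pow_one, hmax])
    have : IsAlgClosed (ResidueField (A ⧸ Ideal.span {f})) :=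
      isAlgClosed_residueField_of_surjective (Ideal.Quotient.mk (Ideal.span {f}))
        (residue_surjective.comp Ideal.Quotient.mk_surjective)
        fun a ha => hmax.le (Ideal.mem_map_of_mem _ ha)
    let := satAlgebra i y hy
    have hs : IsSatCover (A := A) (h.satAction hy) y := h.isSatCover hy
    obtain ⟨c, hc1, hc2⟩ := hs.exists_section_of_quotient hcard hy hf hfm hfy hyf
      (fun i' ρ' h' => ih Z'.card (hn ▸ hZ'card) hZ' hyZ' (by
        have := hcard.map (Ideal.Quotient.mk (Ideal.span {f}))
        rwa [map_natCast] at this) h' rfl)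
    refine ⟨c, fun σ hσ => congrArg Subtype.val (hc1 σ hσ), ?_⟩
    have := congrArg Subtype.val hc2
    rw [gtr] at this
    push_cast at this
    exact this
  by_cases hcase : ∀ z, Z = {z} → IsEmpty ι
  · exact key hyZ h hcase
  push Not at hcase
  obtain ⟨z, rfl, ⟨j⟩⟩ := hcase
  have hy : ∀ j, Prime (y j) := fun j => hZ.prime (hyZ j)
  obtain ⟨t, ht, htj⟩ := h.tame j
  have htu : IsUnit t := by
    by_contra hu
    have : t ∈ maximalIdeal A := hu
    rw [← hZ.span_eq, Finset.coe_singleton, Ideal.mem_span_singleton] at this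
    rw [Finset.mem_singleton.mp (hyZ j)] at htj
    exact htj this
  obtain ⟨u, hu⟩ := htu.exists_left_inv
  have h1 : IsDelta ρ (intSub i) 1 := by
    have := ht.mul_left (apply_mem_intSub i u)
    rwa [← map_mul, hu, map_one] at this
  let := satAlgebra i y hy
  obtain ⟨c, hc1, hc2⟩ := key (fun j => j.elim) (h.isCover_satSub_of_isDelta_one hy h1)
    fun _ _ => inferInstance
  refine ⟨c, fun σ hσ => congrArg Subtype.val (hc1 σ hσ), ?_⟩
  have := congrArg Subtype.val hc2
  rw [gtr] at this
  push_cast at this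
  exact this

end Main

section Abhyankar

variable {O B G : Type} [CommRing O] [IsDomain O] [IsDiscreteValuationRing O]
  [CommRing B] [IsDedekindDomain B] [Algebra O B] [Module.Finite O B] [Module.IsTorsionFree O B]
  [Group G] [Finite G] [MulSemiringAction G B] [IsGaloisGroup G O B]

variable (G) in
theorem exists_eq_unit_mul_pow_of_isGaloisGroup {ϖ : O} (hϖ : Irreducible ϖ) (P : Ideal B)
    [P.IsPrime] (hP : algebraMap O B ϖ ∈ P) :
    ∃ (θ : B) (e : ℕ) (u t : B), IsUnit u ∧ e ≠ 0 ∧ e ∣ Nat.card G ∧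
      algebraMap O B ϖ = u * θ ^ e ∧ θ ∈ P ∧ t ∉ P ∧ ∀ x ∈ P, θ ∣ t * x := by
  classical
  have hm0 : maximalIdeal O ≠ 0 := IsDiscreteValuationRing.not_a_field O
  have hmϖ : maximalIdeal O = Ideal.span {ϖ} := hϖ.maximalIdeal_eq
  have hPover : P.LiesOver (maximalIdeal O) := ⟨by
    refine (IsLocalRing.eq_maximalIdeal ?_).symm
    have hle : maximalIdeal O ≤ P.under O := by
      rw [hmϖ, Ideal.span_singleton_le_iff_mem]
      exact hP
    rw [← (maximalIdeal.isMaximal O).eq_of_le (Ideal.IsPrime.under O P).ne_top hle]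
    exact maximalIdeal.isMaximal O⟩
  have hfinmax : {Q : Ideal B | Q.IsMaximal}.Finite := by
    refine (Algebra.QuasiFinite.finite_primesOver (R := O) (S := B) (maximalIdeal O)).subset ?_
    intro Q hQ
    have : Q.IsMaximal := hQ
    refine ⟨hQ.isPrime, ⟨(IsLocalRing.eq_maximalIdeal ?_).symm⟩⟩
    exact Ideal.isMaximal_comap_of_isIntegral_of_isMaximal Q
  have hpid : IsPrincipalIdealRing B := IsPrincipalIdealRing.of_finite_maximals hfinmax
  set e := (maximalIdeal O).ramificationIdxIn B with he
  have he0 : e ≠ 0 := Ideal.ramificationIdxIn_ne_zero G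
  have hedvd : e ∣ Nat.card G := by
    rw [← Ideal.ncard_primesOver_mul_ramificationIdxIn_mul_inertiaDegIn (maximalIdeal O) B G]
    exact Dvd.dvd.mul_left (Dvd.intro _ rfl) _
  let s : Finset (Ideal B) := ((maximalIdeal O).primesOver B).toFinset
  have hs : ∀ Q, Q ∈ s ↔ Q ∈ (maximalIdeal O).primesOver B := fun Q => Set.mem_toFinset
  have hmap : (maximalIdeal O).map (algebraMap O B) = (∏ Q ∈ s, Q) ^ e := by
    rw [Ideal.map_algebraMap_eq_finsetProd_pow hm0, ← Finset.prod_pow]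
    refine Finset.prod_congr rfl fun Q hQ => ?_
    have hQ1 := (hs Q).mp hQ
    have : Q.IsPrime := hQ1.1
    have : Q.LiesOver (maximalIdeal O) := hQ1.2
    rw [he, Ideal.ramificationIdxIn_eq_ramificationIdx (maximalIdeal O) Q G]
  obtain ⟨θ, hθ⟩ := (hpid.principal (∏ Q ∈ s, Q)).principal
  have hPs : P ∈ s := (hs P).mpr ⟨inferInstance, hPover⟩
  have hassoc : Associated (θ ^ e) (algebraMap O B ϖ) := by
    rw [← Ideal.span_singleton_eq_span_singleton, ← Ideal.span_singleton_pow]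
    have : Ideal.span {θ} = ∏ Q ∈ s, Q := hθ.symm
    rw [this, ← hmap, hmϖ, Ideal.map_span, Set.image_singleton]
  obtain ⟨u, hu⟩ := hassoc
  have hnle : ¬ (∏ Q ∈ s.erase P, Q) ≤ P := by
    intro hle
    obtain ⟨Q, hQ, hQP⟩ := (Ideal.IsPrime.prod_le ‹P.IsPrime›).mp hle
    obtain ⟨hne, hQs⟩ := Finset.mem_erase.mp hQ
    have hQ1 := (hs Q).mp hQs
    have : Q.IsPrime := hQ1.1
    have : Q.LiesOver (maximalIdeal O) := hQ1.2
    have : Q.IsMaximal := Ideal.IsMaximal.of_liesOver_isMaximal Q (maximalIdeal O)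
    exact hne (this.eq_of_le ‹P.IsPrime›.ne_top hQP)
  obtain ⟨t, ht, htP⟩ := Set.not_subset.mp hnle
  refine ⟨θ, e, u, t, u.isUnit, he0, hedvd, by rw [← hu, mul_comm], ?_, htP, fun x hx => ?_⟩
  · have h1 : θ ∈ ∏ Q ∈ s, Q := hθ ▸ Submodule.mem_span_singleton_self θ
    exact (Ideal.prod_le_inf.trans (Finset.inf_le hPs)) h1
  · rw [← Ideal.mem_span_singleton]
    change _ ∈ Submodule.span B {θ}
    rw [← hθ, ← Finset.prod_erase_mul s _ hPs]
    exact Ideal.mul_mem_mul ht hx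

/-- An automorphism of order prime to the residue characteristic that acts trivially on the
residue field and on the tangent space at a prime is trivial. -/
theorem smul_eq_of_forall_smul_sub_mem {P : Ideal B} [P.IsPrime] {σ : G} {θ v t : B}
    (hcard : IsUnit (Nat.card G : B))
    (h0 : ∀ b : B, σ • b - b ∈ P) (hθ : θ ∈ P) (hv : v - 1 ∈ P) (hσ : σ • θ = v * θ)
    (ht : t ∉ P) (htP : ∀ x ∈ P, θ ∣ t * x) (b : B) : σ • b = b := by
  let s : B →+* B := MulSemiringAction.toRingHom G B σ
  have hs : ∀ b, s b = σ • b := fun b => rfl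
  have hsP : ∀ k, ∀ x ∈ P ^ k, s x ∈ P ^ k := by
    intro k
    have h1 : P ≤ P.comap s := fun x hx => by
      have := add_mem (h0 x) hx
      rwa [sub_add_cancel] at this
    exact fun x hx => (Ideal.le_comap_pow s k) (Ideal.pow_right_mono h1 k hx)
  have step : ∀ k, ∀ x ∈ P ^ k, s x - x ∈ P ^ (k + 1) := by
    intro k x hx
    have h1 : θ ^ k ∣ t ^ k * x := by
      have hle : Ideal.span {t} * P ≤ Ideal.span {θ} := by
        rw [Ideal.span_singleton_mul_le_iff]
        intro z hz
        exact Ideal.mem_span_singleton.mpr (htP z hz)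
      have := Ideal.pow_right_mono hle k
      rw [mul_pow, Ideal.span_singleton_pow, Ideal.span_singleton_pow] at this
      exact Ideal.mem_span_singleton.mp (this (Ideal.mul_mem_mul (Ideal.mem_span_singleton_self _) hx))
    obtain ⟨y, hy⟩ := h1
    have h2 : s (t ^ k * x) - t ^ k * x ∈ P ^ (k + 1) := by
      have h3 : s (t ^ k * x) - t ^ k * x = θ ^ k * ((v ^ k - 1) * s y + (s y - y)) := by
        rw [hy, map_mul, map_pow, hs θ, hσ]
        ring
      rw [h3, pow_succ]
      refine Ideal.mul_mem_mul (Ideal.pow_mem_pow hθ k) (add_mem (Ideal.mul_mem_right _ _ ?_) (h0 y))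
      exact Ideal.mem_of_dvd _ (sub_one_dvd_pow_sub_one v k) hv
    have h4 : t ^ k * (s x - x) ∈ P ^ (k + 1) := by
      have h5 : t ^ k * (s x - x) = (s (t ^ k * x) - t ^ k * x) - (s (t ^ k) - t ^ k) * s x := by
        rw [map_mul]; ring
      rw [h5, pow_succ']
      rw [pow_succ'] at h2
      exact sub_mem h2 (Ideal.mul_mem_mul (h0 _) (hsP k x hx))
    exact (Ideal.IsPrime.mul_mem_pow P h4).resolve_left fun h => ht (‹P.IsPrime›.mem_of_pow_mem k h)
  have hall : ∀ k, s b - b ∈ P ^ k := by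
    intro k
    induction k with
    | zero => simp
    | succ k ih =>
      obtain ⟨d, hd⟩ : ∃ d, d = s b - b := ⟨_, rfl⟩
      rw [← hd] at ih ⊢
      have h1 : ∀ i : ℕ, (s ^ i) d - d ∈ P ^ (k + 1) := by
        intro i
        induction i with
        | zero => simp
        | succ i ih' =>
          have h2 : (s ^ (i + 1)) d - d = s ((s ^ i) d - d) + (s d - d) := by
            rw [pow_succ', RingHom.mul_def, RingHom.comp_apply, map_sub s ((s ^ i) d) d]; ring
          rw [h2]
          exact add_mem (hsP _ _ ih') (step k d ih)
      have h3 : ∀ n : ℕ, ∑ i ∈ Finset.range n, (s ^ i) d = (s ^ n) b - b := by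
        intro n
        have h4 := Finset.sum_range_sub (fun i => (s ^ i) b) n
        have h5 : (s ^ 0) b = b := by simp
        rw [h5] at h4
        rw [← h4]
        refine Finset.sum_congr rfl fun i _ => ?_
        rw [hd, map_sub, pow_succ, RingHom.mul_def, RingHom.comp_apply]
      have h4 : (s ^ Nat.card G) b = b := by
        have : ∀ n : ℕ, (s ^ n) b = σ ^ n • b := by
          intro n
          induction n with
          | zero => simp
          | succ n ih =>
            rw [pow_succ', RingHom.mul_def, RingHom.comp_apply, ih, hs, pow_succ', mul_smul]
        rw [this, pow_card_eq_one', one_smul]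
      have h5 : (Nat.card G : B) * d ∈ P ^ (k + 1) := by
        have h6 : (Nat.card G : B) * d = - ∑ i ∈ Finset.range (Nat.card G), ((s ^ i) d - d) := by
          rw [Finset.sum_sub_distrib, h3, h4]
          simp
        rw [h6]
        exact neg_mem (Submodule.sum_mem _ fun i _ => h1 i)
      exact (Ideal.unit_mul_mem_iff_mem _ hcard).mp h5
  have hbot := Ideal.iInf_pow_eq_bot_of_isDomain P ‹P.IsPrime›.ne_top
  have : s b - b ∈ (⨅ k : ℕ, P ^ k) := (Submodule.mem_iInf _).mpr hall
  rw [hbot, Ideal.mem_bot] at this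
  exact sub_eq_zero.mp this

/-- Abhyankar's lemma: after adjoining a root of the uniformizer whose order is the degree of a
tame Galois extension, the extension becomes unramified. -/
theorem exists_sum_mul_sub_eq_one_of_isGaloisGroup {M : Type} [CommRing M] (j : B →+* M)
    (ρ : G →* (M →+* M)) (hρ : ∀ g b, ρ g (j b) = j (g • b)) {ϖ : O} (hϖ : Irreducible ϖ)
    (hjϖ : IsUnit (j (algebraMap O B ϖ))) {z : M} (hz : ∀ g, ρ g z = z)
    (hzϖ : z ^ Nat.card G = j (algebraMap O B ϖ)) (hcard : IsUnit (Nat.card G : B))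
    {σ : G} (hσ : σ ≠ 1) :
    ∃ (κ : Type) (_ : Fintype κ) (a b : κ → M),
      (∀ k, a k ∈ intSub (j.comp (algebraMap O B))) ∧
      (∀ k, b k ∈ intSub (j.comp (algebraMap O B))) ∧ ∑ k, a k * (b k - ρ σ (b k)) = 1 := by
  classical
  have := IsGaloisGroup.commutes (G := G) (A := O) (B := B)
  have hfix : ∀ g (a : O), ρ g (j (algebraMap O B a)) = j (algebraMap O B a) := fun g a => by
    rw [hρ, smul_algebraMap]
  let C := intSub (j.comp (algebraMap O B))
  have hC : ∀ c ∈ C, ρ σ c ∈ C := fun c hc =>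
    isIntegralElem_map_of_comp (RingHom.id O) (ρ σ) (fun a => hfix σ a) hc
  have hjC : ∀ b, j b ∈ C := fun b =>
    isIntegralElem_map_of_comp (i := algebraMap O B) (RingHom.id O) j (fun a => rfl)
      (Algebra.IsIntegral.isIntegral b)
  let jC : B →+* C := j.codRestrict C hjC
  have hint : (jC.comp (algebraMap O B)).IsIntegral := by
    rintro ⟨c, hc⟩
    obtain ⟨q, hq, hq0⟩ := hc
    refine ⟨q, hq, Subtype.ext ?_⟩
    have := Polynomial.hom_eval₂ q (jC.comp (algebraMap O B)) C.subtype ⟨c, q, hq, hq0⟩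
    exact this.trans hq0
  let D : C → C := fun c => c - ⟨ρ σ c, hC c c.2⟩
  by_cases hI : Ideal.span (Set.range D) = ⊤
  · have h1 : (1 : C) ∈ Ideal.span (Set.range D) := by rw [hI]; exact Submodule.mem_top
    obtain ⟨f, hf⟩ := Finsupp.mem_ideal_span_range_iff_exists_finsupp.mp h1
    refine ⟨f.support, inferInstance, fun k => (f k : M), fun k => ((k : C) : M),
      fun k => (f k).2, fun k => (k : C).2, ?_⟩
    have h2 := congrArg C.subtype hf
    rw [Finsupp.sum, map_sum, map_one, ← Finset.sum_coe_sort] at h2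
    exact h2
  exfalso
  obtain ⟨Q, hQ, hIQ⟩ := Ideal.exists_le_maximal _ hI
  have hDQ : ∀ c, D c ∈ Q := fun c => hIQ (Ideal.subset_span ⟨c, rfl⟩)
  have hQO := Ideal.isMaximal_comap_of_isIntegral_of_isMaximal' _ hint Q
  have hP : algebraMap O B ϖ ∈ Q.comap jC := by
    have h1 : ϖ ∈ maximalIdeal O := hϖ.maximalIdeal_eq ▸ Ideal.mem_span_singleton_self ϖ
    rw [← IsLocalRing.eq_maximalIdeal hQO] at h1
    exact h1
  obtain ⟨θ, e, u, t, hu, he0, ⟨h, he⟩, hϖu, hθ, ht, htP⟩ :=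
    exists_eq_unit_mul_pow_of_isGaloisGroup G hϖ (Q.comap jC) hP
  have hθσ : θ ∣ σ • θ := by
    rw [← IsIntegrallyClosed.pow_dvd_pow_iff he0, ← (hu.map (MulSemiringAction.toRingHom G B σ)).dvd_mul_left]
    have h1 : MulSemiringAction.toRingHom G B σ u * (σ • θ) ^ e = u * θ ^ e := by
      rw [← hϖu, ← smul_algebraMap σ ϖ, hϖu, smul_mul', smul_pow']
      rfl
    rw [h1]
    exact Dvd.intro_left _ rfl
  obtain ⟨v, hv⟩ := hθσ
  have hjθ : IsUnit (j θ) := by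
    rw [hϖu, map_mul, map_pow] at hjϖ
    exact (isUnit_pow_iff he0).mp (isUnit_of_mul_isUnit_right hjϖ)
  obtain ⟨τ, hτ⟩ := hjθ.exists_right_inv
  have hξe : (z ^ h * τ) ^ e = j u := by
    rw [mul_pow, ← pow_mul, mul_comm h, ← he, hzϖ, hϖu, map_mul, map_pow, mul_assoc, ← mul_pow, hτ,
      one_pow, mul_one]
  have hξC : z ^ h * τ ∈ C := by
    let := (j.comp (algebraMap O B)).toAlgebra
    have h1 : IsIntegral O ((z ^ h * τ) ^ e) := hξe ▸ hjC u
    exact h1.of_pow (Nat.pos_of_ne_zero he0)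
  let ξ : C := ⟨z ^ h * τ, hξC⟩
  have hξQ : ξ ∉ Q := fun hmem => by
    have h1 : ξ ^ e = jC u := Subtype.ext hξe
    have h2 : jC u ∈ Q := h1 ▸ Ideal.pow_mem_of_mem Q hmem e (Nat.pos_of_ne_zero he0)
    exact hQ.ne_top (Ideal.eq_top_of_isUnit_mem _ h2 (hu.map jC))
  have hξv : ρ σ (z ^ h * τ) * j v = z ^ h * τ := by
    refine hjθ.mul_right_cancel ?_
    have h1 : ρ σ (j θ) * ρ σ τ = 1 := by rw [← map_mul, hτ, map_one]
    rw [hρ, hv, map_mul] at h1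
    rw [map_mul, map_pow, hz]
    linear_combination z ^ h * h1 - z ^ h * hτ
  have hvP : v - 1 ∈ Q.comap jC := by
    have h1 : (⟨ρ σ ξ, hC ξ ξ.2⟩ : C) * jC (v - 1) = D ξ := by
      refine Subtype.ext ?_
      change ρ σ (z ^ h * τ) * j (v - 1) = z ^ h * τ - ρ σ (z ^ h * τ)
      rw [map_sub, map_one]
      linear_combination hξv
    refine (hQ.isPrime.mem_or_mem (h1 ▸ hDQ ξ)).resolve_left fun h2 => hξQ ?_
    have h3 := add_mem (hDQ ξ) h2
    rwa [show D ξ + (⟨ρ σ ξ, hC ξ ξ.2⟩ : C) = ξ from sub_add_cancel _ _] at h3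
  have htriv : ∀ b : B, σ • b = b := by
    refine smul_eq_of_forall_smul_sub_mem hcard (fun b => ?_) hθ hvP (by rw [hv, mul_comm]) ht htP
    have h1 : jC (σ • b - b) = - D (jC b) := by
      refine Subtype.ext ?_
      change j (σ • b - b) = -(j b - ρ σ (j b))
      rw [hρ, map_sub]
      ring
    change jC _ ∈ Q
    rw [h1]
    exact neg_mem (hDQ _)
  have := IsGaloisGroup.faithful (G := G) (A := O) (B := B)
  exact hσ (FaithfulSMul.eq_of_smul_eq_smul (α := B) fun b => by rw [htriv, one_smul])

end Abhyankar

/-- The local ring of a noetherian domain at a prime element is a discrete valuation ring. -/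
theorem isDiscreteValuationRing_localization_prime {R : Type} [CommRing R] [IsDomain R]
    [IsNoetherianRing R] {ϖ : R} (hϖ : Prime ϖ) (P : Ideal R) [P.IsPrime]
    (hP : P = Ideal.span {ϖ}) :
    IsDiscreteValuationRing (Localization.AtPrime P) ∧
      Irreducible (algebraMap R (Localization.AtPrime P) ϖ) := by
  have hinj : Function.Injective (algebraMap R (Localization.AtPrime P)) :=
    IsLocalization.injective _ P.primeCompl_le_nonZeroDivisors
  have hmax : maximalIdeal (Localization.AtPrime P)
      = Ideal.span {algebraMap R (Localization.AtPrime P) ϖ} := by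
    rw [← Localization.AtPrime.map_eq_maximalIdeal, ← Set.image_singleton, ← Ideal.map_span, ← hP]
  have h0 : algebraMap R (Localization.AtPrime P) ϖ ≠ 0 := by
    rw [Ne, map_eq_zero_iff _ hinj]
    exact hϖ.ne_zero
  have hfield : ¬ IsField (Localization.AtPrime P) := by
    rw [isField_iff_maximalIdeal_eq, hmax, Ideal.span_singleton_eq_bot]
    exact h0
  have hdvr : IsDiscreteValuationRing (Localization.AtPrime P) :=
    have hp : (maximalIdeal (Localization.AtPrime P)).IsPrincipal := ⟨⟨_, hmax⟩⟩
    ((IsDiscreteValuationRing.TFAE _ hfield).out 0 4).mpr hp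
  exact ⟨hdvr, (IsDiscreteValuationRing.irreducible_iff_uniformizer _).mpr hmax⟩

/-- Abhyankar's lemma for a tame Galois extension of the fraction field of a discrete
valuation ring. -/
theorem exists_sum_mul_sub_eq_one_of_isFractionRing {O K L G M : Type} [CommRing O] [IsDomain O]
    [IsDiscreteValuationRing O] [Field K] [Algebra O K] [IsFractionRing O K] [Field L]
    [Algebra K L] [Algebra O L] [IsScalarTower O K L] [Group G] [Finite G]
    [MulSemiringAction G L] [IsGaloisGroup G K L] [CommRing M] (j : L →+* M)
    (ρ : G →* (M →+* M)) (hρ : ∀ g b, ρ g (j b) = j (g • b)) {ϖ : O} (hϖ : Irreducible ϖ)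
    {z : M} (hz : ∀ g, ρ g z = z)
    (hzϖ : z ^ Nat.card G = j (algebraMap O L ϖ)) (hcard : IsUnit (Nat.card G : O))
    {σ : G} (hσ : σ ≠ 1) :
    ∃ (κ : Type) (_ : Fintype κ) (a b : κ → M),
      (∀ k, a k ∈ intSub (j.comp (algebraMap O L))) ∧
      (∀ k, b k ∈ intSub (j.comp (algebraMap O L))) ∧ ∑ k, a k * (b k - ρ σ (b k)) = 1 := by
  have hcomm : SMulCommClass G O L := ⟨fun g a b => by
    rw [Algebra.smul_def, Algebra.smul_def, smul_mul', IsScalarTower.algebraMap_apply O K L,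
      smul_algebraMap]⟩
  have hgal : IsGalois K L := IsGaloisGroup.isGalois G K L
  have hfin : FiniteDimensional K L := IsGaloisGroup.finiteDimensional G K L
  have : Module.Finite O (integralClosure O L) := IsIntegralClosure.finite O K L _
  have : IsDedekindDomain (integralClosure O L) := integralClosure.isDedekindDomain O K L
  have : IsFractionRing (integralClosure O L) L :=
    integralClosure.isFractionRing_of_finite_extension K L
  have hinj : Function.Injective (algebraMap O L) := by
    rw [IsScalarTower.algebraMap_eq O K L]
    exact (algebraMap K L).injective.comp (IsFractionRing.injective O K)
  have : Module.IsTorsionFree O L := by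
    rwa [Module.isTorsionFree_iff_algebraMap_injective]
  have : IsGaloisGroup G O (integralClosure O L) :=
    IsGaloisGroup.of_isFractionRing G O (integralClosure O L) K L
  have hϖ0 : algebraMap O L ϖ ≠ 0 := by
    rw [Ne, map_eq_zero_iff _ hinj]
    exact hϖ.ne_zero
  have hcard' := hcard.map (algebraMap O (integralClosure O L))
  rw [map_natCast] at hcard'
  exact exists_sum_mul_sub_eq_one_of_isGaloisGroup (O := O) (B := integralClosure O L)
    (j.comp (algebraMap (integralClosure O L) L)) ρ (fun g b => hρ g b) hϖ
    ((isUnit_iff_ne_zero.mpr hϖ0).map j) hz hzϖ hcard' hσ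

lemma isSplitSum_sub {G E κ : Type} [Group G] [CommRing E] [Fintype κ] {ρ : G →* (E →+* E)}
    {C : Subring E} (hC : ∀ g, ∀ c ∈ C, ρ g c ∈ C) (σ : G) {a b : κ → E}
    (ha : ∀ k, a k ∈ C) (hb : ∀ k, b k ∈ C) :
    IsSplitSum ρ C (fun τ => ∑ k, a k * ρ τ (b k) - ∑ k, a k * ρ σ (b k)) := by
  refine ⟨Option κ, inferInstance, fun k => k.elim (-∑ k, a k * ρ σ (b k)) a,
    fun k => k.elim 1 b, ?_, ?_, fun τ => ?_⟩
  · rintro (_ | k)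
    · exact neg_mem (sum_mem fun k _ => mul_mem (ha k) (hC σ _ (hb k)))
    · exact ha k
  · rintro (_ | k)
    · exact one_mem C
    · exact hb k
  · rw [Fintype.sum_option]
    simp only [Option.elim, map_one]
    ring

/-- Deltas can be assembled from the elements separating `σ` from `1`. -/
theorem exists_isDelta_of_forall_exists_sum {R E G : Type} [CommRing R] [CommRing E] [Group G]
    [Finite G] {ρ : G →* (E →+* E)} {i : R →+* E} (hfix : ∀ g r, ρ g (i r) = i r) {ϖ : R}
    (hϖ : Prime ϖ)
    (h : ∀ σ : G, σ ≠ 1 → ∃ t : R, ¬ ϖ ∣ t ∧ ∃ (κ : Type) (_ : Fintype κ) (a b : κ → E),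
      (∀ k, a k ∈ intSub i) ∧ (∀ k, b k ∈ intSub i) ∧ ∑ k, a k * (b k - ρ σ (b k)) = i t) :
    ∃ t : R, IsDelta ρ (intSub i) (i t) ∧ ¬ ϖ ∣ t := by
  classical
  cases nonempty_fintype G
  have hC : ∀ g, ∀ c ∈ intSub i, ρ g c ∈ intSub i := fun g c hc =>
    isIntegralElem_map_of_comp (RingHom.id R) (ρ g) (hfix g) hc
  have h' : ∀ σ : G, ∃ (t : R) (φ : G → E), ¬ ϖ ∣ t ∧ IsSplitSum ρ (intSub i) φ ∧ φ 1 = i t ∧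
      (σ ≠ 1 → φ σ = 0) := by
    intro σ
    by_cases hσ : σ = 1
    · exact ⟨1, fun _ => 1, hϖ.not_dvd_one, isSplitSum_one, by simp, fun h => (h hσ).elim⟩
    · obtain ⟨t, ht, κ, _, a, b, ha, hb, hab⟩ := h σ hσ
      refine ⟨t, _, ht, isSplitSum_sub hC σ ha hb, ?_, fun _ => by simp⟩
      rw [← hab]
      simp [mul_sub]
  choose t φ ht hφ hφ1 hφσ using h'
  have hs := isSplitSum_prod Finset.univ φ fun σ _ => hφ σ
  refine ⟨∏ σ, t σ, ?_, ?_⟩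
  · have hd := hs.isDelta fun σ hσ => Finset.prod_eq_zero (Finset.mem_univ σ) (hφσ σ hσ)
    simp only [hφ1, ← map_prod] at hd
    exact hd
  · rw [hϖ.dvd_finsetProd_iff]
    rintro ⟨σ, _, hσ⟩
    exact ht σ hσ

/-- Integral elements of a localization lift after multiplication by a denominator. -/
theorem exists_intSub_of_isLocalization {R E M : Type} [CommRing R] [CommRing E] [CommRing M]
    [Algebra E M] (i : R →+* E) (T : Submonoid R) [IsLocalization (T.map (i : R →* E)) M] {m : M}
    (hm : m ∈ intSub ((algebraMap E M).comp i)) :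
    ∃ s ∈ T, ∃ α ∈ intSub i, algebraMap E M α = algebraMap E M (i s) * m := by
  obtain ⟨⟨e, ⟨_, s, hs, rfl⟩⟩, he⟩ := IsLocalization.surj (T.map (i : R →* E)) m
  have hint : algebraMap E M e ∈ intSub ((algebraMap E M).comp i) := by
    rw [← he]
    exact mul_mem hm (apply_mem_intSub ((algebraMap E M).comp i) s)
  obtain ⟨q, hq, hq0⟩ := hint
  rw [← Polynomial.hom_eval₂, IsLocalization.map_eq_zero_iff (T.map (i : R →* E)) M] at hq0
  obtain ⟨⟨_, s', hs', rfl⟩, hs'q⟩ := hq0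
  refine ⟨s' * s, mul_mem hs' hs, i s' * e, ?_, ?_⟩
  · let := i.toAlgebra
    have h1 : Polynomial.aeval e (Polynomial.C s' * q) = 0 := by
      rw [map_mul, Polynomial.aeval_C]
      exact hs'q
    have h2 := isIntegral_leadingCoeff_smul _ e h1
    rw [Polynomial.leadingCoeff_mul_monic hq, Polynomial.leadingCoeff_C, Algebra.smul_def] at h2
    exact h2
  · change m * algebraMap E M (i s) = algebraMap E M e at he
    rw [map_mul, ← he, map_mul i, map_mul]
    ring

theorem exists_intSub_of_isLocalization_fintype {R E M κ : Type} [CommRing R] [CommRing E]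
    [CommRing M] [Algebra E M] [Fintype κ] (i : R →+* E) (T : Submonoid R)
    [IsLocalization (T.map (i : R →* E)) M] {m : κ → M}
    (hm : ∀ k, m k ∈ intSub ((algebraMap E M).comp i)) :
    ∃ s ∈ T, ∃ α : κ → E, (∀ k, α k ∈ intSub i) ∧
      ∀ k, algebraMap E M (α k) = algebraMap E M (i s) * m k := by
  classical
  choose s hs α hα hαm using fun k => exists_intSub_of_isLocalization i T (hm k)
  refine ⟨∏ k, s k, prod_mem fun k _ => hs k,
    fun k => i (∏ l ∈ Finset.univ.erase k, s l) * α k,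
    fun k => mul_mem (apply_mem_intSub i _) (hα k), fun k => ?_⟩
  rw [map_mul, hαm, ← mul_assoc, ← map_mul, ← map_mul, Finset.prod_erase_mul _ _ (Finset.mem_univ k)]

/-- A tame Galois extension becomes étale along a prime element after adjoining a suitable root. -/
theorem exists_isDelta_of_isGaloisGroup {R W E K L G : Type} [CommRing R] [IsDomain R]
    [IsNoetherianRing R] [CommRing W] [IsDomain W] [Algebra R W] [CommRing E]
    [Field K] [Algebra R K] [IsFractionRing R K] [Field L] [Algebra K L] [Algebra R L]
    [IsScalarTower R K L] [Algebra W L] [IsFractionRing W L] [IsScalarTower R W L]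
    [Group G] [Finite G] [MulSemiringAction G W] [SMulCommClass G R W] [MulSemiringAction G L]
    [SMulDistribClass G W L] [IsGaloisGroup G K L]
    (hWR : ∀ w : W, w ≠ 0 → ∃ w' r, r ≠ 0 ∧ w * w' = algebraMap R W r)
    {i : R →+* E} {ρ : G →* (E →+* E)} (f : W →+* E) (hf : ∀ r, f (algebraMap R W r) = i r)
    (hρ : ∀ g w, ρ g (f w) = f (g • w)) {ϖ : R} (hϖ : Prime ϖ) (hiϖ : IsUnit (i ϖ))
    {z : E} (hz : ∀ g, ρ g z = z) (hzϖ : z ^ Nat.card G = i ϖ)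
    (hcard : IsUnit (Nat.card G : R)) :
    ∃ t : R, IsDelta ρ (intSub i) (i t) ∧ ¬ ϖ ∣ t := by
  classical
  have hfix : ∀ g r, ρ g (i r) = i r := fun g r => by rw [← hf, hρ, smul_algebraMap]
  refine exists_isDelta_of_forall_exists_sum hfix hϖ fun σ hσ => ?_
  have hPp : (Ideal.span {ϖ}).IsPrime := (Ideal.span_singleton_prime hϖ.ne_zero).mpr hϖ
  obtain ⟨P, hP⟩ : ∃ P : Ideal R, P = Ideal.span {ϖ} := ⟨_, rfl⟩
  rw [← hP] at hPp
  have hmemP : ∀ r, r ∈ P.primeCompl ↔ ¬ ϖ ∣ r := fun r => by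
    rw [Ideal.mem_primeCompl_iff, hP, Ideal.mem_span_singleton]
  let T : Submonoid E := P.primeCompl.map (i : R →* E)
  let M := Localization T
  have hT : ∀ g, T ≤ T.comap (ρ g) := by
    rintro g _ ⟨s, hs, rfl⟩
    exact ⟨s, hs, (hfix g s).symm⟩
  let ρM : G →* (M →+* M) :=
    { toFun := fun g => IsLocalization.map M (ρ g) (hT g)
      map_one' := IsLocalization.ringHom_ext T (by ext e; simp)
      map_mul' := fun g h => IsLocalization.ringHom_ext T (by ext e; simp) }
  have hρM : ∀ g e, ρM g (algebraMap E M e) = algebraMap E M (ρ g e) := fun g e =>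
    IsLocalization.map_eq (hT g) e
  have hunitR : ∀ r : R, r ≠ 0 → IsUnit (algebraMap E M (i r)) := by
    intro r hr
    obtain ⟨n, s, hs, rfl⟩ := WfDvdMonoid.max_power_factor hr hϖ.irreducible
    rw [map_mul, map_mul, map_pow, map_pow]
    exact ((hiϖ.map _).pow n).mul
      (IsLocalization.map_units M (⟨i s, s, (hmemP s).mpr hs, rfl⟩ : T))
  have hunitW : ∀ w : nonZeroDivisors W, IsUnit ((algebraMap E M).comp f w) := by
    intro w
    obtain ⟨w', r, hr, hw⟩ := hWR w (nonZeroDivisors.ne_zero w.2)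
    have := hunitR r hr
    rw [← hf, ← hw, map_mul, map_mul] at this
    exact isUnit_of_mul_isUnit_left this
  let j : L →+* M := IsLocalization.lift (M := nonZeroDivisors W) hunitW
  have hj : ∀ w, j (algebraMap W L w) = algebraMap E M (f w) := fun w =>
    IsLocalization.lift_eq hunitW w
  have hjR : ∀ r, j (algebraMap R L r) = algebraMap E M (i r) := fun r => by
    rw [IsScalarTower.algebraMap_apply R W L, hj, hf]
  have hjρ : ∀ g b, ρM g (j b) = j (g • b) := by
    intro g b
    have : (ρM g).comp j = j.comp (MulSemiringAction.toRingHom G L g) := by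
      refine IsLocalization.ringHom_ext (nonZeroDivisors W) ?_
      ext w
      simp only [RingHom.comp_apply, MulSemiringAction.toRingHom_apply]
      rw [hj, hρM, hρ, ← algebraMap.coe_smul' (B := W) (C := L), hj]
    exact RingHom.congr_fun this b
  have hunitO : ∀ s : P.primeCompl, IsUnit (algebraMap R K s) := fun s => by
    rw [isUnit_iff_ne_zero, Ne, map_eq_zero_iff _ (IsFractionRing.injective R K)]
    intro h0
    exact (hmemP s).mp s.2 (h0 ▸ dvd_zero _)
  let O := Localization.AtPrime P
  obtain ⟨hdvr, hirr⟩ := isDiscreteValuationRing_localization_prime hϖ P hP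
  let algOK : Algebra O K := (IsLocalization.lift (M := P.primeCompl) hunitO).toAlgebra
  have towROK : IsScalarTower R O K := IsScalarTower.of_algebraMap_eq fun r =>
    (IsLocalization.lift_eq hunitO r).symm
  let algOL : Algebra O L := ((algebraMap K L).comp (algebraMap O K)).toAlgebra
  have towOKL : IsScalarTower O K L := IsScalarTower.of_algebraMap_eq fun r => rfl
  have towROL : ∀ r, algebraMap O L (algebraMap R O r) = algebraMap R L r := fun r => by
    rw [IsScalarTower.algebraMap_apply O K L, ← IsScalarTower.algebraMap_apply R O K,
      ← IsScalarTower.algebraMap_apply R K L]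
  have hfrac : IsFractionRing O K :=
    IsFractionRing.isFractionRing_of_isDomain_of_isLocalization P.primeCompl O K
  have hcardO : IsUnit (Nat.card G : O) := by
    simpa using hcard.map (algebraMap R O)
  obtain ⟨κ, _, a, b, ha, hb, hab⟩ := exists_sum_mul_sub_eq_one_of_isFractionRing (O := O) (K := K)
    j ρM hjρ hirr (z := algebraMap E M z) (fun g => by rw [hρM, hz])
    (by rw [← map_pow, hzϖ, towROL, hjR]) hcardO hσ
  have hOR : ∀ m ∈ intSub (j.comp (algebraMap O L)), ∃ s : R, s ∈ P.primeCompl ∧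
      algebraMap E M (i s) * m ∈ intSub ((algebraMap E M).comp i) := by
    intro m hm
    let := (j.comp (algebraMap O L)).toAlgebra
    let := ((algebraMap E M).comp i).toAlgebra
    have : IsScalarTower R O M := IsScalarTower.of_algebraMap_eq fun r => by
      change algebraMap E M (i r) = j (algebraMap O L (algebraMap R O r))
      rw [towROL, hjR]
    obtain ⟨s, hs⟩ := IsIntegral.exists_multiple_integral_of_isLocalization
      (R := R) (Rₘ := O) P.primeCompl m hm
    refine ⟨s, s.2, ?_⟩
    rw [Submonoid.smul_def, Algebra.smul_def] at hs
    exact hs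
  have hall : ∀ c : κ → M, (∀ k, c k ∈ intSub (j.comp (algebraMap O L))) →
      ∃ s ∈ P.primeCompl, ∃ α : κ → E, (∀ k, α k ∈ intSub i) ∧
        ∀ k, algebraMap E M (α k) = algebraMap E M (i s) * c k := by
    intro c hc
    choose s hs hsc using fun k => hOR (c k) (hc k)
    obtain ⟨s', hs', α, hα, hαc⟩ := exists_intSub_of_isLocalization_fintype i P.primeCompl hsc
    refine ⟨s' * ∏ k, s k, mul_mem hs' (prod_mem fun k _ => hs k),
      fun k => i (∏ l ∈ Finset.univ.erase k, s l) * α k,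
      fun k => mul_mem (apply_mem_intSub i _) (hα k), fun k => ?_⟩
    rw [← Finset.prod_erase_mul _ _ (Finset.mem_univ k), map_mul, hαc]
    simp only [map_mul]
    ring
  obtain ⟨s, hs, α, hα, hαa⟩ := hall a ha
  obtain ⟨s', hs', β, hβ, hβb⟩ := hall b hb
  have hker : algebraMap E M (∑ k, α k * (β k - ρ σ (β k))) = algebraMap E M (i (s * s')) := by
    have hβσ : ∀ k, algebraMap E M (ρ σ (β k)) = algebraMap E M (i s') * ρM σ (b k) := fun k => by
      rw [← hρM, hβb, map_mul, hρM, hfix]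
    simp only [map_sum, map_mul, map_sub, hαa, hβb, hβσ]
    rw [← mul_one (_ * _), ← hab, Finset.mul_sum]
    exact Finset.sum_congr rfl fun k _ => by ring
  obtain ⟨⟨_, s'', hs'', rfl⟩, hc⟩ := (IsLocalization.eq_iff_exists T M).mp hker
  refine ⟨s'' * (s * s'), (hmemP _).mp (mul_mem hs'' (mul_mem hs hs')), κ, inferInstance,
    fun k => i s'' * α k, β, fun k => mul_mem (apply_mem_intSub i _) (hα k), hβ, ?_⟩
  rw [map_mul i]
  refine Eq.trans ?_ hc
  change _ = i s'' * _
  rw [Finset.mul_sum]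
  exact Finset.sum_congr rfl fun k _ => by ring

/-- Krull dimension does not drop in injective integral extensions. -/
theorem ringKrullDim_le_of_isIntegral_of_injective {R A : Type} [CommRing R] [CommRing A]
    [Algebra R A] [Algebra.IsIntegral R A] (h : Function.Injective (algebraMap R A)) :
    ringKrullDim R ≤ ringKrullDim A := by
  refine iSup_le fun l => ?_
  obtain ⟨Q, _, hQ, hQ'⟩ := Ideal.exists_ideal_over_prime_of_isIntegral (S := A) l.head.asIdeal ⊥ (by
    rw [← RingHom.ker_eq_comap_bot, (RingHom.injective_iff_ker_eq_bot _).mp h]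
    exact bot_le)
  have : Q.LiesOver (RelSeries.head l).asIdeal := ⟨hQ'.symm⟩
  obtain ⟨L, hL, -⟩ := Ideal.exists_ltSeries_of_hasGoingUp (S := A) l Q
  rw [← hL]
  exact le_iSup (fun l : LTSeries (PrimeSpectrum A) => (l.length : WithBot ℕ∞)) L

namespace KummerRing

variable {R : Type} [CommRing R] {m : ℕ} {y : Fin m → R} {N : ℕ}

variable (y N) in
/-- The chosen `N`-th root of `y j`. -/
noncomputable def root (j : Fin m) : KummerRing R m y N :=
  Ideal.Quotient.mk _ (MvPolynomial.X j)

lemma root_pow (j : Fin m) : root y N j ^ N = algebraMap R (KummerRing R m y N) (y j) := by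
  have h : Ideal.Quotient.mk (Ideal.span (Set.range fun j : Fin m =>
      MvPolynomial.X j ^ N - MvPolynomial.C (y j))) (MvPolynomial.X j ^ N - MvPolynomial.C (y j)) = 0 :=
    Ideal.Quotient.eq_zero_iff_mem.mpr (Ideal.subset_span ⟨j, rfl⟩)
  rw [map_sub, map_pow, sub_eq_zero] at h
  exact h

lemma exists_lift {B : Type} [CommRing B] (f : R →+* B) (w : Fin m → B)
    (hw : ∀ j, w j ^ N = f (y j)) :
    ∃ F : KummerRing R m y N →+* B, (∀ r, F (algebraMap R _ r) = f r) ∧ ∀ j, F (root y N j) = w j := by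
  refine ⟨Ideal.Quotient.lift _ (MvPolynomial.eval₂Hom f w) ?_, fun r => ?_, fun j => ?_⟩
  · have h : Ideal.span (Set.range fun j : Fin m => MvPolynomial.X j ^ N - MvPolynomial.C (y j))
        ≤ RingHom.ker (MvPolynomial.eval₂Hom f w) := by
      rw [Ideal.span_le]
      rintro _ ⟨j, rfl⟩
      simp [RingHom.mem_ker, hw]
    exact fun a ha => h ha
  · exact (Ideal.Quotient.lift_mk _ _ _).trans (MvPolynomial.eval₂Hom_C f w r)
  · exact (Ideal.Quotient.lift_mk _ _ _).trans (MvPolynomial.eval₂Hom_X' f w j)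

lemma exists_lift_field {Ω : Type} [Field Ω] [IsAlgClosed Ω] (hN : 0 < N) (f : R →+* Ω) :
    ∃ F : KummerRing R m y N →+* Ω, (∀ r, F (algebraMap R _ r) = f r) ∧
      ∀ j, F (root y N j) ^ N = f (y j) := by
  choose w hw using fun j => IsAlgClosed.exists_pow_nat_eq (f (y j)) hN
  obtain ⟨F, hF, hFw⟩ := exists_lift f w hw
  exact ⟨F, hF, fun j => by rw [hFw, hw]⟩

lemma adjoin_root : Algebra.adjoin R (Set.range (root y N)) = ⊤ := by
  rw [eq_top_iff]
  rintro a -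
  obtain ⟨p, rfl⟩ := Ideal.Quotient.mk_surjective a
  induction p using MvPolynomial.induction_on with
  | C r => exact Subalgebra.algebraMap_mem _ r
  | add p q hp hq => rw [map_add]; exact add_mem hp hq
  | mul_X p j hp => rw [map_mul]; exact mul_mem hp (Algebra.subset_adjoin ⟨j, rfl⟩)

lemma finite (hN : 0 < N) : Module.Finite R (KummerRing R m y N) := by
  have h : ∀ a ∈ Set.range (root y N), IsIntegral R a := by
    rintro _ ⟨j, rfl⟩
    refine IsIntegral.of_pow hN ?_
    rw [root_pow]
    exact isIntegral_algebraMap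
  have hfg := fg_adjoin_of_finite (Set.finite_range (root y N)) h
  rw [adjoin_root] at hfg
  exact ⟨hfg⟩

lemma injective_algebraMap [IsDomain R] (hN : 0 < N) :
    Function.Injective (algebraMap R (KummerRing R m y N)) := by
  obtain ⟨F, hF, -⟩ := exists_lift_field (y := y) hN
    ((algebraMap (FractionRing R) (AlgebraicClosure (FractionRing R))).comp
      (algebraMap R (FractionRing R)))
  have h : F.comp (algebraMap R (KummerRing R m y N)) = _ := RingHom.ext hF
  have hinj : Function.Injective (F.comp (algebraMap R (KummerRing R m y N))) := by
    rw [h]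
    exact (algebraMap (FractionRing R) (AlgebraicClosure (FractionRing R))).injective.comp
      (IsFractionRing.injective R (FractionRing R))
  exact Function.Injective.of_comp hinj

lemma dvd_of_root_dvd (hN : 0 < N) {j : Fin m} (hy : Prime (y j)) {r : R}
    (h : root y N j ∣ algebraMap R (KummerRing R m y N) r) : y j ∣ r := by
  have hp : (Ideal.span {y j}).IsPrime := (Ideal.span_singleton_prime hy.ne_zero).mpr hy
  let D := R ⧸ Ideal.span {y j}
  obtain ⟨F, hF, hFj⟩ := exists_lift_field (y := y) hN
    (((algebraMap (FractionRing D) (AlgebraicClosure (FractionRing D))).comp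
      (algebraMap D (FractionRing D))).comp (Ideal.Quotient.mk (Ideal.span {y j})))
  have h0 : F (root y N j) = 0 := by
    rw [← pow_eq_zero_iff hN.ne', hFj]
    have : Ideal.Quotient.mk (Ideal.span {y j}) (y j) = 0 :=
      Ideal.Quotient.eq_zero_iff_mem.mpr (Ideal.mem_span_singleton_self _)
    rw [RingHom.comp_apply, this, map_zero]
  have h1 : F (algebraMap R _ r) = 0 := by
    obtain ⟨c, hc⟩ := h
    rw [hc, map_mul, h0, zero_mul]
  have hinj : Function.Injective ((algebraMap (FractionRing D) (AlgebraicClosure (FractionRing D))).comp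
      (algebraMap D (FractionRing D))) :=
    (algebraMap (FractionRing D) (AlgebraicClosure (FractionRing D))).injective.comp
      (IsFractionRing.injective D (FractionRing D))
  rw [hF, RingHom.comp_apply, map_eq_zero_iff _ hinj, Ideal.Quotient.eq_zero_iff_mem,
    Ideal.mem_span_singleton] at h1
  exact h1

lemma exists_sub_mem_span (a : KummerRing R m y N) :
    ∃ r : R, a - algebraMap R _ r ∈ Ideal.span (Set.range (root y N)) := by
  obtain ⟨p, rfl⟩ := Ideal.Quotient.mk_surjective a
  induction p using MvPolynomial.induction_on with
  | C r =>
    refine ⟨r, ?_⟩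
    rw [show Ideal.Quotient.mk _ (MvPolynomial.C r) = algebraMap R (KummerRing R m y N) r from rfl,
      sub_self]
    exact zero_mem _
  | add p q hp hq =>
    obtain ⟨r, hr⟩ := hp
    obtain ⟨s, hs⟩ := hq
    refine ⟨r + s, ?_⟩
    rw [map_add, map_add, add_sub_add_comm]
    exact add_mem hr hs
  | mul_X p j hp =>
    refine ⟨0, ?_⟩
    rw [map_zero, sub_zero, map_mul]
    exact Ideal.mul_mem_left _ _ (Ideal.subset_span ⟨j, rfl⟩)

section Local

variable [IsLocalRing R] {n : ℕ} {x : Fin n → R}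

lemma eq_span_of_isMaximal (hN : 0 < N)
    (hspan : Ideal.span (Set.range x ∪ Set.range y) = maximalIdeal R)
    (Q : Ideal (KummerRing R m y N)) (hQ : Q.IsMaximal) :
    Q = Ideal.span (Set.range (fun k => algebraMap R (KummerRing R m y N) (x k)) ∪
      Set.range (root y N)) := by
  have := finite (y := y) hN
  have hcomap : Q.comap (algebraMap R _) = maximalIdeal R :=
    IsLocalRing.eq_maximalIdeal (Ideal.isMaximal_comap_of_isIntegral_of_isMaximal Q)
  have hmem : ∀ r ∈ maximalIdeal R, algebraMap R (KummerRing R m y N) r ∈ Q := fun r hr => by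
    rw [← hcomap] at hr
    exact hr
  set J := Ideal.span (Set.range (fun k => algebraMap R (KummerRing R m y N) (x k)) ∪
      Set.range (root y N)) with hJ
  have hroot : ∀ j, root y N j ∈ J := fun j => Ideal.subset_span (Or.inr ⟨j, rfl⟩)
  refine le_antisymm (fun a ha => ?_) ?_
  · have hmJ : (maximalIdeal R).map (algebraMap R (KummerRing R m y N)) ≤ J := by
      rw [← hspan, Ideal.map_span, Ideal.span_le]
      rintro _ ⟨_, ⟨k, rfl⟩ | ⟨j, rfl⟩, rfl⟩
      · exact Ideal.subset_span (Or.inl ⟨k, rfl⟩)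
      · rw [← root_pow]
        exact Ideal.pow_mem_of_mem _ (hroot j) N hN
    obtain ⟨r, hr⟩ := exists_sub_mem_span a
    have hle : Ideal.span (Set.range (root y N)) ≤ Q := by
      rw [Ideal.span_le]
      rintro _ ⟨j, rfl⟩
      refine hQ.isPrime.mem_of_pow_mem N ?_
      rw [root_pow]
      exact hmem _ (hspan ▸ Ideal.subset_span (Or.inr ⟨j, rfl⟩))
    have hrQ : r ∈ Q.comap (algebraMap R (KummerRing R m y N)) := by
      have := sub_mem ha (hle hr)
      rwa [sub_sub_cancel] at this
    rw [hcomap] at hrQ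
    have h1 : Ideal.span (Set.range (root y N)) ≤ J := Ideal.span_mono Set.subset_union_right
    have := add_mem (h1 hr) (hmJ (Ideal.mem_map_of_mem _ hrQ))
    rwa [sub_add_cancel] at this
  · rw [hJ, Ideal.span_le]
    rintro _ (⟨k, rfl⟩ | ⟨j, rfl⟩)
    · exact hmem _ (hspan ▸ Ideal.subset_span (Or.inl ⟨k, rfl⟩))
    · refine hQ.isPrime.mem_of_pow_mem N ?_
      rw [root_pow]
      exact hmem _ (hspan ▸ Ideal.subset_span (Or.inr ⟨j, rfl⟩))

lemma isLocalRing [IsDomain R] (hN : 0 < N)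
    (hspan : Ideal.span (Set.range x ∪ Set.range y) = maximalIdeal R) :
    IsLocalRing (KummerRing R m y N) := by
  have : Nontrivial (KummerRing R m y N) := (injective_algebraMap (y := y) hN).nontrivial
  obtain ⟨Q, hQ⟩ := Ideal.exists_maximal (KummerRing R m y N)
  exact IsLocalRing.of_unique_max_ideal ⟨Q, hQ, fun Q' hQ' => by
    rw [eq_span_of_isMaximal hN hspan Q hQ, eq_span_of_isMaximal hN hspan Q' hQ']⟩

lemma maximalIdeal_eq [IsLocalRing (KummerRing R m y N)] (hN : 0 < N)
    (hspan : Ideal.span (Set.range x ∪ Set.range y) = maximalIdeal R) :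
    maximalIdeal (KummerRing R m y N) =
      Ideal.span (Set.range (fun k => algebraMap R (KummerRing R m y N) (x k)) ∪
        Set.range (root y N)) :=
  eq_span_of_isMaximal hN hspan _ (maximalIdeal.isMaximal _)

lemma algebraMap_mem_maximalIdeal [IsLocalRing (KummerRing R m y N)] (hN : 0 < N) {r : R}
    (hr : r ∈ maximalIdeal R) :
    algebraMap R (KummerRing R m y N) r ∈ maximalIdeal (KummerRing R m y N) := by
  have := finite (y := y) hN
  have h := IsLocalRing.eq_maximalIdeal (Ideal.isMaximal_comap_of_isIntegral_of_isMaximal (R := R)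
    (maximalIdeal (KummerRing R m y N)))
  rw [← h] at hr
  exact hr

lemma isAlgClosed_residueField [IsLocalRing (KummerRing R m y N)] [IsAlgClosed (ResidueField R)]
    (hN : 0 < N) (hspan : Ideal.span (Set.range x ∪ Set.range y) = maximalIdeal R) :
    IsAlgClosed (ResidueField (KummerRing R m y N)) := by
  refine isAlgClosed_residueField_of_surjective (algebraMap R (KummerRing R m y N)) (fun b => ?_)
    fun r hr => algebraMap_mem_maximalIdeal hN hr
  obtain ⟨a, rfl⟩ := residue_surjective b
  obtain ⟨r, hr⟩ := exists_sub_mem_span a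
  refine ⟨r, ?_⟩
  rw [RingHom.comp_apply, eq_comm, ← sub_eq_zero, ← map_sub, residue_eq_zero_iff,
    maximalIdeal_eq hN hspan]
  exact Ideal.span_mono Set.subset_union_right hr

lemma isPrecomplete [IsNoetherianRing R] [IsLocalRing (KummerRing R m y N)]
    [IsPrecomplete (maximalIdeal R) R] (hN : 0 < N)
    (hspan : Ideal.span (Set.range x ∪ Set.range y) = maximalIdeal R) :
    IsPrecomplete (maximalIdeal (KummerRing R m y N)) (KummerRing R m y N) := by
  have := finite (y := y) hN
  have hrad : maximalIdeal (KummerRing R m y N) ≤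
      ((maximalIdeal R).map (algebraMap R (KummerRing R m y N))).radical := by
    rw [maximalIdeal_eq hN hspan, Ideal.span_le]
    rintro _ (⟨k, rfl⟩ | ⟨j, rfl⟩)
    · exact Ideal.le_radical (Ideal.mem_map_of_mem _ (hspan ▸ Ideal.subset_span (Or.inl ⟨k, rfl⟩)))
    · refine ⟨N, ?_⟩
      rw [root_pow]
      exact Ideal.mem_map_of_mem _ (hspan ▸ Ideal.subset_span (Or.inr ⟨j, rfl⟩))
  obtain ⟨c, hc⟩ := Ideal.exists_pow_le_of_le_radical_of_fg hrad (IsNoetherian.noetherian _)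
  refine IsPrecomplete.of_finite (I := maximalIdeal R) (Ideal.map_le_iff_le_comap.mpr fun r hr =>
    algebraMap_mem_maximalIdeal hN hr) (Nat.succ_pos c) ((Ideal.pow_le_pow_right c.le_succ).trans hc)

lemma exists_isRegularParams [IsDomain R] [IsLocalRing (KummerRing R m y N)] (hN : 0 < N)
    (hspan : Ideal.span (Set.range x ∪ Set.range y) = maximalIdeal R)
    (hdim : ringKrullDim R = (n + m : ℕ)) :
    ∃ Z, IsRegularParams (KummerRing R m y N) Z ∧ ∀ j, root y N j ∈ Z := by
  classical
  have := finite (y := y) hN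
  refine ⟨Finset.univ.image (fun k => algebraMap R (KummerRing R m y N) (x k)) ∪
    Finset.univ.image (root y N), ⟨?_, ?_⟩, fun j => by simp⟩
  · rw [maximalIdeal_eq hN hspan]
    simp
  · refine le_trans ?_ (ringKrullDim_le_of_isIntegral_of_injective (injective_algebraMap (y := y) hN))
    rw [hdim]
    have h1 := Finset.card_union_le (Finset.univ.image (fun k => algebraMap R (KummerRing R m y N) (x k)))
      (Finset.univ.image (root y N))
    have h2 := Finset.card_image_le (s := Finset.univ) (f := fun k => algebraMap R (KummerRing R m y N) (x k))
    have h3 := Finset.card_image_le (s := Finset.univ) (f := root y N)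
    simp only [Finset.card_univ, Fintype.card_fin] at h2 h3
    exact_mod_cast h1.trans (add_le_add h2 h3)

end Local

end KummerRing

theorem exists_isRegularParams_of_span_eq {R : Type} [CommRing R] [IsLocalRing R] {n m : ℕ}
    {x : Fin n → R} {y : Fin m → R}
    (hspan : Ideal.span (Set.range x ∪ Set.range y) = maximalIdeal R)
    (hdim : ringKrullDim R = (n + m : ℕ)) :
    ∃ Z, IsRegularParams R Z ∧ ∀ j, y j ∈ Z := by
  classical
  refine ⟨Finset.univ.image x ∪ Finset.univ.image y, ⟨by simpa using hspan, ?_⟩, fun j => by simp⟩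
  rw [hdim]
  have h1 := Finset.card_union_le (Finset.univ.image x) (Finset.univ.image y)
  have h2 := Finset.card_image_le (s := Finset.univ) (f := x)
  have h3 := Finset.card_image_le (s := Finset.univ) (f := y)
  simp only [Finset.card_univ, Fintype.card_fin] at h2 h3
  exact_mod_cast h1.trans (add_le_add h2 h3)

/-- The action of `G` on `W` by ring endomorphisms. -/
def actionHom (G W : Type) [Group G] [CommRing W] [MulSemiringAction G W] : G →* (W →+* W) where
  toFun g := MulSemiringAction.toRingHom G W g
  map_one' := by ext; simp
  map_mul' g g' := by ext; simp [mul_smul]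

lemma actionHom_apply {G W : Type} [Group G] [CommRing W] [MulSemiringAction G W] (g : G) (w : W) :
    actionHom G W g w = g • w := rfl

section Unramified

variable {R S W G : Type} [CommRing R] [CommRing S] [CommRing W] [Group G] [Algebra R S]
  [Algebra S W] [Algebra R W] [IsScalarTower R S W] [MulSemiringAction G W]

/-- A faithful action on an unramified domain has a split delta function. -/
lemma isDelta_one_of_unramified [IsDomain W] [Algebra.FormallyUnramified S W]
    [Algebra.EssFiniteType S W] [SMulCommClass G S W] [FaithfulSMul G W] :
    IsDelta (actionHom G W) ⊤ 1 := by
  obtain ⟨s, hs⟩ := TensorProduct.exists_finset (Algebra.FormallyUnramified.elem S W)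
  have hsum : ∀ f : W × W → W, ∑ k : s, f k = ∑ k ∈ s, f k := fun f => Finset.sum_coe_sort s f
  refine ⟨s, inferInstance, fun k => k.1.1, fun k => k.1.2, fun _ => trivial, fun _ => trivial, ?_,
    fun σ hσ => ?_⟩
  · have h := Algebra.FormallyUnramified.lmul_elem (R := S) (S := W)
    rw [hs, map_sum] at h
    rw [hsum fun k => k.1 * k.2]
    simpa using h
  · rw [hsum fun k => k.1 * actionHom G W σ k.2]
    obtain ⟨b, hb⟩ : ∃ b : W, σ • b ≠ b := by
      by_contra! h
      exact hσ (FaithfulSMul.eq_of_smul_eq_smul (α := W) fun b => by rw [h, one_smul])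
    let F : TensorProduct S W W →ₐ[S] W := Algebra.TensorProduct.lift (AlgHom.id S W)
      (MulSemiringAction.toAlgHom S W σ) fun _ _ => Commute.all _ _
    have h := congrArg F (Algebra.FormallyUnramified.one_tmul_mul_elem (R := S) b)
    rw [map_mul, map_mul, ← sub_eq_zero, ← sub_mul] at h
    have h' := (mul_eq_zero.mp h).resolve_left (by simpa [F, sub_eq_zero] using hb)
    rw [hs, map_sum] at h'
    simpa [F, actionHom_apply] using h'

lemma exists_pow_mul_mem_intSub (d : R) [IsLocalization.Away d S] [Algebra.IsIntegral S W] (w : W) :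
    ∃ k, algebraMap R W d ^ k * w ∈ intSub (algebraMap R W) := by
  obtain ⟨⟨_, k, rfl⟩, hs⟩ := IsIntegral.exists_multiple_integral_of_isLocalization
    (Submonoid.powers d) (Rₘ := S) w (Algebra.IsIntegral.isIntegral w)
  refine ⟨k, ?_⟩
  rw [Submonoid.smul_def, Algebra.smul_def, map_pow] at hs
  exact hs

lemma exists_pow_forall_mul_mem_intSub {κ : Type} [Fintype κ] (d : R) [IsLocalization.Away d S]
    [Algebra.IsIntegral S W] (w : κ → W) :
    ∃ k, ∀ j, algebraMap R W d ^ k * w j ∈ intSub (algebraMap R W) := by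
  choose k hk using fun j => exists_pow_mul_mem_intSub (S := S) d (w j)
  refine ⟨∑ j, k j, fun j => ?_⟩
  classical
  rw [← Finset.sum_erase_add _ _ (Finset.mem_univ j), pow_add, mul_assoc]
  exact mul_mem (pow_mem (apply_mem_intSub _ d) _) (hk j)

lemma exists_isDelta_pow [SMulCommClass G R W] (d : R) [IsLocalization.Away d S]
    [Algebra.IsIntegral S W] (h : IsDelta (actionHom G W) ⊤ 1) :
    ∃ k, IsDelta (actionHom G W) (intSub (algebraMap R W)) (algebraMap R W d ^ k) := by
  obtain ⟨κ, _, a, b, -, -, h1, h2⟩ := h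
  obtain ⟨k, hk⟩ := exists_pow_forall_mul_mem_intSub (S := S) d a
  obtain ⟨l, hl⟩ := exists_pow_forall_mul_mem_intSub (S := S) d b
  have hfix : ∀ σ : G, actionHom G W σ (algebraMap R W d ^ l) = algebraMap R W d ^ l := fun σ => by
    rw [map_pow, actionHom_apply, smul_algebraMap]
  refine ⟨k + l, κ, inferInstance, _, _, hk, hl, ?_, fun σ hσ => ?_⟩
  · rw [pow_add, ← mul_one (_ * _), ← h1, Finset.mul_sum]
    exact Finset.sum_congr rfl fun j _ => by ring
  · have : ∀ j, algebraMap R W d ^ k * a j * actionHom G W σ (algebraMap R W d ^ l * b j) =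
        algebraMap R W d ^ (k + l) * (a j * actionHom G W σ (b j)) := fun j => by
      rw [map_mul, hfix, pow_add]
      ring
    simp only [this]
    rw [← Finset.mul_sum, h2 σ hσ, mul_zero]

lemma exists_pow_mul_eq_of_invariant [Algebra.IsInvariant S W G] (d : R) [IsLocalization.Away d S]
    (w : W) (hw : ∀ g : G, g • w = w) :
    ∃ k r, algebraMap R W d ^ k * w = algebraMap R W r := by
  obtain ⟨s, rfl⟩ := Algebra.IsInvariant.isInvariant (A := S) w hw
  obtain ⟨⟨r, _, k, rfl⟩, hs⟩ := IsLocalization.surj (Submonoid.powers d) s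
  refine ⟨k, r, ?_⟩
  rw [IsScalarTower.algebraMap_apply R S W, IsScalarTower.algebraMap_apply R S W, ← hs, map_mul,
    mul_comm]
  simp

lemma exists_mul_eq_algebraMap [IsDomain W] [Finite G] {d : R}
    (hinv : ∀ w : W, (∀ g : G, g • w = w) → ∃ k r, algebraMap R W d ^ k * w = algebraMap R W r)
    (hd : IsUnit (algebraMap R W d)) (w : W) (hw : w ≠ 0) :
    ∃ w' r, r ≠ 0 ∧ w * w' = algebraMap R W r := by
  classical
  have := Fintype.ofFinite G
  obtain ⟨k, r, hr⟩ := hinv (∏ g : G, g • w) fun σ => by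
    rw [Finset.smul_prod']
    exact Fintype.prod_equiv (Equiv.mulLeft σ) _ _ fun g => by simp [mul_smul]
  rw [← Finset.mul_prod_erase _ _ (Finset.mem_univ 1), one_smul] at hr
  refine ⟨algebraMap R W d ^ k * ∏ g ∈ Finset.univ.erase (1 : G), g • w, r, ?_, by rw [← hr]; ring⟩
  rintro rfl
  rw [map_zero] at hr
  have h := (hd.pow k).mul_right_eq_zero.mp hr
  refine (mul_ne_zero hw (Finset.prod_ne_zero_iff.mpr fun g _ => ?_)) h
  exact (smul_ne_zero_iff_ne g).mpr hw

end Unramified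

section TensorAction

open scoped TensorProduct

variable {R A W G : Type} [CommRing R] [CommRing A] [CommRing W] [Group G] [Algebra R A]
  [Algebra R W] [MulSemiringAction G W] [SMulCommClass G R W]

variable (R A W G) in
/-- The action of `G` on the second factor of a tensor product. -/
noncomputable def tensorAction : G →* (A ⊗[R] W →+* A ⊗[R] W) where
  toFun g := (Algebra.TensorProduct.map (AlgHom.id R A)
    (MulSemiringAction.toAlgHom R W g)).toRingHom
  map_one' := by
    have h : MulSemiringAction.toAlgHom R W (1 : G) = AlgHom.id R W := by ext; simp
    rw [h, Algebra.TensorProduct.map_id]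
    rfl
  map_mul' g g' := by
    have h : MulSemiringAction.toAlgHom R W (g * g') =
        (MulSemiringAction.toAlgHom R W g).comp (MulSemiringAction.toAlgHom R W g') := by
      ext; simp [mul_smul]
    rw [h]
    refine RingHom.ext fun e => ?_
    induction e using TensorProduct.induction_on with
    | zero => simp
    | tmul a w => simp
    | add a b ha hb => rw [map_add, map_add, ha, hb]

lemma tensorAction_tmul (g : G) (a : A) (w : W) :
    tensorAction R A W G g (a ⊗ₜ w) = a ⊗ₜ (g • w) := by
  simp [tensorAction]

lemma exists_pow_mul_gtr_eq [Fintype G] {d : R}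
    (hinv : ∀ w : W, (∀ g : G, g • w = w) → ∃ k r, algebraMap R W d ^ k * w = algebraMap R W r)
    (e : A ⊗[R] W) : ∃ k a, (algebraMap R A d ^ k) ⊗ₜ 1 * gtr (tensorAction R A W G) e =
      a ⊗ₜ[R] (1 : W) := by
  induction e using TensorProduct.induction_on with
  | zero => exact ⟨0, 0, by simp [gtr]⟩
  | tmul a w =>
    obtain ⟨k, r, hr⟩ := hinv (∑ g : G, g • w) fun σ => by
      rw [Finset.smul_sum]
      exact Fintype.sum_equiv (Equiv.mulLeft σ) _ _ fun g => by simp [mul_smul]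
    refine ⟨k, r • a, ?_⟩
    have h1 : gtr (tensorAction R A W G) (a ⊗ₜ w) = a ⊗ₜ (∑ g : G, g • w) := by
      simp [gtr, tensorAction_tmul, TensorProduct.tmul_sum]
    rw [h1, Algebra.TensorProduct.tmul_mul_tmul, one_mul, ← map_pow, ← Algebra.smul_def,
      TensorProduct.smul_tmul, Algebra.smul_def (d ^ k), map_pow, hr, Algebra.algebraMap_eq_smul_one,
      TensorProduct.smul_tmul]
  | add e f he hf =>
    obtain ⟨k, a, ha⟩ := he
    obtain ⟨l, b, hb⟩ := hf
    refine ⟨k + l, algebraMap R A d ^ l * a + algebraMap R A d ^ k * b, ?_⟩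
    have h1 : ∀ c c' : A, (c * c') ⊗ₜ[R] (1 : W) = c ⊗ₜ 1 * c' ⊗ₜ 1 := fun c c' => by simp
    rw [gtr_add, TensorProduct.add_tmul, pow_add, h1, h1, h1, ← ha, ← hb]
    ring

/-- The base change of a generically Galois cover. -/
theorem isCover_tensorAction {ι : Type} [Fintype ι] [Finite G] [IsDomain A] [Module.Flat R W]
    (hnt : Nontrivial (A ⊗[R] W)) {d : R} {z : ι → A} {N : ℕ} (hN : 0 < N)
    (hz : (∏ j, z j) ^ N = algebraMap R A d) (hd : IsUnit (algebraMap R W d))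
    (hcard : IsUnit (Nat.card G : R))
    (hinv : ∀ w : W, (∀ g : G, g • w = w) → ∃ k r, algebraMap R W d ^ k * w = algebraMap R W r)
    (hgal : ∃ k, IsDelta (actionHom G W) (intSub (algebraMap R W)) (algebraMap R W d ^ k))
    (htame : ∀ j, ∃ t : R, IsDelta (tensorAction R A W G) (intSub (algebraMap R (A ⊗[R] W)))
      (algebraMap R (A ⊗[R] W) t) ∧ ¬ z j ∣ algebraMap R A t) :
    IsCover (Algebra.TensorProduct.includeLeftRingHom : A →+* A ⊗[R] W) (tensorAction R A W G) z := by
  have := Fintype.ofFinite G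
  have htmul : ∀ r : R, algebraMap R A r ⊗ₜ[R] (1 : W) = 1 ⊗ₜ algebraMap R W r := fun r => by
    rw [Algebra.algebraMap_eq_smul_one, Algebra.algebraMap_eq_smul_one, TensorProduct.smul_tmul]
  have hd' : ∀ k, Algebra.TensorProduct.includeLeftRingHom (R := R) (B := W) (algebraMap R A d ^ k) =
      (1 : A) ⊗ₜ[R] (algebraMap R W d ^ k) := fun k => by
    rw [← map_pow, ← map_pow]
    exact htmul _
  have hR : ∀ r : R, Algebra.TensorProduct.includeLeftRingHom (R := R) (B := W) (algebraMap R A r) =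
      algebraMap R (A ⊗[R] W) r := fun r => rfl
  have hint : ∀ e ∈ intSub (algebraMap R (A ⊗[R] W)),
      e ∈ intSub (Algebra.TensorProduct.includeLeftRingHom : A →+* A ⊗[R] W) := fun e he =>
    isIntegralElem_map_of_comp (algebraMap R A) (RingHom.id _) (fun r => (hR r).symm) he
  constructor
  · refine (injective_iff_map_eq_zero _).mpr fun a ha => ?_
    by_contra hne
    have hflat := Module.Flat.isSMulRegular_of_nonZeroDivisors (M := A ⊗[R] W)
      (mem_nonZeroDivisors_of_ne_zero hne)
    refine one_ne_zero (α := A ⊗[R] W) (hflat ?_)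
    simp only [smul_zero]
    rw [Algebra.TensorProduct.one_def, TensorProduct.smul_tmul', smul_eq_mul, mul_one]
    exact ha
  · intro j
    have h1 : IsUnit (Algebra.TensorProduct.includeLeftRingHom (R := R) (B := W) (∏ j, z j)) := by
      rw [← isUnit_pow_iff hN.ne', ← map_pow, hz]
      have := hd' 1
      rw [pow_one, pow_one] at this
      rw [this]
      exact hd.map (Algebra.TensorProduct.includeRight : W →ₐ[R] A ⊗[R] W)
    rw [map_prod] at h1
    exact isUnit_of_dvd_unit (Finset.dvd_prod_of_mem
      (fun j => Algebra.TensorProduct.includeLeftRingHom (z j)) (Finset.mem_univ j)) h1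
  · intro g a
    simp [tensorAction_tmul]
  · intro e he
    obtain ⟨u, hu⟩ := hcard
    obtain ⟨k, a, ha⟩ := exists_pow_mul_gtr_eq hinv e
    rw [gtr_of_invariant he] at ha
    refine ⟨N * k, algebraMap R A ↑u⁻¹ * a, ?_⟩
    have h2 : algebraMap R (A ⊗[R] W) ↑u⁻¹ * (Fintype.card G : A ⊗[R] W) = 1 := by
      rw [← map_natCast (algebraMap R (A ⊗[R] W)), ← map_mul, ← Nat.card_eq_fintype_card, ← hu,
        Units.inv_mul, map_one]
    rw [pow_mul, ← map_pow, ← map_pow, hz, map_mul, hR]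
    change (algebraMap R A d ^ k) ⊗ₜ[R] (1 : W) * e = _ * a ⊗ₜ[R] (1 : W)
    rw [← ha, mul_left_comm, ← mul_assoc (algebraMap R _ _), h2, one_mul]
  · obtain ⟨k, hk⟩ := hgal
    refine ⟨N * k, ?_⟩
    rw [pow_mul, ← map_pow, ← map_pow, hz, hd']
    exact hk.map (ρ' := tensorAction R A W G)
      (Algebra.TensorProduct.includeRight : W →ₐ[R] A ⊗[R] W).toRingHom
      (fun σ w => by simp [tensorAction_tmul, actionHom_apply]) fun c hc =>
        isIntegralElem_map_of_comp (algebraMap R A) _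
          (fun r => (htmul r).symm) hc
  · intro j
    obtain ⟨t, ht, ht'⟩ := htame j
    exact ⟨algebraMap R A t, ht.map (RingHom.id _) (fun _ _ => rfl) hint, ht'⟩

end TensorAction

section Descent

lemma exists_ringHom_lift {W L E : Type} [CommRing W] [CommRing L] [CommRing E] {j : L →+* E}
    (hj : Function.Injective j) (θ : W →+* E) (h : ∀ w, ∃ l, j l = θ w) :
    ∃ ψ : W →+* L, ∀ w, j (ψ w) = θ w := by
  choose ψ hψ using h
  exact ⟨{ toFun := ψ
           map_one' := hj (by simp [hψ])
           map_zero' := hj (by simp [hψ])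
           map_add' := fun a b => hj (by simp [hψ])
           map_mul' := fun a b => hj (by simp [hψ]) }, hψ⟩

/-- The retraction onto the invariants defined by a section of a cover. -/
def sectionHom {G E : Type} [Group G] [Fintype G] [CommRing E] (ρ : G →* (E →+* E)) (ε : E)
    (h1 : ∀ σ, σ ≠ 1 → ε * ρ σ ε = 0) (h2 : gtr ρ ε = 1) : E →+* E where
  toFun e := gtr ρ (e * ε)
  map_one' := by rw [one_mul, h2]
  map_zero' := by simp [gtr]
  map_add' a b := by rw [add_mul, gtr_add]
  map_mul' a b := by
    have key : ∀ c : E, ε * gtr ρ (c * ε) = ε * (c * ε) := fun c => by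
      classical
      rw [gtr, Finset.mul_sum, Fintype.sum_eq_single 1]
      · simp
      · intro σ hσ
        rw [map_mul, mul_left_comm, h1 σ hσ, mul_zero]
    have hε : ε * ε = ε := by
      have := key 1
      rwa [one_mul, h2, mul_one, eq_comm] at this
    have h3 : a * ε * gtr ρ (b * ε) = a * b * ε := by
      rw [mul_assoc, key, mul_left_comm ε b ε, hε, mul_assoc]
    rw [mul_comm (gtr ρ (a * ε)), ← gtr_mul_of_invariant (fun g => gtr_invariant g (b * ε)),
      mul_comm (gtr ρ (b * ε)), h3]

end Descent

open scoped TensorProduct in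
/-- Tameness of a Galois cover of degree prime to the residue characteristic after adjoining a root
of the branch divisor. -/
theorem exists_isDelta_tensorAction {R S W A G : Type} [CommRing R] [IsDomain R] [IsNoetherianRing R]
    [CommRing S] [Algebra R S] [CommRing W] [IsDomain W] [Algebra S W] [Algebra R W]
    [IsScalarTower R S W] [CommRing A] [Algebra R A] [Group G] [Finite G] [MulSemiringAction G W]
    [SMulCommClass G R W] [IsGaloisGroup G S W] (d : R) (hd0 : d ≠ 0) [IsLocalization.Away d S]
    (hinj : Function.Injective (algebraMap R W)) {ϖ : R} (hϖ : Prime ϖ) (hϖd : ϖ ∣ d) {z : A}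
    (hz : z ^ Nat.card G = algebraMap R A ϖ) (hcard : IsUnit (Nat.card G : R)) :
    ∃ t : R, IsDelta (tensorAction R A W G) (intSub (algebraMap R (A ⊗[R] W)))
      (algebraMap R (A ⊗[R] W) t) ∧ ¬ ϖ ∣ t := by
  have hd : IsUnit (algebraMap R W d) := by
    rw [IsScalarTower.algebraMap_apply R S W]
    exact (IsLocalization.Away.algebraMap_isUnit d).map _
  have : FaithfulSMul R W := (faithfulSMul_iff_algebraMap_injective R W).mpr hinj
  let K := FractionRing R
  let L := FractionRing W
  have : FaithfulSMul R L := (faithfulSMul_iff_algebraMap_injective R L).mpr (by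
    rw [IsScalarTower.algebraMap_eq R W L]
    exact (IsFractionRing.injective W L).comp hinj)
  let : Algebra K L := FractionRing.liftAlgebra R L
  let : MulSemiringAction G L := IsFractionRing.mulSemiringAction G W L
  have hunit : ∀ s : Submonoid.powers d, IsUnit (algebraMap R K s) := by
    rintro ⟨_, k, rfl⟩
    simp only [map_pow]
    exact ((IsUnit.mk0 _ ((map_ne_zero_iff _ (IsFractionRing.injective R K)).mpr hd0)).pow k)
  let : Algebra S K := (IsLocalization.lift (M := Submonoid.powers d) hunit).toAlgebra
  have : IsScalarTower R S K := IsScalarTower.of_algebraMap_eq fun r =>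
    (IsLocalization.lift_eq hunit r).symm
  have : IsFractionRing S K :=
    IsFractionRing.isFractionRing_of_isDomain_of_isLocalization (Submonoid.powers d) S K
  have : IsScalarTower S K L := IsScalarTower.of_algebraMap_eq' (by
    refine IsLocalization.ringHom_ext (Submonoid.powers d) ?_
    ext r
    simp only [RingHom.comp_apply]
    rw [← IsScalarTower.algebraMap_apply R S K, ← IsScalarTower.algebraMap_apply R K L,
      IsScalarTower.algebraMap_apply S W L, ← IsScalarTower.algebraMap_apply R S W,
      ← IsScalarTower.algebraMap_apply R W L])
  have : IsGaloisGroup G K L := IsGaloisGroup.to_isFractionRing G S W K L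
  have htmul : ∀ r : R, (1 : A) ⊗ₜ[R] algebraMap R W r = algebraMap R (A ⊗[R] W) r := fun r => by
    rw [Algebra.TensorProduct.algebraMap_apply, Algebra.algebraMap_eq_smul_one,
      Algebra.algebraMap_eq_smul_one, TensorProduct.smul_tmul]
  refine exists_isDelta_of_isGaloisGroup (K := K) (L := L) (W := W)
    (exists_mul_eq_algebraMap (G := G) (exists_pow_mul_eq_of_invariant (S := S) d) hd)
    (Algebra.TensorProduct.includeRight : W →ₐ[R] A ⊗[R] W).toRingHom htmul
    (fun g w => tensorAction_tmul g 1 w) hϖ ?_ (z := z ⊗ₜ 1) (fun g => ?_) ?_ hcard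
  · rw [← htmul]
    refine IsUnit.map (Algebra.TensorProduct.includeRight : W →ₐ[R] A ⊗[R] W) ?_
    exact isUnit_of_dvd_unit (map_dvd _ hϖd) hd
  · rw [tensorAction_tmul, smul_one]
  · rw [Algebra.TensorProduct.tmul_pow, one_pow, hz]
    rfl

/-- A section of a cover splits it over the complement of the branch divisor. -/
theorem IsCover.exists_ringHom_localization {ι G A E W : Type} [Fintype ι] [Group G] [Fintype G]
    [CommRing A] [CommRing E] [CommRing W] {i : A →+* E} {ρ : G →* (E →+* E)} {z : ι → A}
    (h : IsCover i ρ z) {N : ℕ} (hN : 0 < N) {d : A} (hz : (∏ j, z j) ^ N = d) {ε : E}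
    (h1 : ∀ σ, σ ≠ 1 → ε * ρ σ ε = 0) (h2 : gtr ρ ε = 1) (f : W →+* E) :
    ∃ ψ : W →+* Localization.Away d, ∀ w a, f w = i a → ψ w = algebraMap A _ a := by
  have hunit : IsUnit (i d) := by
    rw [← hz, map_pow]
    exact h.isUnit_prod.pow _
  let ℓ : Localization.Away d →+* E := IsLocalization.Away.lift _ hunit
  have hℓ : ∀ a, ℓ (algebraMap A _ a) = i a := IsLocalization.Away.lift_eq _ hunit
  have hℓinj : Function.Injective ℓ := by
    refine (injective_iff_map_eq_zero _).mpr fun l hl => ?_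
    obtain ⟨⟨a, s⟩, hs⟩ := IsLocalization.surj (Submonoid.powers d) l
    have h3 : i a = 0 := by rw [← hℓ, ← hs, map_mul, hl, zero_mul]
    rw [(map_eq_zero_iff i h.inj).mp h3, map_zero] at hs
    exact (IsLocalization.map_units _ s).mul_left_eq_zero.mp hs
  let θ := sectionHom ρ ε h1 h2
  obtain ⟨ψ, hψ⟩ := exists_ringHom_lift hℓinj (θ.comp f) fun w => by
    obtain ⟨k, a, ha⟩ := h.inv (θ (f w)) fun g => gtr_invariant g _
    refine ⟨algebraMap A _ (a * (∏ j, z j) ^ (k * (N - 1))) *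
      IsLocalization.Away.invSelf d ^ k, ?_⟩
    have h4 : i (∏ j, z j) ^ N * ℓ (IsLocalization.Away.invSelf d) = 1 := by
      rw [← map_pow, hz, ← hℓ, ← map_mul, IsLocalization.Away.mul_invSelf, map_one]
    rw [map_mul, map_pow, hℓ, map_mul, ← ha, map_pow, RingHom.comp_apply]
    have h5 : k + k * (N - 1) = N * k := by
      obtain ⟨M, rfl⟩ := Nat.exists_eq_succ_of_ne_zero hN.ne'
      simp only [Nat.succ_eq_add_one, Nat.add_sub_cancel]
      ring
    calc _ = (i (∏ j, z j) ^ (k + k * (N - 1)) * ℓ (IsLocalization.Away.invSelf d) ^ k) *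
          θ (f w) := by rw [pow_add]; ring
      _ = θ (f w) := by rw [h5, pow_mul, ← mul_pow, h4, one_pow, one_mul]
  refine ⟨ψ, fun w a hw => hℓinj ?_⟩
  rw [hψ, hℓ, RingHom.comp_apply, hw]
  change gtr ρ (i a * ε) = _
  rw [gtr_mul_of_invariant fun g => h.fix g _, h2, mul_one]

/-- A Galois étale cover of the complement of a normal crossings divisor, of invertible degree `N`,
is dominated by the ring obtained by adjoining `N`-th roots of the equations of the divisor. -/
theorem exists_ringHom_kummerRing {R S W G : Type} [CommRing R] [IsLocalRing R] [IsNoetherianRing R]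
    [IsPrecomplete (maximalIdeal R) R] [IsAlgClosed (ResidueField R)] {n m : ℕ}
    {x : Fin n → R} {y : Fin m → R}
    (hspan : Ideal.span (Set.range x ∪ Set.range y) = maximalIdeal R)
    (hdim : ringKrullDim R = (n + m : ℕ)) [CommRing S] [Algebra R S]
    [IsLocalization.Away (∏ j, y j) S] [CommRing W] [IsDomain W] [Algebra S W] [Algebra R W]
    [IsScalarTower R S W] [Algebra.Etale S W] [Module.Finite S W] [Group G] [Finite G]
    [MulSemiringAction G W] [IsGaloisGroup G S W] (hcard : IsUnit (Nat.card G : R)) :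
    ∃ ψ : W →+* Localization.Away (algebraMap R (KummerRing R m y (Nat.card G)) (∏ j, y j)),
      Function.Injective ψ ∧ ∀ a : R, ψ (algebraMap R W a) =
        algebraMap (KummerRing R m y (Nat.card G)) _ (algebraMap R _ a) := by
  have := Fintype.ofFinite G
  have hN : 0 < Nat.card G := Nat.card_pos
  obtain ⟨Z, hZ, hyZ⟩ := exists_isRegularParams_of_span_eq hspan hdim
  have := hZ.isDomain
  have hyp : ∀ j, Prime (y j) := fun j => hZ.prime (hyZ j)
  have hd0 : ∏ j, y j ≠ 0 := Finset.prod_ne_zero_iff.mpr fun j _ => (hyp j).ne_zero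
  have : SMulCommClass G R W := ⟨fun g r w => by
    rw [← algebraMap_smul S r w, ← algebraMap_smul S r (g • w), smul_comm]⟩
  have : Module.Flat R S := IsLocalization.flat S (Submonoid.powers (∏ j, y j))
  have : Module.Flat R W := Module.Flat.trans R S W
  have hRW : Function.Injective (algebraMap R W) := by
    refine (injective_iff_map_eq_zero _).mpr fun r hr => ?_
    by_contra hne
    refine one_ne_zero (α := W) (Module.Flat.isSMulRegular_of_nonZeroDivisors (M := W)
      (mem_nonZeroDivisors_of_ne_zero hne) ?_)
    simp only [smul_zero]
    rwa [← Algebra.algebraMap_eq_smul_one]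
  let A := KummerRing R m y (Nat.card G)
  have : IsLocalRing A := KummerRing.isLocalRing hN hspan
  have : Module.Finite R A := KummerRing.finite hN
  have : IsNoetherianRing A := IsNoetherianRing.of_finite R A
  have : IsPrecomplete (maximalIdeal A) A := KummerRing.isPrecomplete hN hspan
  have : IsAlgClosed (ResidueField A) := KummerRing.isAlgClosed_residueField hN hspan
  obtain ⟨Z', hZ', hrZ'⟩ := KummerRing.exists_isRegularParams (N := Nat.card G) hN hspan hdim
  have : IsDomain A := hZ'.isDomain
  have hRA : Function.Injective (algebraMap R A) := KummerRing.injective_algebraMap hN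
  have hnt : Nontrivial (TensorProduct R A W) := by
    let Ω := AlgebraicClosure (FractionRing W)
    obtain ⟨F, hF, -⟩ := KummerRing.exists_lift_field (y := y) hN
      (((algebraMap (FractionRing W) Ω).comp (algebraMap W _)).comp (algebraMap R W))
    let : Algebra R Ω :=
      (((algebraMap (FractionRing W) Ω).comp (algebraMap W _)).comp (algebraMap R W)).toAlgebra
    let F' : A →ₐ[R] Ω := { F with commutes' := hF }
    let F'' : W →ₐ[R] Ω :=
      { (algebraMap (FractionRing W) Ω).comp (algebraMap W _) with commutes' := fun r => rfl }
    exact (Algebra.TensorProduct.lift F' F'' fun _ _ => Commute.all _ _).toRingHom.domain_nontrivial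
  have hd : IsUnit (algebraMap R W (∏ j, y j)) := by
    rw [IsScalarTower.algebraMap_apply R S W]
    exact (IsLocalization.Away.algebraMap_isUnit _).map _
  have hz : (∏ j, KummerRing.root y (Nat.card G) j) ^ Nat.card G =
      algebraMap R A (∏ j, y j) := by
    rw [← Finset.prod_pow, map_prod]
    exact Finset.prod_congr rfl fun j _ => KummerRing.root_pow j
  have : FaithfulSMul G W := IsGaloisGroup.faithful S
  have hinv := exists_pow_mul_eq_of_invariant (S := S) (W := W) (G := G) (∏ j, y j)
  have hcover := isCover_tensorAction (G := G) hnt hN hz hd hcard hinv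
    (exists_isDelta_pow (S := S) _ (isDelta_one_of_unramified (S := S))) fun j => by
      obtain ⟨t, ht, ht'⟩ := exists_isDelta_tensorAction (S := S) (W := W) (A := A) (G := G)
        (∏ j, y j) hd0 hRW (hyp j) (Finset.dvd_prod_of_mem _ (Finset.mem_univ j))
        (KummerRing.root_pow j) hcard
      exact ⟨t, ht, fun h => ht' (KummerRing.dvd_of_root_dvd hN (hyp j) h)⟩
  have hcardA : IsUnit (Fintype.card G : A) := by
    rw [← Nat.card_eq_fintype_card]
    simpa using hcard.map (algebraMap R A)
  obtain ⟨ε, h1, h2⟩ := hcover.exists_section hZ' hrZ' hcardA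
  let i : A →+* TensorProduct R A W := Algebra.TensorProduct.includeLeftRingHom
  let f : W →+* TensorProduct R A W :=
    (Algebra.TensorProduct.includeRight : W →ₐ[R] TensorProduct R A W).toRingHom
  have hf : ∀ r, f (algebraMap R W r) = i (algebraMap R A r) := fun r =>
    (Algebra.TensorProduct.includeRight : W →ₐ[R] TensorProduct R A W).commutes r
  obtain ⟨ψ, hψ⟩ := hcover.exists_ringHom_localization hN hz h1 h2 f
  have hψR : ∀ a : R, ψ (algebraMap R W a) = algebraMap A _ (algebraMap R A a) := fun a =>
    hψ _ _ (hf a)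
  refine ⟨ψ, (injective_iff_map_eq_zero _).mpr fun w hw => ?_, hψR⟩
  by_contra hne
  obtain ⟨w', r, hr, hww'⟩ := exists_mul_eq_algebraMap (G := G) hinv hd w hne
  have h6 : ψ (algebraMap R W r) = 0 := by rw [← hww', map_mul, hw, zero_mul]
  have h7 : Function.Injective
      (algebraMap A (Localization.Away (algebraMap R A (∏ j, y j)))) :=
    IsLocalization.injective _ (powers_le_nonZeroDivisors_of_noZeroDivisors
      ((map_ne_zero_iff _ hRA).mpr hd0))
  rw [hψR, map_eq_zero_iff _ h7, map_eq_zero_iff _ hRA] at h6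
  exact hr h6

/-- Let `(R, 𝔪)` be a complete regular local ring of mixed characteristic
`(0, p)` with algebraically closed residue field and regular system of parameters
`(x_1, …, x_n, y_1, …, y_m)`, and let `S = R[1/(y_1 ⋯ y_m)]`.  Every Galois étale
extension `W` of `S` of degree prime to `p` embeds (as an `S`-algebra) into
`R_e[1/(y_1 ⋯ y_m)]` for some `e` coprime to `p`, where
`R_e = R[T_1, …, T_m]/(T_i^e − y_i)`:  the maximal prime-to-`p` Galois étale extension of
`S` is generated by the prime-to-`p` roots of the `y_i`. -/
theorem prime_to_p_etale_extensions_generated_by_roots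
    (p : ℕ) (hp : p.Prime)
    (R : Type) [CommRing R] [IsLocalRing R] [IsNoetherianRing R]
    -- `R` is complete
    (hcomplete : IsAdicComplete (IsLocalRing.maximalIdeal R) R)
    -- mixed characteristic `(0, p)`
    [CharZero R] (hres : CharP (IsLocalRing.ResidueField R) p)
    -- algebraically closed residue field
    [IsAlgClosed (IsLocalRing.ResidueField R)]
    -- regular system of parameters `(x_1, …, x_n, y_1, …, y_m)`
    (n m : ℕ) (x : Fin n → R) (y : Fin m → R)
    (hspan : Ideal.span (Set.range x ∪ Set.range y) = IsLocalRing.maximalIdeal R)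
    (hdim : ringKrullDim R = (n + m : ℕ))
    -- `W` is a finite étale `S`-algebra which is a domain, `S = R[1/(y_1 ⋯ y_m)]`
    (W : Type) [CommRing W] [IsDomain W]
    [Algebra (Localization.Away (∏ j, y j)) W]
    [Algebra.Etale (Localization.Away (∏ j, y j)) W]
    [Module.Finite (Localization.Away (∏ j, y j)) W]
    -- a finite group of `S`-algebra automorphisms with fixed ring `S` and
    -- order equal to the degree, prime to `p`
    (G : Subgroup (W ≃ₐ[Localization.Away (∏ j, y j)] W)) [Finite G]
    (hfix : ∀ w : W, (∀ g ∈ G, g w = w) ↔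
      w ∈ (algebraMap (Localization.Away (∏ j, y j)) W).range)
    (hcard : Nat.card G = Module.finrank (Localization.Away (∏ j, y j)) W)
    (hcop : Nat.Coprime (Nat.card G) p) :
    ∃ e : ℕ, 0 < e ∧ Nat.Coprime e p ∧
      ∃ ψ : W →+* Localization.Away ((algebraMap R (KummerRing R m y e)) (∏ j, y j)),
        Function.Injective ψ ∧
        -- `ψ` is an `S`-algebra homomorphism: it is compatible with the canonical maps
        -- from `R` (hence from `S`, by the universal property of localization)
        ∀ a : R,
          ψ (algebraMap (Localization.Away (∏ j, y j)) W
              (algebraMap R (Localization.Away (∏ j, y j)) a)) =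
            algebraMap (KummerRing R m y e)
              (Localization.Away ((algebraMap R (KummerRing R m y e)) (∏ j, y j)))
              (algebraMap R (KummerRing R m y e) a) := by
  let S := Localization.Away (∏ j, y j)
  have hunit : IsUnit (Nat.card G : R) := by
    by_contra h
    have h0 : (Nat.card G : IsLocalRing.ResidueField R) = 0 := by
      rw [← map_natCast (IsLocalRing.residue R), IsLocalRing.residue_eq_zero_iff]
      exact h
    have := Nat.Coprime.eq_one_of_dvd hcop.symm ((CharP.cast_eq_zero_iff _ p _).mp h0)
    exact hp.one_lt.ne' this
  let : Algebra R W := ((algebraMap S W).comp (algebraMap R S)).toAlgebra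
  have : IsScalarTower R S W := IsScalarTower.of_algebraMap_eq fun _ => rfl
  have : IsGaloisGroup G S W :=
    { faithful := inferInstance
      commutes := inferInstance
      isInvariant := ⟨fun w hw => (hfix w).mp fun g hg => hw ⟨g, hg⟩⟩ }
  obtain ⟨ψ, hψ, hψR⟩ := exists_ringHom_kummerRing (S := S) (W := W) (G := G) hspan hdim hunit
  exact ⟨Nat.card G, Nat.card_pos, hcop, ψ, hψ, hψR⟩
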